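/- Let q ≥ 3 be an integer and define Π(s) = ∏_{χ mod q} L(s, χ), the product over all Dirichlet characters modulo q. Then Π(s) has at most one zero ρ = β + it (counted with multiplicity) in the region β ≥ 1 − 1/(R0 · log max{q, q|t|}), β < 1. Moreover, if such a zero exists, it is real and simple, and it is a zero of L(s, χ) for a nonprincipal real Dirichlet character χ modulo q. -/

import Mathlib

/-- The constant `R₀ = 6.3970`. -/
noncomputable def R0 : ℝ := 6.3970
/-- `Π(s) = ∏_{χ mod q} L(s, χ)`. -/
noncomputable def PiProd (q : ℕ) [NeZero q] (s : ℂ) : ℂ :=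
  ∏ χ : DirichletCharacter ℂ q, DirichletCharacter.LFunction χ s


open Complex Filter Topology Metric

/-- zeros of `f` in the closed ball of radius `R` about `c0` -/
noncomputable def zset (f : ℂ → ℂ) (c0 : ℂ) (R : ℝ) : Finset ℂ :=
  open Classical in
  if h : {z | f z = 0 ∧ ‖z - c0‖ ≤ R}.Finite then h.toFinset else ∅

lemma zset_finite {f : ℂ → ℂ} (hf : Differentiable ℂ f) {c0 : ℂ} (h0 : f c0 ≠ 0) (R : ℝ) :
    {z | f z = 0 ∧ ‖z - c0‖ ≤ R}.Finite := by
  have hA : AnalyticOnNhd ℂ f Set.univ := fun z _ => hf.analyticAt z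
  have hcod : f ⁻¹' {0}ᶜ ∈ codiscrete ℂ := by
    have := hA.preimage_zero_mem_codiscrete (x := c0) h0
    simpa using this
  have hfin := (mem_codiscrete'.mp hcod)
  obtain ⟨ho, hd⟩ := hfin
  have hcl : IsClosed (f ⁻¹' {0}ᶜ)ᶜ := ho.isClosed_compl
  have hc : IsCompact ((f ⁻¹' {0}ᶜ)ᶜ ∩ closedBall c0 R) :=
    (isCompact_closedBall c0 R).inter_left hcl
  have := hc.finite (hd.mono Set.inter_subset_left)
  refine this.subset ?_
  rintro z ⟨h1, h2⟩
  refine ⟨by simp [h1], by simpa [dist_eq_norm] using h2⟩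

lemma mem_zset {f : ℂ → ℂ} (hf : Differentiable ℂ f) {c0 : ℂ} (h0 : f c0 ≠ 0) {R : ℝ} {z : ℂ} :
    z ∈ zset f c0 R ↔ f z = 0 ∧ ‖z - c0‖ ≤ R := by
  classical
  unfold zset
  rw [dif_pos (zset_finite hf h0 R)]
  simp

lemma order_ne_top {f : ℂ → ℂ} (hf : Differentiable ℂ f) {c0 : ℂ} (h0 : f c0 ≠ 0) (z : ℂ) :
    analyticOrderAt f z ≠ ⊤ := by
  have hA : AnalyticOnNhd ℂ f Set.univ := fun z _ => hf.analyticAt z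
  refine AnalyticOnNhd.analyticOrderAt_ne_top_of_isPreconnected hA isPreconnected_univ
    (x := c0) (y := z) trivial trivial ?_
  rw [(hf.analyticAt c0).analyticOrderAt_eq_zero.mpr h0]
  simp

lemma factor_one {f : ℂ → ℂ} (hf : Differentiable ℂ f) {c0 : ℂ} (h0 : f c0 ≠ 0) (ρ : ℂ) :
    ∃ g : ℂ → ℂ, Differentiable ℂ g ∧ g ρ ≠ 0 ∧
      ∀ z, f z = (z - ρ) ^ analyticOrderNatAt f ρ * g z := by
  classical
  obtain ⟨g, hg, hg0, he⟩ := ((hf.analyticAt ρ).analyticOrderAt_ne_top).mp (order_ne_top hf h0 ρ)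
  set n := analyticOrderNatAt f ρ
  let G : ℂ → ℂ := fun z => if z = ρ then g ρ else f z / (z - ρ) ^ n
  have hGg : G =ᶠ[𝓝 ρ] g := by
    filter_upwards [he] with z hz
    by_cases h : z = ρ
    · simp [G, h]
    · have : (z - ρ) ^ n ≠ 0 := pow_ne_zero _ (sub_ne_zero.mpr h)
      simp only [G, h, if_false, hz, smul_eq_mul]
      field_simp
  refine ⟨G, ?_, by simpa [G] using hg0, ?_⟩
  · intro z
    by_cases h : z = ρ
    · subst h
      exact (hGg.differentiableAt_iff).mpr hg.differentiableAt
    · have : G =ᶠ[𝓝 z] fun z => f z / (z - ρ) ^ n := by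
        filter_upwards [isOpen_ne.mem_nhds h] with w hw
        simp [G, show w ≠ ρ from hw]
      refine (this.differentiableAt_iff).mpr ?_
      refine (hf z).div (by fun_prop) (pow_ne_zero _ (sub_ne_zero.mpr h))
  · intro z
    by_cases h : z = ρ
    · subst h
      have := he.self_of_nhds
      simpa [G] using this
    · have : (z - ρ) ^ n ≠ 0 := pow_ne_zero _ (sub_ne_zero.mpr h)
      simp only [G, h, if_false]
      field_simp

lemma factor_finset {f : ℂ → ℂ} (hf : Differentiable ℂ f) {c0 : ℂ} (h0 : f c0 ≠ 0)
    (S : Finset ℂ) :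
    ∃ g : ℂ → ℂ, Differentiable ℂ g ∧ (∀ ρ ∈ S, g ρ ≠ 0) ∧
      ∀ z, f z = (∏ ρ ∈ S, (z - ρ) ^ analyticOrderNatAt f ρ) * g z := by
  classical
  induction S using Finset.induction_on with
  | empty => exact ⟨f, hf, by simp, by simp⟩
  | insert ρ S hρ ih =>
    obtain ⟨g, hg, hgS, hfg⟩ := ih
    have hg0 : g c0 ≠ 0 := by
      intro h; apply h0; rw [hfg, h, mul_zero]
    obtain ⟨G, hG, hGρ, hgG⟩ := factor_one hg hg0 ρ
    have hord : analyticOrderNatAt g ρ = analyticOrderNatAt f ρ := by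
      have hP : AnalyticAt ℂ (fun z => ∏ ρ ∈ S, (z - ρ) ^ analyticOrderNatAt f ρ) ρ := by
        refine Differentiable.analyticAt ?_ ρ
        fun_prop
      have hP0 : (∏ ρ' ∈ S, (ρ - ρ') ^ analyticOrderNatAt f ρ') ≠ 0 := by
        refine Finset.prod_ne_zero_iff.mpr fun a ha => pow_ne_zero _ (sub_ne_zero.mpr ?_)
        rintro rfl; exact hρ ha
      have he : f = (fun z => ∏ ρ ∈ S, (z - ρ) ^ analyticOrderNatAt f ρ) * g := by
        ext z; simpa using hfg z
      have : analyticOrderAt f ρ = analyticOrderAt g ρ := by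
        conv_lhs => rw [he]
        rw [analyticOrderAt_mul hP (hg.analyticAt ρ), hP.analyticOrderAt_eq_zero.mpr hP0, zero_add]
      simp [analyticOrderNatAt, this]
    refine ⟨G, hG, ?_, ?_⟩
    · intro r hr
      rcases Finset.mem_insert.mp hr with rfl | hr
      · exact hGρ
      · intro h; apply hgS r hr; rw [hgG, h, mul_zero]
    · intro z
      rw [Finset.prod_insert hρ, hfg z, hgG z, hord]; ring

lemma logDeriv_diff_bound {g : ℂ → ℂ} (hg : Differentiable ℂ g) {c0 : ℂ} {R M : ℝ} (hR : 0 < R)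
    (hM : 0 < M) (hne : ∀ z ∈ ball c0 R, g z ≠ 0)
    (hb : ∀ z ∈ ball c0 R, ‖g z / g c0‖ ≤ Real.exp M) {s s' : ℂ}
    (hs : s ∈ ball c0 (R/8)) (hs' : s' ∈ ball c0 (R/8)) :
    ‖logDeriv g s - logDeriv g s'‖ ≤ 64 * M / R ^ 2 * ‖s - s'‖ := by
  have hc : c0 ∈ ball c0 R := mem_ball_self hR
  have hd : DifferentiableOn ℂ (logDeriv g) (ball c0 R) := by
    intro z hz
    have h1 : DifferentiableAt ℂ (deriv g) z := (hg.analyticAt z).deriv.differentiableAt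
    exact (h1.div (hg z) (hne z hz)).differentiableWithinAt
  obtain ⟨F, hF0, hF⟩ := hd.isExactOn_ball.with_val_at c0 0
  have hgF : ∀ z ∈ ball c0 R, g z = g c0 * Complex.exp (F z) := by
    have key : ∀ z ∈ ball c0 R, g z * Complex.exp (-F z) = g c0 * Complex.exp (-F c0) := by
      intro z hz
      have hD : ∀ w ∈ ball c0 R, HasDerivAt (fun w => g w * Complex.exp (-F w)) 0 w := by
        intro w hw
        have h1 := (hg w).hasDerivAt.mul ((hF w hw).neg.cexp)
        refine HasDerivAt.congr_deriv (f := fun w => g w * Complex.exp (-F w)) h1 ?_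
        have := hne w hw
        have h2 : logDeriv g w = deriv g w / g w := rfl
        rw [h2]
        field_simp
        ring
      exact (convex_ball c0 R).is_const_of_fderivWithin_eq_zero (𝕜 := ℂ)
        (fun w hw => (hD w hw).differentiableAt.differentiableWithinAt)
        (fun w hw => by
          rw [fderivWithin_of_isOpen isOpen_ball hw]
          ext; simp [(hD w hw).deriv]) hz hc
    intro z hz
    have := key z hz
    rw [hF0] at this
    simp only [neg_zero, Complex.exp_zero, mul_one] at this
    rw [← this, mul_assoc, ← Complex.exp_add]; simp
  have hre : ∀ z ∈ ball c0 R, (F z).re ≤ M := by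
    intro z hz
    have h := hb z hz
    rw [hgF z hz, mul_div_cancel_left₀ _ (hne c0 hc), Complex.norm_exp] at h
    exact Real.exp_le_exp.mp h
  have hFd : ∀ z ∈ ball c0 R, DifferentiableAt ℂ F z := fun z hz => (hF z hz).differentiableAt
  have hFb : ∀ z ∈ closedBall c0 (R/2), ‖F z‖ ≤ 2 * M := by
    intro z hz
    have hzz : ‖z - c0‖ ≤ R / 2 := by simpa [dist_eq_norm] using hz
    have h := Complex.borelCaratheodory_zero (f := fun w => F (w + c0)) (z := z - c0) (R := R) hM
      (by
        intro w hw
        have : w + c0 ∈ ball c0 R := by simpa [dist_eq_norm] using hw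
        exact ((hFd _ this).comp w (by fun_prop)).differentiableWithinAt)
      (by
        intro w hw
        have : w + c0 ∈ ball c0 R := by simpa [dist_eq_norm] using hw
        exact hre _ this) hR (by simp; linarith) (by simpa using hF0)
    simp only [sub_add_cancel] at h
    refine h.trans ?_
    rw [div_le_iff₀ (by linarith)]
    nlinarith
  have hF1 : ∀ z ∈ closedBall c0 (R/4), ‖logDeriv g z‖ ≤ 8 * M / R := by
    intro z hz
    have hzz : dist z c0 ≤ R / 4 := hz
    have hsub : closedBall z (R/4) ⊆ closedBall c0 (R/2) :=
      closedBall_subset_closedBall' (by linarith)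
    have hsub2 : closedBall c0 (R/2) ⊆ ball c0 R := closedBall_subset_ball (by linarith)
    have h := Complex.norm_deriv_le_of_forall_mem_sphere_norm_le (c := z) (R := R/4) (C := 2 * M)
      (f := F) (by linarith)
      (DifferentiableOn.diffContOnCl (by
        intro w hw
        refine (hFd w (hsub2 (hsub ?_))).differentiableWithinAt
        rwa [closure_ball _ (by positivity)] at hw))
      (fun w hw => hFb w (hsub (sphere_subset_closedBall hw)))
    rw [(hF z (hsub2 (hsub (mem_closedBall_self (by linarith))))).deriv] at h
    refine h.trans (le_of_eq ?_)
    field_simp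
    ring
  have hF2 : ∀ z ∈ ball c0 (R/8), ‖deriv (logDeriv g) z‖ ≤ 64 * M / R ^ 2 := by
    intro z hz
    have hzz : dist z c0 < R / 8 := hz
    have hsub : closedBall z (R/8) ⊆ closedBall c0 (R/4) :=
      closedBall_subset_closedBall' (by linarith)
    have hsub2 : closedBall c0 (R/4) ⊆ ball c0 R := closedBall_subset_ball (by linarith)
    have h := Complex.norm_deriv_le_of_forall_mem_sphere_norm_le (c := z) (R := R/8)
      (C := 8 * M / R) (f := logDeriv g) (by linarith)
      (DifferentiableOn.diffContOnCl (by
        refine hd.mono ?_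
        rw [closure_ball _ (by positivity)]
        exact hsub.trans hsub2))
      (fun w hw => hF1 w (hsub (sphere_subset_closedBall hw)))
    refine h.trans (le_of_eq ?_)
    field_simp
    ring
  refine (convex_ball c0 (R/8)).norm_image_sub_le_of_norm_deriv_le (𝕜 := ℂ) ?_ hF2 hs' hs
  intro z hz
  exact hd.differentiableAt (isOpen_ball.mem_nhds (ball_subset_ball (by linarith) hz))

theorem hadamard_diff {f : ℂ → ℂ} (hf : Differentiable ℂ f) {c0 : ℂ} (h0 : f c0 ≠ 0)
    (hgr : ∀ ε > 0, ∃ C, ∀ z, ‖f z‖ ≤ C * Real.exp (ε * ‖z - c0‖ ^ 2)) {s s' : ℂ}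
    (hs : f s ≠ 0) (hs' : f s' ≠ 0) :
    Tendsto (fun R : ℝ => ∑ ρ ∈ zset f c0 R,
      (analyticOrderNatAt f ρ : ℂ) * (1 / (s - ρ) - 1 / (s' - ρ))) atTop
      (𝓝 (logDeriv f s - logDeriv f s')) := by
  rw [Metric.tendsto_atTop]
  intro δ hδ
  -- choose ε
  set D := ‖s - s'‖ + 1 with hD
  have hDpos : 0 < D := by positivity
  obtain ⟨C, hC⟩ := hgr (δ / (64 * 4 * 16 * D)) (by positivity)
  set ε := δ / (64 * 4 * 16 * D) with hε
  have hεpos : 0 < ε := by positivity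
  have hCpos : 0 < C := by
    have := hC c0
    have h2 : 0 < ‖f c0‖ := norm_pos_iff.mpr h0
    simp at this; linarith
  set K := |Real.log (C / ‖f c0‖)| with hK
  have hlim : Tendsto (fun R : ℝ => 64 * (16 * ε * R ^ 2 + (K + 1)) / R ^ 2 * D) atTop
      (𝓝 (64 * (16 * ε + 0) * D)) := by
    have h1 : Tendsto (fun R : ℝ => (K + 1) / R ^ 2) atTop (𝓝 0) :=
      tendsto_const_nhds.div_atTop (tendsto_pow_atTop (by norm_num))
    have h2 : Tendsto (fun R : ℝ => 64 * (16 * ε + (K + 1) / R ^ 2) * D) atTop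
      (𝓝 (64 * (16 * ε + 0) * D)) := ((tendsto_const_nhds.add h1).const_mul 64).mul_const D
    refine h2.congr' ?_
    filter_upwards [eventually_gt_atTop 0] with R hR
    field_simp
  have hlt : 64 * (16 * ε + 0) * D < δ := by
    rw [hε]; field_simp; norm_num; linarith
  have hev := (hlim.eventually_lt_const hlt).and (eventually_gt_atTop (8 * (‖s - c0‖ + ‖s' - c0‖) + 1))
  obtain ⟨N, hN⟩ := eventually_atTop.mp hev
  refine ⟨N, fun R hR => ?_⟩
  obtain ⟨hbd, hRbig⟩ := hN R hR
  have hRpos : 0 < R := by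
    have := norm_nonneg (s - c0); have := norm_nonneg (s' - c0); linarith
  set S := zset f c0 R with hS
  obtain ⟨g, hg, hgS, hfg⟩ := factor_finset hf h0 S
  have hgne : ∀ z ∈ closedBall c0 R, g z ≠ 0 := by
    intro z hz hgz
    have hfz : f z = 0 := by rw [hfg, hgz, mul_zero]
    exact hgS z ((mem_zset hf h0).mpr ⟨hfz, by simpa [dist_eq_norm] using hz⟩) hgz
  have hgc : g c0 ≠ 0 := hgne c0 (mem_closedBall_self hRpos.le)
  set M := 16 * ε * R ^ 2 + (K + 1) with hMdef
  have hMpos : 0 < M := by positivity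
  have hsph : ∀ z ∈ frontier (ball c0 (4 * R)), ‖g z / g c0‖ ≤ Real.exp M := by
    intro z hz
    rw [frontier_ball _ (by positivity)] at hz
    have hz' : ‖z - c0‖ = 4 * R := by simpa [dist_eq_norm] using hz
    have hPle : ‖∏ ρ ∈ S, (c0 - ρ) ^ analyticOrderNatAt f ρ‖ ≤
        ‖∏ ρ ∈ S, (z - ρ) ^ analyticOrderNatAt f ρ‖ := by
      rw [norm_prod, norm_prod]
      refine Finset.prod_le_prod (fun _ _ => norm_nonneg _) (fun ρ hρ => ?_)
      rw [norm_pow, norm_pow]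
      have h1 : ‖ρ - c0‖ ≤ R := ((mem_zset hf h0).mp hρ).2
      have h2 : ‖z - c0‖ ≤ ‖z - ρ‖ + ‖ρ - c0‖ := by
        simpa using norm_add_le (z - ρ) (ρ - c0)
      rw [norm_sub_rev c0 ρ]
      gcongr
      linarith
    set P0 := ∏ ρ ∈ S, (c0 - ρ) ^ analyticOrderNatAt f ρ
    set P1 := ∏ ρ ∈ S, (z - ρ) ^ analyticOrderNatAt f ρ
    have e0 : f c0 = P0 * g c0 := hfg c0
    have e1 : f z = P1 * g z := hfg z
    have hP0 : 0 < ‖P0‖ := norm_pos_iff.mpr fun h => h0 (by rw [e0, h, zero_mul])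
    have hle : ‖g z / g c0‖ ≤ ‖f z‖ / ‖f c0‖ := by
      rw [norm_div, e0, e1, norm_mul, norm_mul, div_le_div_iff₀ (norm_pos_iff.mpr hgc)
        (mul_pos hP0 (norm_pos_iff.mpr hgc))]
      have := mul_le_mul_of_nonneg_right hPle (mul_nonneg (norm_nonneg (g z)) (norm_nonneg (g c0)))
      nlinarith
    refine hle.trans ?_
    have hf0 : 0 < ‖f c0‖ := norm_pos_iff.mpr h0
    have h3 : ‖f z‖ / ‖f c0‖ ≤ C / ‖f c0‖ * Real.exp (16 * ε * R ^ 2) := by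
      have := hC z
      rw [hz'] at this
      rw [div_le_iff₀ hf0]
      refine this.trans (le_of_eq ?_)
      rw [show ε * (4 * R) ^ 2 = 16 * ε * R ^ 2 by ring]
      field_simp
    refine h3.trans ?_
    rw [hMdef, Real.exp_add, mul_comm]
    gcongr
    rw [← Real.log_le_iff_le_exp (by positivity)]
    linarith [le_abs_self (Real.log (C / ‖f c0‖))]
  have hball : ∀ z ∈ ball c0 R, ‖g z / g c0‖ ≤ Real.exp M := by
    intro z hz
    refine Complex.norm_le_of_forall_mem_frontier_norm_le (f := fun z => g z / g c0)
      (isBounded_ball (x := c0) (r := 4 * R)) (Differentiable.diffContOnCl (by fun_prop)) hsph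
      (subset_closure (ball_subset_ball (by linarith) hz))
  have h1 : s ∈ ball c0 (R / 8) := by
    have := norm_nonneg (s - c0); have := norm_nonneg (s' - c0)
    simp only [mem_ball, dist_eq_norm]; linarith
  have h2 : s' ∈ ball c0 (R / 8) := by
    have := norm_nonneg (s - c0); have := norm_nonneg (s' - c0)
    simp only [mem_ball, dist_eq_norm]; linarith
  have hmain := logDeriv_diff_bound hg hRpos hMpos
    (fun z hz => hgne z (ball_subset_closedBall hz)) hball h1 h2
  have hlog : ∀ z, f z ≠ 0 → logDeriv f z =
      ∑ ρ ∈ S, (analyticOrderNatAt f ρ : ℂ) * (1 / (z - ρ)) + logDeriv g z := by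
    intro z hz
    have he : f = fun z => (∏ ρ ∈ S, (z - ρ) ^ analyticOrderNatAt f ρ) * g z := funext hfg
    have hne : ∀ ρ ∈ S, z - ρ ≠ 0 := by
      intro ρ hρ h
      rw [sub_eq_zero] at h
      subst h
      exact hz ((mem_zset hf h0).mp hρ).1
    have hne' : ∀ ρ ∈ S, (z - ρ) ^ analyticOrderNatAt f ρ ≠ 0 :=
      fun ρ hρ => pow_ne_zero _ (hne ρ hρ)
    have hgz : g z ≠ 0 := fun h => hz (by rw [hfg, h, mul_zero])
    conv_lhs => rw [he]
    rw [logDeriv_mul z (Finset.prod_ne_zero_iff.mpr hne') hgz (by fun_prop) (hg z)]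
    congr 1
    rw [logDeriv_prod hne' (by intro i _; fun_prop)]
    refine Finset.sum_congr rfl fun ρ hρ => ?_
    rw [logDeriv_fun_pow (by fun_prop)]
    simp [logDeriv_apply]
  rw [hlog s hs, hlog s' hs', dist_eq_norm]
  have hsum : (∑ ρ ∈ S, (analyticOrderNatAt f ρ : ℂ) * (1 / (s - ρ) - 1 / (s' - ρ))) -
      (∑ ρ ∈ S, (analyticOrderNatAt f ρ : ℂ) * (1 / (s - ρ)) + logDeriv g s -
        (∑ ρ ∈ S, (analyticOrderNatAt f ρ : ℂ) * (1 / (s' - ρ)) + logDeriv g s')) =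
      -(logDeriv g s - logDeriv g s') := by
    simp only [mul_sub, Finset.sum_sub_distrib]
    ring
  rw [hsum, norm_neg]
  refine lt_of_le_of_lt (hmain.trans ?_) hbd
  have : ‖s - s'‖ ≤ D := by linarith
  gcongr

open Complex Filter Topology Metric ComplexConjugate

/-- Poisson type kernel -/
noncomputable def gk (p u : ℝ) : ℝ := p / (p ^ 2 + u ^ 2)

/-- smoothed kernel -/
noncomputable def hk (p u : ℝ) : ℝ := gk p u - 136 / 125 * gk (p + 1) u + 3 / 5 * gk (p + 3 / 2) u

/-- symmetrised kernel at `σ` for a zero of real part `β` -/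
noncomputable def Hk (σ β u : ℝ) : ℝ := hk (σ - β) u + hk (σ - 1 + β) u

/-- properties of a completed L-function -/
structure XiLike (f : ℂ → ℂ) : Prop where
  diff : Differentiable ℂ f
  growth : ∀ ε > 0, ∃ C, ∀ z, ‖f z‖ ≤ C * Real.exp (ε * ‖z - 2‖ ^ 2)
  symm : ∃ e : ℂ, e ≠ 0 ∧ ∀ z, f (1 - conj z) = e * conj (f z)
  ne_zero : ∀ z : ℂ, 1 < z.re → f z ≠ 0

noncomputable def Dop (f : ℂ → ℂ) (s : ℂ) : ℝ :=
  (logDeriv f s).re - 136 / 125 * (logDeriv f (s + 1)).re + 3 / 5 * (logDeriv f (s + 3 / 2)).re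

namespace XiLike

variable {f : ℂ → ℂ}

lemma ne_two (hf : XiLike f) : f 2 ≠ 0 := hf.ne_zero 2 (by norm_num)

lemma zero_symm (hf : XiLike f) {ρ : ℂ} (h : f ρ = 0) : f (1 - conj ρ) = 0 := by
  obtain ⟨e, he, hs⟩ := hf.symm
  rw [hs, h]; simp

lemma re_le (hf : XiLike f) {ρ : ℂ} (h : f ρ = 0) : ρ.re ≤ 1 := by
  by_contra hc
  exact hf.ne_zero ρ (by linarith) h

lemma re_ge (hf : XiLike f) {ρ : ℂ} (h : f ρ = 0) : 0 ≤ ρ.re := by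
  have := hf.re_le (hf.zero_symm h)
  simp at this; exact this

lemma deriv_symm (hf : XiLike f) : ∃ e : ℂ, e ≠ 0 ∧ (∀ z, f (1 - conj z) = e * conj (f z)) ∧
    ∀ z, deriv f (1 - conj z) = -(e * conj (deriv f z)) := by
  obtain ⟨e, he, hs⟩ := hf.symm
  refine ⟨e, he, hs, fun z => ?_⟩
  have h1 : HasDerivAt (fun w => f (1 - w)) (-deriv f (1 - conj z)) (conj z) := by
    have := (hf.diff (1 - conj z)).hasDerivAt.comp_const_sub 1 (conj z)
    simpa using this
  have h2 : HasDerivAt (fun w => e * conj (f (conj w))) (e * conj (deriv f z)) (conj z) := by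
    have : HasDerivAt (fun w => conj (f (conj w))) (conj (deriv f z)) (conj z) := by
      have := (hf.diff z).hasDerivAt.conj_conj
      simpa [Function.comp_def] using this
    exact this.const_mul e
  have h3 : (fun w => f (1 - w)) = fun w => e * conj (f (conj w)) := by
    ext w
    have := hs (conj w)
    simpa using this
  rw [h3] at h1
  have := h1.unique h2
  rw [← this]; ring

lemma logDeriv_symm (hf : XiLike f) {s : ℂ} : logDeriv f (1 - conj s) = - conj (logDeriv f s) := by
  obtain ⟨e, he, hs, hd⟩ := hf.deriv_symm
  simp only [logDeriv_apply, hs, hd, map_div₀]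
  rw [neg_div, mul_div_mul_left _ _ he]

lemma re_kernel (s ρ : ℂ) : (1 / (s - ρ) - 1 / (1 - conj s - ρ)).re =
    gk (s.re - ρ.re) (s.im - ρ.im) + gk (s.re - 1 + ρ.re) (s.im - ρ.im) := by
  have e : (1 - conj s - ρ).re = -(s.re - 1 + ρ.re) := by simp; ring
  have e2 : (1 - conj s - ρ).im = s.im - ρ.im := by simp
  simp only [one_div, Complex.sub_re, Complex.inv_re, gk, normSq_apply] at *
  rw [e, e2]
  simp only [Complex.sub_im]
  rw [neg_div, sub_neg_eq_add]
  congr 2 <;> ring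

lemma tendsto_re (hf : XiLike f) {s : ℂ} (hs : 1 < s.re) :
    Tendsto (fun R : ℝ => ∑ ρ ∈ zset f 2 R, (analyticOrderNatAt f ρ : ℝ) *
      (gk (s.re - ρ.re) (s.im - ρ.im) + gk (s.re - 1 + ρ.re) (s.im - ρ.im))) atTop
      (𝓝 (2 * (logDeriv f s).re)) := by
  have h1 : f s ≠ 0 := hf.ne_zero s hs
  have h2 : f (1 - conj s) ≠ 0 := by
    obtain ⟨e, he, hsy⟩ := hf.symm
    rw [hsy]; exact mul_ne_zero he (by simpa using h1)
  have h := hadamard_diff hf.diff hf.ne_two hf.growth h1 h2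
  have h' := (Complex.continuous_re.tendsto _).comp h
  rw [hf.logDeriv_symm] at h'
  have e : (logDeriv f s - -conj (logDeriv f s)).re = 2 * (logDeriv f s).re := by
    simp; ring
  rw [e] at h'
  refine h'.congr fun R => ?_
  simp only [Function.comp_def, Complex.re_sum]
  refine Finset.sum_congr rfl fun ρ _ => ?_
  rw [← re_kernel]
  simp only [Complex.mul_re, Complex.natCast_re, Complex.natCast_im, zero_mul, sub_zero]

lemma tendsto_D (hf : XiLike f) {s : ℂ} (hs : 1 < s.re) :
    Tendsto (fun R : ℝ => ∑ ρ ∈ zset f 2 R, (analyticOrderNatAt f ρ : ℝ) *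
      Hk s.re ρ.re (s.im - ρ.im)) atTop (𝓝 (2 * Dop f s)) := by
  have h1 := hf.tendsto_re hs
  have h2 := hf.tendsto_re (s := s + 1) (by simp; linarith)
  have h3 := hf.tendsto_re (s := s + 3 / 2) (by simp; linarith)
  have h := (h1.sub (h2.const_mul (136 / 125))).add (h3.const_mul (3 / 5))
  have e : 2 * (logDeriv f s).re - 136 / 125 * (2 * (logDeriv f (s + 1)).re) +
    3 / 5 * (2 * (logDeriv f (s + 3 / 2)).re) = 2 * Dop f s := by
    unfold Dop; ring
  rw [e] at h
  refine h.congr fun R => ?_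
  simp only [Finset.mul_sum, ← Finset.sum_sub_distrib, ← Finset.sum_add_distrib]
  refine Finset.sum_congr rfl fun ρ _ => ?_
  have e1 : (s + 3 / 2).re = s.re + 3 / 2 := by simp
  have e2 : (s + 3 / 2).im = s.im := by simp
  rw [e1, e2]
  simp only [Complex.add_re, Complex.add_im, Complex.one_re, Complex.one_im, add_zero, Hk, hk]
  rw [show s.re + 1 - ρ.re = s.re - ρ.re + 1 by ring,
    show s.re + 1 - 1 + ρ.re = s.re - 1 + ρ.re + 1 by ring,
    show s.re + 3 / 2 - ρ.re = s.re - ρ.re + 3 / 2 by ring,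
    show s.re + 3 / 2 - 1 + ρ.re = s.re - 1 + ρ.re + 3 / 2 by ring]
  ring

/-- lower bound for the multiplicity -/
lemma order_ge (hf : XiLike f) {ρ : ℂ} (h : f ρ = 0) :
    (if deriv f ρ = 0 then 2 else 1 : ℕ) ≤ analyticOrderNatAt f ρ := by
  have ht := order_ne_top hf.diff hf.ne_two ρ
  have hA := hf.diff.analyticAt ρ
  suffices ((if deriv f ρ = 0 then 2 else 1 : ℕ) : ℕ∞) ≤ analyticOrderAt f ρ by
    rw [← Nat.cast_analyticOrderNatAt ht] at this
    exact_mod_cast this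
  rw [natCast_le_analyticOrderAt_iff_iteratedDeriv_eq_zero hA]
  intro i hi
  split_ifs at hi with hd
  · interval_cases i
    · simpa using h
    · simpa [iteratedDeriv_one] using hd
  · interval_cases i
    simpa using h

theorem D_ge (hf : XiLike f) {s : ℂ} (hs : 1 < s.re) (W : Finset ℂ) (hW : ∀ ρ ∈ W, f ρ = 0)
    (hWre : ∀ ρ ∈ W, 1 / 2 < ρ.re)
    (hpos : ∀ β u : ℝ, 0 ≤ β → β ≤ 1 → 0 ≤ Hk s.re β u) :
    ∑ ρ ∈ W, ((if deriv f ρ = 0 then 2 else 1 : ℕ) : ℝ) * Hk s.re ρ.re (s.im - ρ.im)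
      ≤ Dop f s := by
  classical
  set n : ℂ → ℕ := fun ρ => if deriv f ρ = 0 then 2 else 1 with hn
  let φ : ℂ → ℂ := fun ρ => 1 - conj ρ
  have hφinj : Function.Injective φ := by
    intro a b hab
    have := congrArg conj (show conj a = conj b by simpa [φ] using hab)
    simpa using this
  set V := W ∪ W.image φ with hV
  have hdisj : Disjoint W (W.image φ) := by
    rw [Finset.disjoint_left]
    intro a ha hb
    obtain ⟨b, hb', rfl⟩ := Finset.mem_image.mp hb
    have h1 := hWre _ ha
    have h2 := hWre _ hb'
    simp [φ] at h1; linarith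
  have hVz : ∀ ρ ∈ V, f ρ = 0 := by
    intro ρ hρ
    rcases Finset.mem_union.mp hρ with h | h
    · exact hW ρ h
    · obtain ⟨b, hb, rfl⟩ := Finset.mem_image.mp h
      exact hf.zero_symm (hW b hb)
  have hnφ : ∀ ρ, n (φ ρ) = n ρ := by
    intro ρ
    obtain ⟨e, he, hsy, hd⟩ := hf.deriv_symm
    simp only [hn, φ, hd]
    simp [he]
  have hsum : ∑ ρ ∈ V, (n ρ : ℝ) * Hk s.re ρ.re (s.im - ρ.im) =
      2 * ∑ ρ ∈ W, (n ρ : ℝ) * Hk s.re ρ.re (s.im - ρ.im) := by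
    rw [hV, Finset.sum_union hdisj, Finset.sum_image (fun a _ b _ h => hφinj h), two_mul]
    congr 1
    refine Finset.sum_congr rfl fun ρ _ => ?_
    rw [hnφ]
    congr 1
    simp only [φ, Hk, Complex.sub_re, Complex.one_re, Complex.conj_re, Complex.sub_im,
      Complex.one_im, Complex.conj_im]
    rw [show s.re - (1 - ρ.re) = s.re - 1 + ρ.re by ring,
      show s.re - 1 + (1 - ρ.re) = s.re - ρ.re by ring]
    rw [show s.im - (0 - -ρ.im) = s.im - ρ.im by ring]
    ring
  have hle : ∑ ρ ∈ V, (n ρ : ℝ) * Hk s.re ρ.re (s.im - ρ.im) ≤ 2 * Dop f s := by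
    refine ge_of_tendsto (hf.tendsto_D hs) ?_
    obtain ⟨B, hB⟩ := (V.finite_toSet.image (fun ρ => ‖ρ - 2‖)).bddAbove
    filter_upwards [eventually_ge_atTop B] with R hR
    have hsub : V ⊆ zset f 2 R := by
      intro ρ hρ
      refine (mem_zset hf.diff hf.ne_two).mpr ⟨hVz ρ hρ, ?_⟩
      exact (hB ⟨ρ, hρ, rfl⟩).trans hR
    have hnonneg : ∀ ρ, f ρ = 0 → 0 ≤ Hk s.re ρ.re (s.im - ρ.im) := fun ρ hρ =>
      hpos _ _ (hf.re_ge hρ) (hf.re_le hρ)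
    calc ∑ ρ ∈ V, (n ρ : ℝ) * Hk s.re ρ.re (s.im - ρ.im)
        ≤ ∑ ρ ∈ V, (analyticOrderNatAt f ρ : ℝ) * Hk s.re ρ.re (s.im - ρ.im) := by
          refine Finset.sum_le_sum fun ρ hρ => ?_
          have h1 : (n ρ : ℝ) ≤ analyticOrderNatAt f ρ := by
            exact_mod_cast hf.order_ge (hVz ρ hρ)
          exact mul_le_mul_of_nonneg_right h1 (hnonneg ρ (hVz ρ hρ))
      _ ≤ _ := by
          refine Finset.sum_le_sum_of_subset_of_nonneg hsub fun ρ hρ _ => ?_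
          exact mul_nonneg (by positivity) (hnonneg ρ ((mem_zset hf.diff hf.ne_two).mp hρ).1)
  rw [hsum] at hle
  linarith

end XiLike

open Complex Filter Topology Metric ComplexConjugate

noncomputable def dhat (l u : ℝ) : ℝ :=
  -(11 / 125) * gk (1 + l) u - 136 / 125 * gk (2 + l) u
    + 3 / 5 * (gk (3 / 2 + l) u + gk (5 / 2 + l) u)

lemma dhat_eq (l u : ℝ) (hl : 0 ≤ l) : dhat l u =
    ((9 / 20 + 54 / 25 * l + 7769 / 2000 * l ^ 2 + 7189 / 2000 * l ^ 3 + 507 / 250 * l ^ 4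
      + 98 / 125 * l ^ 5 + 1 / 5 * l ^ 6 + 3 / 125 * l ^ 7 + 2549 / 2000 * (u ^ 2)
      + 2389 / 2000 * (u ^ 2) * l + 97 / 125 * (u ^ 2) * l ^ 2 + 129 / 125 * (u ^ 2) * l ^ 3
      + 67 / 125 * (u ^ 2) * l ^ 4 + 9 / 125 * (u ^ 2) * l ^ 5 + (-193 / 250) * (u ^ 2) ^ 2
      + 31 / 125 * (u ^ 2) ^ 2 * l + 59 / 125 * (u ^ 2) ^ 2 * l ^ 2
      + 9 / 125 * (u ^ 2) ^ 2 * l ^ 3 + 17 / 125 * (u ^ 2) ^ 3 + 3 / 125 * (u ^ 2) ^ 3 * l)) /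
    (((1 + l) ^ 2 + u ^ 2) * ((2 + l) ^ 2 + u ^ 2) * ((3 / 2 + l) ^ 2 + u ^ 2)
      * ((5 / 2 + l) ^ 2 + u ^ 2)) := by
  unfold dhat gk
  have h1 : (1 + l) ^ 2 + u ^ 2 ≠ 0 := by positivity
  have h2 : (2 + l) ^ 2 + u ^ 2 ≠ 0 := by positivity
  have h3 : (3 / 2 + l) ^ 2 + u ^ 2 ≠ 0 := by positivity
  have h4 : (5 / 2 + l) ^ 2 + u ^ 2 ≠ 0 := by positivity
  rw [eq_div_iff (by positivity)]
  generalize ha : (1 + l) ^ 2 + u ^ 2 = a at *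
  generalize hb : (2 + l) ^ 2 + u ^ 2 = b at *
  generalize hc : (3 / 2 + l) ^ 2 + u ^ 2 = c at *
  generalize hd : (5 / 2 + l) ^ 2 + u ^ 2 = d at *
  field_simp
  subst ha hb hc hd
  ring

lemma dhat_nonneg (l u : ℝ) (hl : 0 ≤ l) : 0 ≤ dhat l u := by
  rw [dhat_eq l u hl]
  apply div_nonneg _ (by positivity)
  generalize hx : u ^ 2 = x
  have hx0 : 0 ≤ x := by rw [← hx]; positivity
  have h1 : 0 ≤ 9 / 20 + 2549 / 2000 * x + (-193 / 250) * x ^ 2 + 17 / 125 * x ^ 3 := by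
    nlinarith [mul_nonneg hx0 (sq_nonneg (x - 2838 / 1000)), mul_nonneg hx0 hx0]
  have h2 : 0 ≤ 54 / 25 * l + 7769 / 2000 * l ^ 2 + 7189 / 2000 * l ^ 3 + 507 / 250 * l ^ 4
      + 98 / 125 * l ^ 5 + 1 / 5 * l ^ 6 + 3 / 125 * l ^ 7
      + 2389 / 2000 * x * l + 97 / 125 * x * l ^ 2 + 129 / 125 * x * l ^ 3
      + 67 / 125 * x * l ^ 4 + 9 / 125 * x * l ^ 5
      + 31 / 125 * x ^ 2 * l + 59 / 125 * x ^ 2 * l ^ 2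
      + 9 / 125 * x ^ 2 * l ^ 3 + 3 / 125 * x ^ 3 * l := by positivity
  linarith

lemma half_nonneg (l u : ℝ) (hl : 0 ≤ l) : 0 ≤ gk (1 / 2 + l) u - 2 * (136 / 125) *
    gk (1 / 2 + l + 1) u + 2 * (3 / 5) * gk (1 / 2 + l + 3 / 2) u + 4 / 25 := by
  have e : gk (1 / 2 + l) u - 2 * (136 / 125) *
    gk (1 / 2 + l + 1) u + 2 * (3 / 5) * gk (1 / 2 + l + 3 / 2) u + 4 / 25 =
    (1473 / 500 + 11159 / 1000 * l + 14647 / 1000 * l ^ 2 + 5119 / 500 * l ^ 3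
      + 1159 / 250 * l ^ 4 + 163 / 125 * l ^ 5 + 4 / 25 * l ^ 6 + (-3057 / 1000) * u ^ 2
      + 711 / 500 * u ^ 2 * l + 664 / 125 * u ^ 2 * l ^ 2 + 326 / 125 * u ^ 2 * l ^ 3
      + 12 / 25 * u ^ 2 * l ^ 4 + 169 / 250 * (u ^ 2) ^ 2 + 163 / 125 * (u ^ 2) ^ 2 * l
      + 12 / 25 * (u ^ 2) ^ 2 * l ^ 2 + 4 / 25 * (u ^ 2) ^ 3) /
    (((1 / 2 + l) ^ 2 + u ^ 2) * ((1 / 2 + l + 1) ^ 2 + u ^ 2)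
      * ((1 / 2 + l + 3 / 2) ^ 2 + u ^ 2)) := by
    unfold gk
    have h1 : (1 / 2 + l) ^ 2 + u ^ 2 ≠ 0 := by positivity
    have h2 : (1 / 2 + l + 1) ^ 2 + u ^ 2 ≠ 0 := by positivity
    have h3 : (1 / 2 + l + 3 / 2) ^ 2 + u ^ 2 ≠ 0 := by positivity
    rw [eq_div_iff (by positivity)]
    generalize ha : (1 / 2 + l) ^ 2 + u ^ 2 = a at *
    generalize hb : (1 / 2 + l + 1) ^ 2 + u ^ 2 = b at *
    generalize hc : (1 / 2 + l + 3 / 2) ^ 2 + u ^ 2 = c at *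
    field_simp
    subst ha hb hc
    ring
  rw [e]
  apply div_nonneg _ (by positivity)
  generalize hx : u ^ 2 = x
  have hx0 : 0 ≤ x := by rw [← hx]; positivity
  have h1 : 0 ≤ 1473 / 500 + (-3057 / 1000) * x + 169 / 250 * x ^ 2 + 4 / 25 * x ^ 3 := by
    nlinarith [mul_nonneg hx0 (sq_nonneg (x - 3 / 2)), sq_nonneg (x - 3 / 2)]
  have h2 : 0 ≤ 11159 / 1000 * l + 14647 / 1000 * l ^ 2 + 5119 / 500 * l ^ 3
      + 1159 / 250 * l ^ 4 + 163 / 125 * l ^ 5 + 4 / 25 * l ^ 6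
      + 711 / 500 * x * l + 664 / 125 * x * l ^ 2 + 326 / 125 * x * l ^ 3
      + 12 / 25 * x * l ^ 4 + 163 / 125 * x ^ 2 * l
      + 12 / 25 * x ^ 2 * l ^ 2 := by positivity
  linarith

lemma strip_pos {a b : ℝ} (hab : a < b) {G : ℂ → ℂ}
    (hd : ∀ z : ℂ, a ≤ z.re → z.re ≤ b → DifferentiableAt ℂ G z) {B : ℝ}
    (hB : ∀ z : ℂ, a ≤ z.re → z.re ≤ b → -B ≤ (G z).re)
    (ha : ∀ z : ℂ, z.re = a → 0 ≤ (G z).re) (hb : ∀ z : ℂ, z.re = b → 0 ≤ (G z).re) {z : ℂ}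
    (hz1 : a ≤ z.re) (hz2 : z.re ≤ b) : 0 ≤ (G z).re := by
  have key : ‖Complex.exp (-G z)‖ ≤ 1 := by
    refine PhragmenLindelof.vertical_strip (a := a) (b := b) (f := fun z => Complex.exp (-G z))
      ?_ ?_ ?_ ?_ hz1 hz2
    · refine DifferentiableOn.diffContOnCl ?_
      intro w hw
      have hw' : w ∈ re ⁻¹' (Set.Icc a b) := by
        have : closure (re ⁻¹' Set.Ioo a b) ⊆ re ⁻¹' Set.Icc a b :=
          closure_minimal (Set.preimage_mono Set.Ioo_subset_Icc_self)
            (isClosed_Icc.preimage Complex.continuous_re)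
        exact this hw
      exact ((hd w hw'.1 hw'.2).neg.cexp).differentiableWithinAt
    · refine ⟨0, by have := sub_pos.mpr hab; positivity, 0, ?_⟩
      refine Asymptotics.IsBigO.of_bound (Real.exp B) ?_
      refine Filter.Eventually.filter_mono inf_le_right ?_
      rw [eventually_principal]
      intro w hw
      simp only [Complex.norm_exp, Complex.neg_re, zero_mul, Real.exp_zero]
      simp only [norm_one, mul_one]
      exact Real.exp_le_exp.mpr (by have := hB w hw.1.le hw.2.le; linarith)
    · intro w hw
      simp only [Complex.norm_exp, Complex.neg_re]
      exact Real.exp_le_one_iff.mpr (by have := ha w hw; linarith)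
    · intro w hw
      simp only [Complex.norm_exp, Complex.neg_re]
      exact Real.exp_le_one_iff.mpr (by have := hb w hw; linarith)
  rw [Complex.norm_exp, Real.exp_le_one_iff, Complex.neg_re] at key
  linarith

lemma gk_le (p u : ℝ) (hp : 0 < p) : gk p u ≤ 1 / p := by
  unfold gk
  rw [div_le_div_iff₀ (by positivity) hp]
  nlinarith [sq_nonneg u]

lemma gk_nonneg (p u : ℝ) (hp : 0 ≤ p) : 0 ≤ gk p u := by
  unfold gk; positivity

lemma gk_neg (p u : ℝ) : gk p (-u) = gk p u := by simp [gk]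

lemma hk_neg (p u : ℝ) : hk p (-u) = hk p u := by simp [hk, gk_neg]

lemma re_inv_eq (z : ℂ) : (1 / z).re = gk z.re z.im := by
  simp only [one_div, Complex.inv_re, gk, normSq_apply]
  ring_nf

lemma hk_ge (p u : ℝ) (hp : 0 ≤ p) : -(136 / 125) ≤ hk p u := by
  unfold hk
  have h1 := gk_nonneg p u hp
  have h2 := gk_nonneg (p + 3 / 2) u (by linarith)
  have h3 := gk_le (p + 1) u (by linarith)
  have h4 : 1 / (p + 1) ≤ 1 := by rw [div_le_one (by linarith)]; linarith
  linarith

/-- positivity of the symmetrised kernel -/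
theorem Hk_nonneg {l β u : ℝ} (hl : 0 < l) (h0 : 0 ≤ β) (h1 : β ≤ 1) : 0 ≤ Hk (1 + l) β u := by
  let K : ℂ → ℂ := fun z => 1 / z - ((136 / 125 : ℝ) : ℂ) * (1 / (z + 1))
    + ((3 / 5 : ℝ) : ℂ) * (1 / (z + ((3 / 2 : ℝ) : ℂ)))
  have hK : ∀ z, (K z).re = hk z.re z.im := by
    intro z
    simp only [K, hk, Complex.add_re, Complex.sub_re, Complex.re_ofReal_mul, re_inv_eq,
      Complex.add_im, Complex.one_re, Complex.one_im, Complex.ofReal_re, Complex.ofReal_im,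
      add_zero]
  have hKd : ∀ z : ℂ, 0 < z.re → DifferentiableAt ℂ K z := by
    intro z hz
    have a1 : z ≠ 0 := by rintro rfl; simp at hz
    have a2 : z + 1 ≠ 0 := by
      intro h
      have := congrArg Complex.re h; simp at this; linarith
    have a3 : z + ((3 / 2 : ℝ) : ℂ) ≠ 0 := by
      intro h
      have := congrArg Complex.re h
      rw [Complex.add_re, Complex.ofReal_re, Complex.zero_re] at this; linarith
    fun_prop (disch := assumption)
  let G : ℂ → ℂ := fun z => K (l + z) + K (1 + l - z)
  have hG : ∀ z, (G z).re = Hk (1 + l) z.re z.im := by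
    intro z
    simp only [G, Complex.add_re, hK, Hk, Complex.sub_re, Complex.add_im, Complex.sub_im,
      Complex.ofReal_re, Complex.ofReal_im, Complex.one_re, Complex.one_im]
    rw [show (0:ℝ) + 0 - z.im = -z.im by ring, hk_neg]
    rw [show 1 + l - 1 + z.re = l + z.re by ring, zero_add]
    ring
  have hedge : ∀ u, 0 ≤ Hk (1 + l) 0 u := by
    intro u
    have h1 := dhat_nonneg l u hl.le
    have h2 := gk_nonneg l u hl.le
    have e : Hk (1 + l) 0 u = gk l u + dhat l u := by
      unfold Hk hk dhat
      rw [show 1 + l - 0 = 1 + l by ring, show 1 + l - 1 + 0 = l by ring,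
        show 1 + l + 1 = 2 + l by ring, show 1 + l + 3 / 2 = 5 / 2 + l by ring,
        show l + 1 = 1 + l by ring, show l + 3 / 2 = 3 / 2 + l by ring]
      ring
    linarith
  have := strip_pos (a := 0) (b := 1) (by norm_num) (G := G) (B := 2 * (136 / 125))
    (by
      intro z hz1 hz2
      refine DifferentiableAt.add ?_ ?_
      · exact (hKd _ (by simp; linarith)).comp z (by fun_prop)
      · exact (hKd _ (by simp; linarith)).comp z (by fun_prop))
    (by
      intro z hz1 hz2
      rw [hG]
      have h1 := hk_ge (1 + l - z.re) z.im (by linarith)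
      have h2 := hk_ge (1 + l - 1 + z.re) z.im (by linarith)
      unfold Hk; linarith)
    (by intro z hz; rw [hG, hz]; exact hedge _)
    (by
      intro z hz; rw [hG, hz]
      have := hedge z.im
      unfold Hk at *
      rw [show 1 + l - 1 + 1 = 1 + l - 0 by ring, show 1 + l - 1 = 1 + l - 1 + 0 by ring]
      linarith)
    (z := ⟨β, u⟩) h0 h1
  rw [hG] at this
  exact this

/-- lower bound of the kernel near the edge -/
theorem Hk_lower {l η u : ℝ} (hl : 0 < l) (h0 : 0 ≤ η) (h1 : η ≤ 1 / 2) :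
    gk (l + η) u - 8 / 25 * η ≤ Hk (1 + l) (1 - η) u := by
  let G : ℂ → ℂ := fun z => - (((136 / 125 : ℝ) : ℂ) * (1 / (z + ((l + 1 : ℝ) : ℂ))))
    + ((3 / 5 : ℝ) : ℂ) * (1 / (z + ((l + 3 / 2 : ℝ) : ℂ)))
    + 1 / (((1 + l : ℝ) : ℂ) - z) - ((136 / 125 : ℝ) : ℂ) * (1 / (((2 + l : ℝ) : ℂ) - z))
    + ((3 / 5 : ℝ) : ℂ) * (1 / (((5 / 2 + l : ℝ) : ℂ) - z)) + ((8 / 25 : ℝ) : ℂ) * z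
  have hG : ∀ z, (G z).re = Hk (1 + l) (1 - z.re) z.im - gk (l + z.re) z.im + 8 / 25 * z.re := by
    intro z
    simp only [G, Complex.add_re, Complex.neg_re, Complex.sub_re, Complex.re_ofReal_mul,
      re_inv_eq, Complex.add_im, Complex.sub_im, Complex.ofReal_re, Complex.ofReal_im, zero_sub,
      add_zero, gk_neg, Hk, hk]
    rw [show 1 + l - (1 - z.re) = l + z.re by ring, show 1 + l - 1 + (1 - z.re) = 1 + l - z.re by ring,
      show z.re + (l + 1) = l + z.re + 1 by ring, show z.re + (l + 3 / 2) = l + z.re + 3 / 2 by ring,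
      show 2 + l - z.re = 1 + l - z.re + 1 by ring,
      show 5 / 2 + l - z.re = 1 + l - z.re + 3 / 2 by ring]
    ring
  have hne : ∀ w : ℂ, 0 < w.re → w ≠ 0 := by
    rintro w hw rfl; simp at hw
  have := strip_pos (a := 0) (b := 1 / 2) (by norm_num) (G := G) (B := 3)
    (by
      intro z hz1 hz2
      have a1 : z + ((l + 1 : ℝ) : ℂ) ≠ 0 := hne _ (by rw [add_re, ofReal_re]; linarith)
      have a2 : z + ((l + 3 / 2 : ℝ) : ℂ) ≠ 0 := hne _ (by rw [add_re, ofReal_re]; linarith)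
      have a3 : ((1 + l : ℝ) : ℂ) - z ≠ 0 := hne _ (by rw [sub_re, ofReal_re]; linarith)
      have a4 : ((2 + l : ℝ) : ℂ) - z ≠ 0 := hne _ (by rw [sub_re, ofReal_re]; linarith)
      have a5 : ((5 / 2 + l : ℝ) : ℂ) - z ≠ 0 := hne _ (by rw [sub_re, ofReal_re]; linarith)
      simp only [G]
      fun_prop (disch := assumption))
    (by
      intro z hz1 hz2
      rw [hG]
      unfold Hk
      have h2 := hk_ge (1 + l - 1 + (1 - z.re)) z.im (by linarith)
      unfold hk at *
      rw [show 1 + l - (1 - z.re) = l + z.re by ring]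
      have h3 := gk_le (l + z.re + 1) z.im (by linarith)
      have h4 : 1 / (l + z.re + 1) ≤ 1 := by rw [div_le_one (by linarith)]; linarith
      have h5 := gk_nonneg (l + z.re + 3 / 2) z.im (by linarith)
      linarith)
    (by
      intro z hz; rw [hG, hz]
      have h := dhat_nonneg l z.im hl.le
      unfold dhat at h
      unfold Hk hk
      rw [show 1 + l - (1 - 0) = l by ring, show 1 + l - 1 + (1 - 0) = 1 + l by ring,
        show 1 + l + 1 = 2 + l by ring, show 1 + l + 3 / 2 = 5 / 2 + l by ring,
        show l + 1 = 1 + l by ring, show l + 3 / 2 = 3 / 2 + l by ring, add_zero]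
      linarith)
    (by
      intro z hz; rw [hG, hz]
      have h := half_nonneg l z.im hl.le
      unfold Hk hk
      rw [show 1 + l - (1 - 1 / 2) = 1 / 2 + l by ring,
        show 1 + l - 1 + (1 - 1 / 2) = 1 / 2 + l by ring, show l + 1 / 2 = 1 / 2 + l by ring]
      linarith)
    (z := ⟨η, u⟩) h0 h1
  rw [hG] at this
  simp only at this
  linarith

open Complex Filter Topology Metric ComplexConjugate

lemma log_ratio_bounds (k : ℕ) : 1 / ((k : ℝ) + 2) ≤ Real.log (1 + 1 / ((k : ℝ) + 1)) ∧
    Real.log (1 + 1 / ((k : ℝ) + 1)) ≤ 1 / ((k : ℝ) + 1) := by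
  have hk : (0 : ℝ) ≤ k := Nat.cast_nonneg k
  have hp : (0 : ℝ) < 1 + 1 / ((k : ℝ) + 1) := by positivity
  constructor
  · have := Real.one_sub_inv_le_log_of_pos hp
    refine le_trans (le_of_eq ?_) this
    field_simp
    ring
  · have := Real.log_le_sub_one_of_pos hp
    linarith

theorem digamma_tendsto {z : ℂ} (hz : 0 < z.re) :
    Tendsto (fun n : ℕ => Complex.digamma (z + 1 + n) - (Real.log ((n : ℝ) + 1) : ℂ)) atTop
      (𝓝 0) := by
  let g : ℕ → ℂ → ℂ := fun k w => w * (Real.log (1 + 1 / ((k : ℝ) + 1)) : ℂ)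
    - Complex.log (1 + w / ((k : ℂ) + 1))
  let g' : ℕ → ℂ → ℂ := fun k w => (Real.log (1 + 1 / ((k : ℝ) + 1)) : ℂ)
    - 1 / (w + 1 + k)
  set B : ℝ := ‖z‖ + 2 with hB
  let t : Set ℂ := {w | 0 < w.re} ∩ ball 0 B
  have ht : IsOpen t := (isOpen_lt continuous_const Complex.continuous_re).inter isOpen_ball
  have htc : IsPreconnected t :=
    ((convex_halfSpace_re_gt 0).inter (convex_ball 0 B)).isPreconnected
  have hre : ∀ (k : ℕ) (w : ℂ), w ∈ t → (0:ℝ) < k + 1 ∧ ((k : ℝ) + 1 ≤ ‖w + 1 + k‖) := by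
    intro k w hw
    have h1 : 0 < w.re := hw.1
    have hk : (0 : ℝ) ≤ k := Nat.cast_nonneg k
    refine ⟨by positivity, ?_⟩
    have := Complex.re_le_norm (w + 1 + k)
    simp at this; linarith
  have hkne : ∀ k : ℕ, (k : ℂ) + 1 ≠ 0 := fun k => by exact_mod_cast Nat.succ_ne_zero k
  have hkre : ∀ (k : ℕ) (w : ℂ), (w / ((k : ℂ) + 1)).re = w.re / ((k : ℝ) + 1) := by
    intro k w
    rw [show (k : ℂ) + 1 = (((k : ℝ) + 1 : ℝ) : ℂ) by push_cast; rfl, Complex.div_ofReal_re]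
  have hwne : ∀ (k : ℕ) (w : ℂ), w ∈ t → w + 1 + k ≠ 0 := by
    intro k w hw h
    have := hre k w hw
    rw [h, norm_zero] at this; linarith [this.1, this.2]
  have hg : ∀ n y, y ∈ t → HasDerivAt (g n) (g' n y) y := by
    intro k w hw
    have hslit : 1 + w / ((k : ℂ) + 1) ∈ Complex.slitPlane := by
      left
      rw [Complex.add_re, hkre]
      have : 0 < w.re / ((k : ℝ) + 1) := div_pos hw.1 (hre k w hw).1
      simp; linarith
    have h1 : HasDerivAt (fun w : ℂ => 1 + w / ((k : ℂ) + 1)) (1 / ((k : ℂ) + 1)) w :=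
      ((hasDerivAt_id w).div_const _).const_add 1
    have h2 := ((hasDerivAt_id w).mul_const (Real.log (1 + 1 / ((k : ℝ) + 1)) : ℂ)).sub (h1.clog hslit)
    refine HasDerivAt.congr_deriv (f := g k) h2 ?_
    have := hkne k
    have := hwne k w hw
    have h3 : (k : ℂ) + 1 + w ≠ 0 := by rwa [show (k : ℂ) + 1 + w = w + 1 + k by ring]
    simp only [g', one_mul]
    congr 1
    field_simp
    ring
  have hsum : Summable fun k : ℕ => (B + 1) * (1 / ((k : ℝ) + 1) ^ 2) := by
    have := (summable_nat_add_iff 1).mpr (Real.summable_one_div_nat_pow.mpr (by norm_num : 1 < 2))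
    refine (this.congr fun k => ?_).mul_left _
    push_cast; rfl
  have hg'b : ∀ n y, y ∈ t → ‖g' n y‖ ≤ (B + 1) * (1 / ((n : ℝ) + 1) ^ 2) := by
    intro k w hw
    have hk := (hre k w hw).1
    have hn := (hre k w hw).2
    have hwB : ‖w‖ ≤ B := by have := hw.2; simp at this; exact this.le
    obtain ⟨l1, l2⟩ := log_ratio_bounds k
    have e : g' k w = ((Real.log (1 + 1 / ((k : ℝ) + 1)) - 1 / ((k : ℝ) + 1) : ℝ) : ℂ)
        + w / (((k : ℂ) + 1) * (w + 1 + k)) := by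
      have := hkne k
      have := hwne k w hw
      simp only [g']
      push_cast
      field_simp
      ring
    have h1 : ‖((Real.log (1 + 1 / ((k : ℝ) + 1)) - 1 / ((k : ℝ) + 1) : ℝ) : ℂ)‖ ≤
        1 / ((k : ℝ) + 1) ^ 2 := by
      rw [Complex.norm_real, Real.norm_eq_abs, abs_le]
      have hpos : (0:ℝ) ≤ 1 / ((k : ℝ) + 1) ^ 2 := by positivity
      refine ⟨?_, by linarith⟩
      have : 1 / ((k : ℝ) + 1) - 1 / ((k : ℝ) + 2) ≤ 1 / ((k : ℝ) + 1) ^ 2 := by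
        rw [div_sub_div _ _ (by positivity) (by positivity), div_le_div_iff₀ (by positivity) (by positivity)]
        nlinarith
      linarith
    have h2 : ‖w / (((k : ℂ) + 1) * (w + 1 + k))‖ ≤ B * (1 / ((k : ℝ) + 1) ^ 2) := by
      rw [norm_div, norm_mul]
      have e1 : ‖(k : ℂ) + 1‖ = (k : ℝ) + 1 := by
        rw [show (k : ℂ) + 1 = (((k : ℝ) + 1 : ℝ) : ℂ) by push_cast; rfl, Complex.norm_real,
          Real.norm_eq_abs, abs_of_pos hk]
      rw [e1, ← mul_div_assoc, mul_one]
      have hBp : 0 ≤ B := le_trans (norm_nonneg _) hwB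
      gcongr
      nlinarith
    rw [e]
    refine (norm_add_le _ _).trans ?_
    linarith
  have h1t : (1 : ℂ) ∈ t := by
    refine ⟨by simp, ?_⟩
    simp [hB]; linarith [norm_nonneg z]
  have hzt : z ∈ t := ⟨hz, by simp [hB]⟩
  have hg10 : ∀ k, g k 1 = 0 := by
    intro k
    simp only [g, one_mul]
    rw [Complex.ofReal_log (by positivity)]
    push_cast
    ring
  have hg1 : Summable fun n => g n 1 := by
    simp only [hg10]; exact summable_zero
  have hder : ∀ y ∈ t, HasDerivAt (fun w => ∑' n, g n w) (∑' n, g' n y) y := fun y hy =>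
    hasDerivAt_tsum_of_isPreconnected hsum ht htc hg hg'b h1t hg1 hy
  have hsumm : ∀ y ∈ t, Summable fun n => g n y := fun y hy =>
    summable_of_summable_hasDerivAt_of_isPreconnected hsum ht htc hg hg'b h1t hg1 hy
  have hlogsum : ∀ n : ℕ, ∑ k ∈ Finset.range n, Real.log (1 + 1 / ((k : ℝ) + 1)) =
      Real.log ((n : ℝ) + 1) := by
    intro n
    induction n with
    | zero => simp
    | succ n ih =>
      rw [Finset.sum_range_succ, ih, ← Real.log_mul (by positivity) (by positivity)]
      congr 1
      push_cast
      field_simp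
  have hexp : ∀ y ∈ t, Complex.exp (∑' n, g n y) = Complex.Gamma (y + 1) := by
    intro y hy
    have hy0 : y ≠ 0 := by
      rintro rfl
      have := hy.1; simp at this
    have hT := ((hsumm y hy).hasSum.tendsto_sum_nat)
    have hT2 := (Complex.continuous_exp.tendsto _).comp hT
    refine tendsto_nhds_unique hT2 ?_
    have hG := (Complex.GammaSeq_tendsto_Gamma y).comp (tendsto_add_atTop_nat 1)
    have hr : Tendsto (fun n : ℕ => (y + 1 + n) / ((n : ℂ) + 1)) atTop (𝓝 1) := by
      have h0 : Tendsto (fun n : ℕ => y * (1 / ((n : ℂ) + 1)) + 1) atTop (𝓝 (y * 0 + 1)) :=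
        (tendsto_one_div_add_atTop_nhds_zero_nat.const_mul y).add_const 1
      rw [mul_zero, zero_add] at h0
      refine h0.congr fun n => ?_
      have := hkne n
      field_simp
      ring
    have hfin := (hG.const_mul y).mul hr
    rw [mul_one, ← Complex.Gamma_add_one y hy0] at hfin
    refine hfin.congr fun n => ?_
    have hprod : ∀ n : ℕ, Complex.exp (∑ k ∈ Finset.range n, g k y) =
        ((n : ℂ) + 1) ^ y * (n.factorial : ℂ) / ∏ k ∈ Finset.range n, (y + ((k : ℂ) + 1)) := by
      intro n
      have e1 : ∑ k ∈ Finset.range n, g k y = y * (Real.log ((n : ℝ) + 1) : ℂ) -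
          ∑ k ∈ Finset.range n, Complex.log (1 + y / ((k : ℂ) + 1)) := by
        rw [← hlogsum n]
        simp only [g, Finset.sum_sub_distrib, ← Finset.mul_sum]
        push_cast
        rfl
      rw [e1, Complex.exp_sub, Complex.exp_sum]
      have e2 : Complex.exp (y * (Real.log ((n : ℝ) + 1) : ℂ)) = ((n : ℂ) + 1) ^ y := by
        rw [Complex.cpow_def_of_ne_zero (hkne n), Complex.ofReal_log (by positivity)]
        push_cast; rw [mul_comm]
      have e3 : ∏ k ∈ Finset.range n, Complex.exp (Complex.log (1 + y / ((k : ℂ) + 1))) =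
          (∏ k ∈ Finset.range n, (y + ((k : ℂ) + 1))) / (n.factorial : ℂ) := by
        have : (n.factorial : ℂ) = ∏ k ∈ Finset.range n, ((k : ℂ) + 1) := by
          rw [← Finset.prod_range_add_one_eq_factorial]; push_cast; rfl
        rw [this, ← Finset.prod_div_distrib]
        refine Finset.prod_congr rfl fun k _ => ?_
        have h1 := hkne k
        have h2 := hwne k y hy
        rw [Complex.exp_log]
        · field_simp; ring
        · intro h
          apply h2
          field_simp at h
          rw [mul_zero] at h
          rw [← h]; ring
      rw [e2, e3]
      field_simp
    simp only [Function.comp_def]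
    rw [hprod n, Complex.GammaSeq, Finset.prod_range_succ', Finset.prod_range_succ,
      Nat.factorial_succ]
    have h1 := hkne n
    have h2 := hwne n y hy
    have h3 : (∏ k ∈ Finset.range n, (y + ((k : ℂ) + 1))) ≠ 0 := by
      refine Finset.prod_ne_zero_iff.mpr fun k _ => ?_
      have := hwne k y hy
      rwa [show y + ((k : ℂ) + 1) = y + 1 + k by ring]
    push_cast
    have h4 : y + ((n : ℂ) + 1) ≠ 0 := by rwa [show y + ((n : ℂ) + 1) = y + 1 + n by ring]
    simp only [add_zero]
    field_simp
    ring
  have hdig : ∑' n, g' n z = Complex.digamma (z + 1) := by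
    have h1 := (hder z hzt).cexp
    have h2 : (fun w => Complex.exp (∑' n, g n w)) =ᶠ[𝓝 z] fun w => Complex.Gamma (w + 1) := by
      filter_upwards [ht.mem_nhds hzt] with w hw using hexp w hw
    have h3 := h1.congr_of_eventuallyEq h2.symm
    rw [hexp z hzt] at h3
    have hz1 : ∀ m : ℕ, z + 1 ≠ -m := by
      intro m h
      have := congrArg Complex.re h
      simp at this
      have hm : (0 : ℝ) ≤ m := Nat.cast_nonneg m
      linarith
    have h4 := (Complex.differentiableAt_Gamma (z + 1) hz1).hasDerivAt.comp_add_const z 1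
    have h5 := h3.unique h4
    rw [Complex.digamma_def, logDeriv_apply, ← h5]
    rw [mul_div_cancel_left₀ _ (Complex.Gamma_ne_zero hz1)]
  have hsg' : Summable fun n => g' n z := Summable.of_norm_bounded hsum fun n => hg'b n z hzt
  have hlim := hsg'.hasSum.tendsto_sum_nat
  rw [hdig] at hlim
  have hshift : ∀ n : ℕ, Complex.digamma (z + 1 + n) = Complex.digamma (z + 1) +
      ∑ k ∈ Finset.range n, 1 / (z + 1 + k) := by
    intro n
    induction n with
    | zero => simp
    | succ n ih =>
      rw [Finset.sum_range_succ, ← add_assoc, ← ih]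
      have := Complex.digamma_apply_add_one (z + 1 + n) (by
        intro m h
        have := congrArg Complex.re h
        simp at this
        have hm : (0 : ℝ) ≤ m := Nat.cast_nonneg m
        have hn : (0 : ℝ) ≤ n := Nat.cast_nonneg n
        linarith)
      rw [show z + 1 + ((n + 1 : ℕ) : ℂ) = z + 1 + n + 1 by push_cast; ring, this]
      simp
  have hfin := hlim.const_sub (Complex.digamma (z + 1))
  rw [sub_self] at hfin
  refine hfin.congr fun n => ?_
  rw [hshift n, ← hlogsum n]
  simp only [g', Finset.sum_sub_distrib]
  push_cast
  ring

open Complex Filter Topology Metric ComplexConjugate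

/-- gamma factor contribution -/
noncomputable def Tg (y u : ℝ) : ℝ :=
  1 / 2 * ((Complex.digamma (⟨y / 2, u / 2⟩ : ℂ)).re
    - 136 / 125 * (Complex.digamma (⟨(y + 1) / 2, u / 2⟩ : ℂ)).re
    + 3 / 5 * (Complex.digamma (⟨(y + 3 / 2) / 2, u / 2⟩ : ℂ)).re) - 32 / 125 * Real.log Real.pi

noncomputable def Qp (y : ℝ) : ℝ := y ^ 2 - 175 / 64 * y + 7

noncomputable def Ug (y u : ℝ) : ℝ :=
  16 / 125 * Real.log ((u ^ 2 + Qp y) / (4 * Real.pi ^ 2))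

/-- final bound for the gamma factor contribution -/
noncomputable def Eg (u : ℝ) : ℝ := 16 / 125 * Real.log ((u ^ 2 + 13) / 39)

lemma Qp_pos (y : ℝ) : 5 ≤ Qp y := by
  unfold Qp; nlinarith [sq_nonneg (y - 175 / 128)]

lemma digamma_step (y u : ℝ) (hy : 0 < y) :
    (Complex.digamma (⟨(y + 2) / 2, u / 2⟩ : ℂ)).re =
      (Complex.digamma (⟨y / 2, u / 2⟩ : ℂ)).re + 2 * gk y u := by
  have h := Complex.digamma_apply_add_one (⟨y / 2, u / 2⟩ : ℂ) (by
    intro m h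
    have := congrArg Complex.re h
    simp at this
    have hm : (0 : ℝ) ≤ m := Nat.cast_nonneg m
    linarith)
  rw [show (⟨(y + 2) / 2, u / 2⟩ : ℂ) = (⟨y / 2, u / 2⟩ : ℂ) + 1 by
    apply Complex.ext
    · simp; ring
    · simp]
  rw [h, Complex.add_re]
  congr 1
  simp only [Complex.inv_re, normSq_apply, gk]
  have : 0 < y ^ 2 + u ^ 2 := by positivity
  have h2 : 0 < y / 2 * (y / 2) + u / 2 * (u / 2) := by nlinarith
  field_simp

lemma Tg_step (y u : ℝ) (hy : 0 < y) : Tg (y + 2) u = Tg y u + hk y u := by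
  unfold Tg hk
  have h1 := digamma_step y u hy
  have h2 := digamma_step (y + 1) u (by linarith)
  have h3 := digamma_step (y + 3 / 2) u (by linarith)
  rw [show y + 2 + 1 = y + 1 + 2 by ring, show y + 2 + 3 / 2 = y + 3 / 2 + 2 by ring, h1, h2, h3]
  ring

lemma log_le_half_sub (t : ℝ) (ht : 1 ≤ t) : Real.log t ≤ (t - t⁻¹) / 2 := by
  rw [← Real.sinh_log (by linarith)]
  exact Real.self_le_sinh_iff.mpr (Real.log_nonneg ht)

lemma Ug_step (y u : ℝ) (hy : 1 ≤ y) : Ug (y + 2) u ≤ Ug y u + hk y u := by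
  unfold Ug
  set A := u ^ 2 + Qp y with hA
  set B := u ^ 2 + Qp (y + 2) with hB
  have hA0 : 0 < A := by have := Qp_pos y; positivity
  have hB0 : 0 < B := by have := Qp_pos (y + 2); positivity
  have hAB : A ≤ B := by
    rw [hA, hB]; unfold Qp; nlinarith
  have hpi : (0:ℝ) < 4 * Real.pi ^ 2 := by positivity
  have h1 : Real.log (B / (4 * Real.pi ^ 2)) = Real.log (A / (4 * Real.pi ^ 2)) + Real.log (B / A) := by
    rw [Real.log_div hB0.ne' hpi.ne', Real.log_div hA0.ne' hpi.ne', Real.log_div hB0.ne' hA0.ne']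
    ring
  have h2 := log_le_half_sub (B / A) (by rw [one_le_div hA0]; exact hAB)
  have h3 : 16 / 125 * ((B / A - (B / A)⁻¹) / 2) ≤ hk y u := by
    have h0 : 0 < y := by linarith
    have d0 : 0 < y ^ 2 + u ^ 2 := by positivity
    have d1 : 0 < (y + 1) ^ 2 + u ^ 2 := by positivity
    have d2 : 0 < (y + 3 / 2) ^ 2 + u ^ 2 := by positivity
    have hpoly : 0 ≤ 4 * (y * ((y + 1) ^ 2 + u ^ 2) * ((y + 3 / 2) ^ 2 + u ^ 2)
        - 136 / 125 * (y + 1) * (y ^ 2 + u ^ 2) * ((y + 3 / 2) ^ 2 + u ^ 2)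
        + 3 / 5 * (y + 3 / 2) * (y ^ 2 + u ^ 2) * ((y + 1) ^ 2 + u ^ 2)) * A * B
        - 32 / 125 * (B ^ 2 - A ^ 2) * ((y ^ 2 + u ^ 2) * ((y + 1) ^ 2 + u ^ 2)
          * ((y + 3 / 2) ^ 2 + u ^ 2)) := by
      rw [hA, hB]
      unfold Qp
      obtain ⟨t, rfl⟩ : ∃ t, y = 1 + t := ⟨y - 1, by ring⟩
      have ht : 0 ≤ t := by linarith
      generalize hx : u ^ 2 = x
      have hx0 : 0 ≤ x := by rw [← hx]; positivity
      have hp : 0 ≤ 2709345 / 1024 + 18160973 / 2560 * t + 770951749 / 102400 * t ^ 2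
          + 2175935447 / 512000 * t ^ 3 + 744349853 / 512000 * t ^ 4 + 171203849 / 512000 * t ^ 5
          + 14091151 / 256000 * t ^ 6 + 20543 / 4000 * t ^ 7 + 92421117 / 102400 * x
          + 1354769487 / 512000 * x * t + 1127582719 / 512000 * x * t ^ 2
          + 443705921 / 512000 * x * t ^ 3 + 99577 / 500 * x * t ^ 4 + 82047 / 4000 * x * t ^ 5
          + 21770163 / 256000 * x ^ 2 + 18881229 / 64000 * x ^ 2 * t
          + 37348081 / 256000 * x ^ 2 * t ^ 2 + 20493 / 800 * x ^ 2 * t ^ 3 + 3561 / 2000 * x ^ 3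
          + 40961 / 4000 * x ^ 3 * t := by positivity
      refine hp.trans (le_of_eq ?_)
      ring
    have e : hk y u - 16 / 125 * ((B / A - (B / A)⁻¹) / 2) =
      (4 * (y * ((y + 1) ^ 2 + u ^ 2) * ((y + 3 / 2) ^ 2 + u ^ 2)
        - 136 / 125 * (y + 1) * (y ^ 2 + u ^ 2) * ((y + 3 / 2) ^ 2 + u ^ 2)
        + 3 / 5 * (y + 3 / 2) * (y ^ 2 + u ^ 2) * ((y + 1) ^ 2 + u ^ 2)) * A * B
        - 32 / 125 * (B ^ 2 - A ^ 2) * ((y ^ 2 + u ^ 2) * ((y + 1) ^ 2 + u ^ 2)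
          * ((y + 3 / 2) ^ 2 + u ^ 2))) / (4 * A * B * ((y ^ 2 + u ^ 2) * ((y + 1) ^ 2 + u ^ 2)
          * ((y + 3 / 2) ^ 2 + u ^ 2))) := by
      unfold hk gk
      clear_value A B
      generalize y ^ 2 + u ^ 2 = a at *
      generalize (y + 1) ^ 2 + u ^ 2 = b at *
      generalize (y + 3 / 2) ^ 2 + u ^ 2 = c at *
      rw [inv_div]
      field_simp
      ring
    have : 0 ≤ hk y u - 16 / 125 * ((B / A - (B / A)⁻¹) / 2) := by
      rw [e]; exact div_nonneg hpoly (by positivity)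
    linarith
  rw [h1]
  linarith

lemma tendsto_TU (y u : ℝ) (hy : 1 ≤ y) :
    Tendsto (fun n : ℕ => Ug (y + 2 * (n + 1)) u - Tg (y + 2 * (n + 1)) u) atTop (𝓝 0) := by
  have hd : ∀ v : ℝ, 0 < v → Tendsto (fun n : ℕ =>
      (Complex.digamma (⟨(v + 2 * (n + 1)) / 2, u / 2⟩ : ℂ)).re - Real.log ((n : ℝ) + 1)) atTop
      (𝓝 0) := by
    intro v hv
    have h := (Complex.continuous_re.tendsto _).comp
      (digamma_tendsto (z := (⟨v / 2, u / 2⟩ : ℂ)) (by simpa using hv))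
    simp only [Complex.zero_re] at h
    refine h.congr fun n => ?_
    simp only [Function.comp_def, Complex.sub_re, Complex.ofReal_re]
    congr 3
    apply Complex.ext
    · simp; ring
    · simp
  have hlog : Tendsto (fun n : ℕ => Real.log ((u ^ 2 + Qp (y + 2 * (n + 1))) / (4 * ((n:ℝ) + 1) ^ 2)))
      atTop (𝓝 0) := by
    have hr : Tendsto (fun n : ℕ => (u ^ 2 + Qp (y + 2 * (n + 1))) / (4 * ((n:ℝ) + 1) ^ 2))
        atTop (𝓝 1) := by
      have h0 := tendsto_one_div_add_atTop_nhds_zero_nat (𝕜 := ℝ)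
      have h1 : Tendsto (fun n : ℕ => 1 + (4 * y - 175 / 32) / 4 * (1 / ((n : ℝ) + 1)) +
          (u ^ 2 + Qp y) / 4 * ((1 / ((n : ℝ) + 1)) * (1 / ((n : ℝ) + 1)))) atTop
          (𝓝 (1 + (4 * y - 175 / 32) / 4 * 0 + (u ^ 2 + Qp y) / 4 * (0 * 0))) :=
        (tendsto_const_nhds.add (h0.const_mul _)).add ((h0.mul h0).const_mul _)
      simp only [mul_zero, add_zero] at h1
      refine h1.congr fun n => ?_
      have : (n : ℝ) + 1 ≠ 0 := by positivity
      unfold Qp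
      field_simp
      ring
    have := (Real.continuousAt_log (one_ne_zero)).tendsto.comp hr
    simpa [Function.comp_def] using this
  have h1 := hd y (by linarith)
  have h2 := hd (y + 1) (by linarith)
  have h3 := hd (y + 3 / 2) (by linarith)
  have h := (hlog.const_mul (16 / 125)).sub
    (((h1.sub (h2.const_mul (136 / 125))).add (h3.const_mul (3 / 5))).const_mul (1 / 2))
  simp only [mul_zero, sub_zero, add_zero] at h
  refine h.congr fun n => ?_
  unfold Ug Tg
  have hq := Qp_pos (y + 2 * (n + 1))
  have hn : (0 : ℝ) < (n : ℝ) + 1 := by positivity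
  rw [Real.log_div (by positivity) (by positivity), Real.log_div (by positivity) (by positivity),
    Real.log_mul (by norm_num) (by positivity), Real.log_mul (by norm_num) (by positivity),
    Real.log_pow, Real.log_pow]
  rw [show y + 2 * ((n : ℝ) + 1) + 1 = y + 1 + 2 * (n + 1) by ring,
    show y + 2 * ((n : ℝ) + 1) + 3 / 2 = y + 3 / 2 + 2 * (n + 1) by ring]
  push_cast
  ring

theorem Tg_le_Ug (y u : ℝ) (hy : 1 ≤ y) : Tg y u ≤ Ug y u := by
  have hstep : ∀ v : ℝ, 1 ≤ v → Ug (v + 2) u - Tg (v + 2) u ≤ Ug v u - Tg v u := by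
    intro v hv
    have h1 := Ug_step v u hv
    have h2 := Tg_step v u (by linarith)
    linarith
  have hall : ∀ n : ℕ, Ug (y + 2 * (n + 1)) u - Tg (y + 2 * (n + 1)) u ≤ Ug y u - Tg y u := by
    intro n
    induction n with
    | zero => simpa using hstep y hy
    | succ n ih =>
      have hn : (0 : ℝ) ≤ n := Nat.cast_nonneg n
      have := hstep (y + 2 * (n + 1)) (by linarith)
      push_cast
      rw [show y + 2 * ((n : ℝ) + 1 + 1) = y + 2 * (n + 1) + 2 by ring]
      linarith
  have := le_of_tendsto (tendsto_TU y u hy) (Eventually.of_forall hall)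
  linarith

lemma Ug_le_aux (y u : ℝ) (hy : 1 ≤ y) (hy3 : y ≤ 3) :
    Ug y u ≤ 16 / 125 * Real.log ((u ^ 2 + 39 / 5) / 39) := by
  unfold Ug
  have hq := Qp_pos y
  have hq2 : Qp y ≤ 39 / 5 := by unfold Qp; nlinarith
  have hpi : 39 ≤ 4 * Real.pi ^ 2 := by nlinarith [Real.pi_gt_d2]
  have : Real.log ((u ^ 2 + Qp y) / (4 * Real.pi ^ 2)) ≤ Real.log ((u ^ 2 + 39 / 5) / 39) := by
    apply Real.log_le_log (by positivity)
    gcongr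
  linarith

theorem Tg_le_Eg (y u : ℝ) (hy : 1 ≤ y) (hy3 : y ≤ 3) : Tg y u ≤ Eg u := by
  refine (Tg_le_Ug y u hy).trans ((Ug_le_aux y u hy hy3).trans ?_)
  unfold Eg
  have : Real.log ((u ^ 2 + 39 / 5) / 39) ≤ Real.log ((u ^ 2 + 13) / 39) := by
    apply Real.log_le_log (by positivity)
    gcongr
    norm_num
  linarith

lemma dhat_le (l u : ℝ) (hl : 0 ≤ l) (hl2 : l ≤ 2) : dhat l u ≤ 416 / 625 / (u ^ 2 + 13) := by
  rw [dhat_eq l u hl, div_le_div_iff₀ (by positivity) (by positivity)]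
  generalize hx : u ^ 2 = x
  have hx0 : 0 ≤ x := by rw [← hx]; positivity
  have h2 : 0 ≤ 2 - l := by linarith
  have hp : 0 ≤ 3159 / 100 + 20514 / 125 * l + 3733639 / 10000 * l ^ 2 + 4780139 / 10000 * l ^ 3
      + 465881 / 1250 * l ^ 4 + 113022 / 625 * l ^ 5 + 33527 / 625 * l ^ 6
      + 5629 / 625 * l ^ 7 + 416 / 625 * l ^ 8 + 524119 / 10000 * x + 2275019 / 10000 * x * l
      + 3455347 / 10000 * x * l ^ 2 + 525083 / 2000 * x * l ^ 3 + 28119 / 250 * x * l ^ 4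
      + 16397 / 625 * x * l ^ 5 + 1509 / 625 * x * l ^ 6 + 490719 / 10000 * x ^ 2
      + 841063 / 10000 * x ^ 2 * l + 42064 / 625 * x ^ 2 * l ^ 2 + 16242 / 625 * x ^ 2 * l ^ 3
      + 2071 / 625 * x ^ 2 * l ^ 4 + 9987 / 1250 * x ^ 3 + 5474 / 625 * x ^ 3 * l
      + 1279 / 625 * x ^ 3 * l ^ 2 + 301 / 625 * x ^ 4
      + (3 / 125 * x * l ^ 6 * (2 - l) + 9 / 125 * x ^ 2 * l ^ 4 * (2 - l)
      + 9 / 125 * x ^ 3 * l ^ 2 * (2 - l) + 3 / 125 * x ^ 4 * (2 - l)) := by positivity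
  rw [← sub_nonneg]
  refine hp.trans (le_of_eq ?_)
  ring

theorem Tg_dhat_le_Eg (l u : ℝ) (hl : 0 ≤ l) (hl2 : l ≤ 2) : Tg (1 + l) u + dhat l u ≤ Eg u := by
  have h1 := (Tg_le_Ug (1 + l) u (by linarith)).trans (Ug_le_aux (1 + l) u (by linarith) (by linarith))
  have h2 := dhat_le l u hl hl2
  unfold Eg
  have hx : (0:ℝ) ≤ u ^ 2 := by positivity
  have h3 := Real.one_sub_inv_le_log_of_pos (x := (u ^ 2 + 13) / (u ^ 2 + 39 / 5)) (by positivity)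
  rw [Real.log_div (by positivity) (by positivity)] at h3
  rw [Real.log_div (by positivity) (by positivity)] at h1 ⊢
  have h4 : 1 - ((u ^ 2 + 13) / (u ^ 2 + 39 / 5))⁻¹ = (26 / 5) / (u ^ 2 + 13) := by
    rw [inv_div]; field_simp; ring
  rw [h4] at h3
  have h5 : 416 / 625 / (u ^ 2 + 13) = 16 / 125 * ((26 / 5) / (u ^ 2 + 13)) := by
    field_simp; norm_num
  linarith

open Complex Filter Topology Metric ComplexConjugate

lemma strongPair_strip_bdd {P : WeakFEPair ℂ} (hP : IsStrongFEPair P) (a b : ℝ) :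
    ∃ C, ∀ s : ℂ, a ≤ s.re → s.re ≤ b → ‖P.Λ s‖ ≤ C := by
  have hconv : ∀ r : ℝ, MeasureTheory.IntegrableOn (fun t : ℝ => t ^ (r - 1) * ‖P.f t‖)
      (Set.Ioi 0) := by
    intro r
    have h := (hP.hasMellin (r : ℂ)).1.norm
    refine h.congr ?_
    filter_upwards [MeasureTheory.ae_restrict_mem measurableSet_Ioi] with t ht
    rw [norm_smul, Complex.norm_cpow_eq_rpow_re_of_pos ht]
    simp
  refine ⟨∫ t in Set.Ioi (0:ℝ), (t ^ (a - 1) * ‖P.f t‖ + t ^ (b - 1) * ‖P.f t‖), ?_⟩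
  intro s ha hb
  rw [← (hP.hasMellin s).2, mellin]
  refine MeasureTheory.norm_integral_le_of_norm_le ((hconv a).add (hconv b)) ?_
  filter_upwards [MeasureTheory.ae_restrict_mem measurableSet_Ioi] with t ht
  have ht0 : (0:ℝ) < t := ht
  rw [norm_smul, Complex.norm_cpow_eq_rpow_re_of_pos ht]
  rw [← add_mul]
  refine mul_le_mul_of_nonneg_right ?_ (norm_nonneg _)
  have h1 : 0 < t ^ (a - 1) := Real.rpow_pos_of_pos ht0 _
  have h2 : 0 < t ^ (b - 1) := Real.rpow_pos_of_pos ht0 _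
  rcases le_total 1 t with h | h
  · have : t ^ (s - 1).re ≤ t ^ (b - 1) := Real.rpow_le_rpow_of_exponent_le h (by simpa using hb)
    linarith
  · have : t ^ (s - 1).re ≤ t ^ (a - 1) :=
      Real.rpow_le_rpow_of_exponent_ge ht0 h (by simpa using ha)
    linarith

lemma weakPair_strip_bdd (P : WeakFEPair ℂ) (a b : ℝ) :
    ∃ C, ∀ s : ℂ, a ≤ s.re → s.re ≤ b → ‖P.Λ₀ s‖ ≤ C := by
  obtain ⟨C, hC⟩ := strongPair_strip_bdd P.isStrongFEPair_toStrongFEPair a b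
  refine ⟨C, fun s h1 h2 => ?_⟩
  have h := hC s h1 h2
  rw [P.isStrongFEPair_toStrongFEPair.Λ_eq] at h
  exact h

lemma even₀_strip_bdd (x : UnitAddCircle) (a b : ℝ) :
    ∃ C, ∀ s : ℂ, a ≤ s.re → s.re ≤ b → ‖HurwitzZeta.completedHurwitzZetaEven₀ x s‖ ≤ C := by
  obtain ⟨C, hC⟩ := weakPair_strip_bdd (HurwitzZeta.hurwitzEvenFEPair x) (a / 2) (b / 2)
  refine ⟨C / 2, fun s h1 h2 => ?_⟩
  rw [HurwitzZeta.completedHurwitzZetaEven₀]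
  have := hC (s / 2) (by simp; linarith) (by simp; linarith)
  rw [norm_div]
  simp only [Complex.norm_ofNat]
  linarith

lemma odd_strip_bdd (x : UnitAddCircle) (a b : ℝ) :
    ∃ C, ∀ s : ℂ, a ≤ s.re → s.re ≤ b → ‖HurwitzZeta.completedHurwitzZetaOdd x s‖ ≤ C := by
  obtain ⟨C, hC⟩ := strongPair_strip_bdd (HurwitzZeta.isStrong_hurwitzOddFEPair x)
    ((a + 1) / 2) ((b + 1) / 2)
  refine ⟨C / 2, fun s h1 h2 => ?_⟩
  rw [HurwitzZeta.completedHurwitzZetaOdd]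
  have := hC ((s + 1) / 2) (by simp; linarith) (by simp; linarith)
  rw [norm_div]
  simp only [Complex.norm_ofNat]
  linarith

lemma completedL_strip_bdd {N : ℕ} [NeZero N] {Φ : ZMod N → ℂ} (h0 : Φ 0 = 0)
    (hs : ∑ j, Φ j = 0) (a b : ℝ) :
    ∃ C, ∀ s : ℂ, a ≤ s.re → s.re ≤ b → ‖ZMod.completedLFunction Φ s‖ ≤ C := by
  choose C1 hC1 using fun x => even₀_strip_bdd x a b
  choose C2 hC2 using fun x => odd_strip_bdd x a b
  have hN : (1:ℝ) ≤ N := by exact_mod_cast NeZero.one_le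
  have hN0 : (0:ℝ) < N := by linarith
  refine ⟨(N:ℝ) ^ (-a) * (∑ j : ZMod N, ‖Φ j‖ * C1 (ZMod.toAddCircle j)) +
    (N:ℝ) ^ (-a) * (∑ j : ZMod N, ‖Φ j‖ * C2 (ZMod.toAddCircle j)), fun s h1 h2 => ?_⟩
  rw [ZMod.completedLFunction_eq, h0, hs]
  simp only [mul_zero, zero_div, sub_zero]
  rw [ZMod.completedLFunction₀]
  have hn : ‖(N:ℂ) ^ (-s)‖ ≤ (N:ℝ) ^ (-a) := by
    rw [Complex.norm_natCast_cpow_of_pos (by exact_mod_cast hN0)]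
    exact Real.rpow_le_rpow_of_exponent_le hN (by simpa using h1)
  refine (norm_add_le _ _).trans (add_le_add ?_ ?_)
  · rw [norm_mul]
    refine mul_le_mul hn ?_ (norm_nonneg _) (by positivity)
    refine (norm_sum_le _ _).trans (Finset.sum_le_sum fun j _ => ?_)
    rw [norm_mul]
    exact mul_le_mul_of_nonneg_left (hC1 _ s h1 h2) (norm_nonneg _)
  · rw [norm_mul]
    refine mul_le_mul hn ?_ (norm_nonneg _) (by positivity)
    refine (norm_sum_le _ _).trans (Finset.sum_le_sum fun j _ => ?_)
    rw [norm_mul]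
    exact mul_le_mul_of_nonneg_left (hC2 _ s h1 h2) (norm_nonneg _)

lemma exp_lin_le (A : ℝ) {ε : ℝ} (hε : 0 < ε) (x : ℝ) :
    A * x ≤ ε * x ^ 2 + A ^ 2 / (4 * ε) := by
  have h : 0 ≤ (2 * ε * x - A) ^ 2 / (4 * ε) := by positivity
  have : (2 * ε * x - A) ^ 2 / (4 * ε) = ε * x ^ 2 - A * x + A ^ 2 / (4 * ε) := by
    field_simp; ring
  linarith

lemma Gamma_real_growth {ε : ℝ} (hε : 0 < ε) :
    ∃ C, 0 ≤ C ∧ ∀ x : ℝ, 1 ≤ x → Real.Gamma x ≤ Real.exp (ε * x ^ 2 + C) := by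
  -- Gamma x ≤ Gamma (n+2) with n = floor x
  set δ := ε / 18 with hδ
  have hδ0 : 0 < δ := by positivity
  refine ⟨(Real.log (1 / δ)) ^ 2 / (4 * δ), by positivity, ?_⟩
  intro x hx
  set n := ⌊x⌋₊ + 2 with hn
  have hnx : (n:ℝ) ≤ 3 * x := by
    have := Nat.floor_le (by linarith : (0:ℝ) ≤ x)
    rw [hn]; push_cast; linarith
  have hxn : x + 1 ≤ n := by
    have := Nat.lt_floor_add_one x
    rw [hn]; push_cast; linarith
  have hn0 : (0:ℝ) < n := by linarith
  have h1 : Real.Gamma x ≤ Real.Gamma (n + 1) := by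
    have hA : Real.Gamma x ≤ Real.Gamma (x + 1) := by
      rw [Real.Gamma_add_one (by linarith)]
      have := Real.Gamma_pos_of_pos (by linarith : (0:ℝ) < x)
      nlinarith
    refine hA.trans ?_
    exact Real.Gamma_strictMonoOn_Ici.monotoneOn (by simp; linarith) (by simp; linarith)
      (by linarith)
  rw [Real.Gamma_nat_eq_factorial] at h1
  have h2 : (n.factorial : ℝ) ≤ (n:ℝ) ^ n := by exact_mod_cast Nat.factorial_le_pow n
  have h3 : (n:ℝ) ^ n = Real.exp (n * Real.log n) := by
    rw [← Real.log_pow, Real.exp_log (by positivity)]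
  refine h1.trans (h2.trans ?_)
  rw [h3]
  refine Real.exp_le_exp.mpr ?_
  have h4 : Real.log n ≤ δ * n + Real.log (1 / δ) := by
    have := Real.log_le_sub_one_of_pos (by positivity : 0 < δ * n)
    rw [Real.log_mul (by positivity) (by positivity)] at this
    rw [one_div, Real.log_inv]
    linarith
  have h5 := exp_lin_le (Real.log (1 / δ)) hδ0 (n:ℝ)
  have h6 : (n:ℝ) * Real.log n ≤ n * (δ * n + Real.log (1 / δ)) :=
    mul_le_mul_of_nonneg_left h4 hn0.le
  have h7 : (n:ℝ) ^ 2 ≤ (3 * x) ^ 2 := by gcongr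
  have h8 : δ * (n:ℝ) ^ 2 ≤ δ * (3 * x) ^ 2 := by gcongr
  have h9 : 2 * (δ * (3 * x) ^ 2) = ε * x ^ 2 := by rw [hδ]; ring
  nlinarith

/-- Growth criterion. -/
lemma growth_of_bounds {f : ℂ → ℂ} {e : ℂ} (hsymm : ∀ z, f (1 - conj z) = e * conj (f z))
    {C A a : ℝ} (hC : 0 ≤ C) (hA : 0 ≤ A) (ha0 : 0 ≤ a) (ha1 : a ≤ 1)
    (hstrip : ∀ z : ℂ, 1 / 2 ≤ z.re → z.re ≤ 2 → ‖f z‖ ≤ C * (1 + ‖z‖) ^ 2)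
    (hright : ∀ z : ℂ, 2 ≤ z.re →
      ‖f z‖ ≤ C * (1 + ‖z‖) ^ 2 * Real.exp (A * z.re) * Real.Gamma ((z.re + a) / 2)) :
    ∀ ε > 0, ∃ C', ∀ z, ‖f z‖ ≤ C' * Real.exp (ε * ‖z - 2‖ ^ 2) := by
  -- first on the right half plane
  have key : ∀ ε > 0, ∃ C', 0 ≤ C' ∧ ∀ z : ℂ, 1 / 2 ≤ z.re →
      ‖f z‖ ≤ C' * Real.exp (ε * ‖z - 2‖ ^ 2) := by
    intro ε hε
    set δ := ε / 6 with hδ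
    have hδ0 : 0 < δ := by positivity
    obtain ⟨D, hD0, hD⟩ := Gamma_real_growth (by positivity : 0 < δ)
    have hpoly : ∀ z : ℂ, (1 + ‖z‖) ^ 2 ≤ Real.exp (δ * ‖z‖ ^ 2 + (2 ^ 2 / (4 * δ))) := by
      intro z
      have h1 : (1 + ‖z‖) ≤ Real.exp ‖z‖ := by
        have := Real.add_one_le_exp ‖z‖; linarith
      calc (1 + ‖z‖) ^ 2 ≤ (Real.exp ‖z‖) ^ 2 := by gcongr
        _ = Real.exp (2 * ‖z‖) := by rw [← Real.exp_nat_mul]; norm_num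
        _ ≤ _ := Real.exp_le_exp.mpr (exp_lin_le 2 hδ0 _)
    have hz2 : ∀ z : ℂ, ‖z‖ ^ 2 ≤ 2 * ‖z - 2‖ ^ 2 + 8 := by
      intro z
      have h : ‖z‖ ≤ ‖z - 2‖ + 2 := by
        have := norm_add_le (z - 2) 2
        simpa using this
      nlinarith [norm_nonneg z, norm_nonneg (z - 2), sq_nonneg (‖z - 2‖ - 2)]
    set K := 2 ^ 2 / (4 * δ) + A ^ 2 / (4 * δ) + D + 24 * δ with hK
    have hA' : 0 ≤ A ^ 2 / (4 * δ) := by positivity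
    refine ⟨C * Real.exp K, by positivity, fun z hz => ?_⟩
    rw [mul_assoc, ← Real.exp_add]
    have hexp : 0 ≤ ε * ‖z - 2‖ ^ 2 - 3 * δ * ‖z‖ ^ 2 + 24 * δ := by
      have h := mul_le_mul_of_nonneg_left (hz2 z) hδ0.le
      have : ε = 6 * δ := by rw [hδ]; ring
      rw [this]; linarith
    have hzz : 0 ≤ δ * ‖z‖ ^ 2 := by positivity
    rcases le_total z.re 2 with h | h
    · refine (hstrip z hz h).trans (mul_le_mul_of_nonneg_left ((hpoly z).trans ?_) hC)
      refine Real.exp_le_exp.mpr ?_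
      rw [hK]; linarith
    · refine (hright z h).trans ?_
      rw [mul_assoc, mul_assoc]
      refine mul_le_mul_of_nonneg_left ?_ hC
      have hG := hD ((z.re + a) / 2) (by linarith)
      have hGp : 0 ≤ Real.Gamma ((z.re + a) / 2) := (Real.Gamma_pos_of_pos (by linarith)).le
      have hre : z.re ^ 2 ≤ ‖z‖ ^ 2 := by
        rw [Complex.sq_norm, Complex.normSq_apply]; nlinarith [sq_nonneg z.im]
      calc (1 + ‖z‖) ^ 2 * (Real.exp (A * z.re) * Real.Gamma ((z.re + a) / 2))
          ≤ Real.exp (δ * ‖z‖ ^ 2 + (2 ^ 2 / (4 * δ))) *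
            (Real.exp (δ * z.re ^ 2 + A ^ 2 / (4 * δ)) *
              Real.exp (δ * ((z.re + a) / 2) ^ 2 + D)) := by
            gcongr
            · exact hpoly z
            · exact exp_lin_le A hδ0 _
        _ ≤ _ := by
            rw [← Real.exp_add, ← Real.exp_add]
            refine Real.exp_le_exp.mpr ?_
            have h1 : ((z.re + a) / 2) ^ 2 ≤ z.re ^ 2 := by
              apply pow_le_pow_left₀ (by linarith); linarith
            have h2 := mul_le_mul_of_nonneg_left h1 hδ0.le
            have h3 := mul_le_mul_of_nonneg_left hre hδ0.le
            rw [hK]; linarith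
  intro ε hε
  obtain ⟨C1, hC1, h1⟩ := key (ε / 2) (by positivity)
  refine ⟨C1 * Real.exp 0 + ‖e‖ * (C1 * Real.exp (9 * ε)), fun z => ?_⟩
  have hE : 0 ≤ Real.exp (ε * ‖z - 2‖ ^ 2) := (Real.exp_pos _).le
  rw [add_mul]
  rcases le_total (1 / 2) z.re with h | h
  · refine (h1 z h).trans ?_
    have : C1 * Real.exp (ε / 2 * ‖z - 2‖ ^ 2) ≤ C1 * Real.exp 0 * Real.exp (ε * ‖z - 2‖ ^ 2) := by
      rw [Real.exp_zero, mul_one]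
      gcongr; linarith
    have h0 : 0 ≤ ‖e‖ * (C1 * Real.exp (9 * ε)) * Real.exp (ε * ‖z - 2‖ ^ 2) := by positivity
    linarith
  · have hz := hsymm (1 - conj z)
    have hzz : (1 : ℂ) - conj (1 - conj z) = z := by simp
    rw [hzz] at hz
    have hb := h1 (1 - conj z) (by simp; linarith)
    have hn : ‖(1 - conj z) - 2‖ ≤ ‖z - 2‖ + 3 := by
      have : (1 - conj z) - 2 = - conj (z - 2) + (-3) := by
        simp only [map_sub, Complex.conj_ofNat]; ring
      rw [this]
      refine (norm_add_le _ _).trans ?_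
      simp only [norm_neg, Complex.norm_conj, Complex.norm_ofNat]
      exact le_rfl
    rw [hz, norm_mul, Complex.norm_conj]
    have h2 : ‖(1 - conj z) - 2‖ ^ 2 ≤ 2 * ‖z - 2‖ ^ 2 + 18 := by
      nlinarith [norm_nonneg ((1 - conj z) - 2), norm_nonneg (z - 2), sq_nonneg (‖z - 2‖ - 3)]
    have h3 : C1 * Real.exp (ε / 2 * ‖(1 - conj z) - 2‖ ^ 2)
        ≤ C1 * Real.exp (9 * ε) * Real.exp (ε * ‖z - 2‖ ^ 2) := by
      rw [mul_assoc, ← Real.exp_add]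
      gcongr
      nlinarith
    have h0 : 0 ≤ C1 * Real.exp 0 * Real.exp (ε * ‖z - 2‖ ^ 2) := by positivity
    have h4 := mul_le_mul_of_nonneg_left (hb.trans h3) (norm_nonneg e)
    nlinarith

open Complex Filter Topology Metric ComplexConjugate

lemma norm_Gamma_le_of_pos {z : ℂ} (hz : 0 < z.re) : ‖Complex.Gamma z‖ ≤ Real.Gamma z.re := by
  rw [Complex.Gamma_eq_integral hz, Real.Gamma_eq_integral hz, Complex.GammaIntegral]
  refine MeasureTheory.norm_integral_le_of_norm_le (Real.GammaIntegral_convergent hz) ?_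
  filter_upwards [MeasureTheory.ae_restrict_mem measurableSet_Ioi] with t ht
  rw [norm_mul, Complex.norm_cpow_eq_rpow_re_of_pos ht, Complex.norm_real, Real.norm_eq_abs,
    abs_of_pos (Real.exp_pos _)]
  simp

lemma norm_Gammaℝ_le {z : ℂ} (hz : 0 < z.re) : ‖Complex.Gammaℝ z‖ ≤ Real.Gamma (z.re / 2) := by
  rw [Complex.Gammaℝ_def, norm_mul]
  have h1 : ‖(Real.pi : ℂ) ^ (-z / 2)‖ ≤ 1 := by
    rw [Complex.norm_cpow_eq_rpow_re_of_pos Real.pi_pos]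
    refine Real.rpow_le_one_of_one_le_of_nonpos (by linarith [Real.pi_gt_three]) ?_
    simp; linarith
  have h2 : ‖Complex.Gamma (z / 2)‖ ≤ Real.Gamma (z.re / 2) := by
    have := norm_Gamma_le_of_pos (z := z / 2) (by simpa using hz)
    simpa using this
  calc _ ≤ 1 * Real.Gamma (z.re / 2) := by gcongr
    _ = _ := one_mul _

lemma Gammaℝ_conj (z : ℂ) : Complex.Gammaℝ (conj z) = conj (Complex.Gammaℝ z) := by
  rw [Complex.Gammaℝ_def, Complex.Gammaℝ_def, map_mul, ← Complex.Gamma_conj]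
  rw [map_div₀, Complex.conj_ofNat]
  congr 1
  have h := Complex.cpow_conj (Real.pi : ℂ) (-z / 2) (by
    rw [Complex.arg_ofReal_of_nonneg Real.pi_pos.le]; exact Real.pi_pos.ne)
  rw [Complex.conj_ofReal, map_div₀, map_neg, Complex.conj_ofNat] at h
  exact h

lemma natCast_cpow_conj (N : ℕ) (z : ℂ) : (N : ℂ) ^ (conj z) = conj ((N : ℂ) ^ z) := by
  rw [Complex.cpow_conj _ _ (by rw [Complex.natCast_arg]; exact Real.pi_pos.ne),
    Complex.conj_natCast]

lemma entire_conj_ext {f g : ℂ → ℂ} (hf : Differentiable ℂ f) (hg : Differentiable ℂ g)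
    (h : ∀ z : ℂ, 1 < z.re → g (conj z) = conj (f z)) (z : ℂ) : g (conj z) = conj (f z) := by
  have hg' : Differentiable ℂ (conj ∘ g ∘ conj) := fun z => by
    simpa using (hg (conj z)).conj_conj
  have hE : f = conj ∘ g ∘ conj := by
    refine AnalyticOnNhd.eq_of_eventuallyEq (z₀ := 2)
      (fun z _ => (hf.analyticAt z)) (fun z _ => hg'.analyticAt z) ?_
    have : {z : ℂ | 1 < z.re} ∈ 𝓝 (2 : ℂ) :=
      (isOpen_lt continuous_const Complex.continuous_re).mem_nhds (by simp)
    filter_upwards [this] with z hz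
    simp only [Function.comp]
    rw [h z hz, Complex.conj_conj]
  have := congrFun hE z
  simp only [Function.comp] at this
  rw [this, Complex.conj_conj]

namespace DirichletCharacter

lemma LSeries_inv_conj {N : ℕ} [NeZero N] (χ : DirichletCharacter ℂ N) (z : ℂ) :
    LSeries (fun n => χ⁻¹ n) (conj z) = conj (LSeries (fun n => χ n) z) := by
  rw [LSeries, LSeries, Complex.conj_tsum]
  refine tsum_congr fun n => ?_
  rcases eq_or_ne n 0 with rfl | hn
  · simp
  · rw [LSeries.term_of_ne_zero hn, LSeries.term_of_ne_zero hn, map_div₀]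
    congr 1
    · rw [← MulChar.star_eq_inv, MulChar.star_apply]; rfl
    · exact natCast_cpow_conj n z

lemma LFunction_inv_conj {N : ℕ} [NeZero N] (χ : DirichletCharacter ℂ N) {z : ℂ} (hz : 1 < z.re) :
    LFunction χ⁻¹ (conj z) = conj (LFunction χ z) := by
  rw [LFunction_eq_LSeries _ hz, LFunction_eq_LSeries _ (by simpa using hz), LSeries_inv_conj]

lemma LFunction_norm_bdd {N : ℕ} [NeZero N] (χ : DirichletCharacter ℂ N) :
    ∃ C, 0 ≤ C ∧ ∀ z : ℂ, 2 ≤ z.re → ‖LFunction χ z‖ ≤ C := by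
  have hs : Summable (fun n => ‖LSeries.term (fun n => χ n) 2 n‖) :=
    (ZMod.LSeriesSummable_of_one_lt_re (fun n => χ n) (s := 2) (by simp)).norm
  refine ⟨∑' n, ‖LSeries.term (fun n => χ n) 2 n‖, tsum_nonneg fun _ => norm_nonneg _, ?_⟩
  intro z hz
  rw [LFunction_eq_LSeries _ (by linarith), LSeries]
  exact tsum_of_norm_bounded hs.hasSum
    (fun n => LSeries.norm_term_le_of_re_le_re _ (by simpa using hz) n)

open Classical in
/-- Parity. -/
noncomputable def par {N : ℕ} (χ : DirichletCharacter ℂ N) : ℝ := if χ.Even then 0 else 1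

lemma par_cases {N : ℕ} (χ : DirichletCharacter ℂ N) : par χ = 0 ∨ par χ = 1 := by
  unfold par; split_ifs <;> simp

lemma gammaFactor_eq {N : ℕ} (χ : DirichletCharacter ℂ N) (s : ℂ) :
    gammaFactor χ s = Gammaℝ (s + (par χ : ℂ)) := by
  unfold par gammaFactor
  split_ifs <;> simp

lemma par_inv {N : ℕ} (χ : DirichletCharacter ℂ N) : par χ⁻¹ = par χ := by
  unfold par
  have : χ⁻¹.Even ↔ χ.Even := by
    rw [Even, Even]
    have : χ⁻¹ (-1) = (χ (-1))⁻¹ := by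
      rw [← MulChar.star_eq_inv, MulChar.star_apply]
      rcases χ.even_or_odd with h | h
      · rw [Even] at h; rw [h]; simp
      · rw [Odd] at h; rw [h]; norm_num
    rw [this]
    exact inv_eq_one
  classical
  by_cases h : χ.Even
  · rw [if_pos h, if_pos (this.mpr h)]
  · rw [if_neg h, if_neg (fun h2 => h (this.mp h2))]

/-- `ξ(s, χ)`. -/
noncomputable def xiC {N : ℕ} [NeZero N] (χ : DirichletCharacter ℂ N) (s : ℂ) : ℂ :=
  (N : ℂ) ^ (s / 2) * completedLFunction χ s

variable {N : ℕ} [NeZero N] {χ : DirichletCharacter ℂ N}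

lemma xiC_eq (hχ : χ ≠ 1) {s : ℂ} (hs : 0 < s.re) :
    xiC χ s = (N : ℂ) ^ (s / 2) * Gammaℝ (s + (par χ : ℂ)) * LFunction χ s := by
  have hN : N ≠ 1 := hχ ∘ level_one' _
  have hG : gammaFactor χ s ≠ 0 := by
    rw [gammaFactor_eq]
    refine Complex.Gammaℝ_ne_zero_of_re_pos ?_
    rcases par_cases χ with h | h <;> simp [h] <;> linarith
  rw [LFunction_eq_completed_div_gammaFactor χ s (Or.inr hN), xiC, ← gammaFactor_eq]
  field_simp

lemma xiC_differentiable (hχ : χ ≠ 1) : Differentiable ℂ (xiC χ) := by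
  unfold xiC
  refine Differentiable.mul ?_ (differentiable_completedLFunction hχ)
  intro s
  have hN : (N : ℂ) ≠ 0 := NeZero.ne _
  exact (differentiableAt_id.div_const 2).const_cpow (Or.inl hN)

lemma xiC_eq_zero_of (hχ : χ ≠ 1) {s : ℂ} (hs : 0 < s.re) (h : LFunction χ s = 0) :
    xiC χ s = 0 := by
  rw [xiC_eq hχ hs, h, mul_zero]

lemma inv_ne_one {N : ℕ} {χ : DirichletCharacter ℂ N} (hχ : χ ≠ 1) : χ⁻¹ ≠ 1 := by
  intro h; exact hχ (inv_eq_one.mp h)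

lemma xiC_conj (hχ : χ ≠ 1) (z : ℂ) : xiC χ⁻¹ (conj z) = conj (xiC χ z) := by
  refine entire_conj_ext (xiC_differentiable hχ) (xiC_differentiable (inv_ne_one hχ)) ?_ z
  intro z hz
  rw [xiC_eq hχ (by linarith), xiC_eq (inv_ne_one hχ) (by simp; linarith), map_mul, map_mul,
    LFunction_inv_conj χ hz, par_inv, ← Gammaℝ_conj, ← natCast_cpow_conj,
    map_div₀, Complex.conj_ofNat, map_add, Complex.conj_ofReal]

lemma xiC_ne_zero (hχ : χ ≠ 1) {z : ℂ} (hz : 1 ≤ z.re) : xiC χ z ≠ 0 := by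
  rw [xiC_eq hχ (by linarith)]
  refine mul_ne_zero (mul_ne_zero ?_ ?_) ?_
  · rw [Complex.cpow_ne_zero_iff]; left; exact NeZero.ne _
  · refine Complex.Gammaℝ_ne_zero_of_re_pos ?_
    rcases par_cases χ with h | h <;> simp [h] <;> linarith
  · exact LFunction_ne_zero_of_one_le_re χ (Or.inl hχ) hz

lemma xiC_symm (hχ : χ ≠ 1) (hp : χ.IsPrimitive) (z : ℂ) :
    xiC χ (1 - conj z) = rootNumber χ * conj (xiC χ z) := by
  rw [← xiC_conj hχ, xiC, hp.completedLFunction_one_sub, xiC]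
  have hN : (N : ℂ) ≠ 0 := NeZero.ne _
  have : (N : ℂ) ^ ((1 - conj z) / 2) * (N : ℂ) ^ (conj z - 1 / 2) = (N : ℂ) ^ (conj z / 2) := by
    rw [← Complex.cpow_add _ _ hN]; congr 1; ring
  rw [← this]; ring

lemma rootNumber_ne (hχ : χ ≠ 1) (hp : χ.IsPrimitive) : rootNumber χ ≠ 0 := by
  intro h
  have := xiC_symm hχ hp (-1)
  rw [h, zero_mul] at this
  exact xiC_ne_zero hχ (z := 1 - conj (-1)) (by simp) this

theorem xiC_xiLike (hχ : χ ≠ 1) (hp : χ.IsPrimitive) : XiLike (xiC χ) where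
  diff := xiC_differentiable hχ
  symm := ⟨rootNumber χ, rootNumber_ne hχ hp, xiC_symm hχ hp⟩
  ne_zero := fun z hz => xiC_ne_zero hχ hz.le
  growth := by
    have hN1 : N ≠ 1 := hχ ∘ level_one' _
    have hN : (1:ℝ) ≤ N := by exact_mod_cast NeZero.one_le
    obtain ⟨C1, hC1⟩ := completedL_strip_bdd (Φ := χ) (χ.map_zero' hN1)
      (χ.sum_eq_zero_of_ne_one hχ) (1 / 2) 2
    obtain ⟨C2, hC20, hC2⟩ := LFunction_norm_bdd χ
    have hnorm : ∀ z : ℂ, ‖(N : ℂ) ^ (z / 2)‖ = (N : ℝ) ^ (z.re / 2) := by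
      intro z
      rw [Complex.norm_natCast_cpow_of_pos (by exact_mod_cast NeZero.pos N)]
      simp
    have hpar : 0 ≤ par χ ∧ par χ ≤ 1 := by
      rcases par_cases χ with h | h <;> rw [h] <;> norm_num
    have hlog : 0 ≤ Real.log N := Real.log_nonneg hN
    refine growth_of_bounds (a := par χ) (xiC_symm hχ hp) (C := N * |C1| + C2)
      (A := Real.log N / 2) (by positivity) (by positivity) hpar.1 hpar.2 ?_ ?_
    · intro z h1 h2
      have h3 : (N : ℝ) ^ (z.re / 2) ≤ N := by
        calc (N : ℝ) ^ (z.re / 2) ≤ (N:ℝ) ^ (1:ℝ) :=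
              Real.rpow_le_rpow_of_exponent_le hN (by linarith)
          _ = N := Real.rpow_one _
      rw [xiC, norm_mul, hnorm]
      have h4 : ‖completedLFunction χ z‖ ≤ |C1| := (hC1 z h1 h2).trans (le_abs_self _)
      have h5 : (1:ℝ) ≤ (1 + ‖z‖) ^ 2 := by nlinarith [norm_nonneg z]
      calc (N : ℝ) ^ (z.re / 2) * ‖completedLFunction χ z‖ ≤ N * |C1| := by gcongr
        _ ≤ (N * |C1| + C2) * 1 := by linarith
        _ ≤ _ := by gcongr
    · intro z hz
      have h5 : (1:ℝ) ≤ (1 + ‖z‖) ^ 2 := by nlinarith [norm_nonneg z]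
      rw [xiC_eq hχ (by linarith), norm_mul, norm_mul, hnorm]
      have hG : ‖Gammaℝ (z + (par χ : ℂ))‖ ≤ Real.Gamma ((z.re + par χ) / 2) := by
        have := norm_Gammaℝ_le (z := z + (par χ : ℂ)) (by simp; linarith)
        simpa using this
      have hE : (N : ℝ) ^ (z.re / 2) = Real.exp (Real.log N / 2 * z.re) := by
        rw [Real.rpow_def_of_pos (by linarith)]; congr 1; ring
      have hG0 : 0 ≤ Real.Gamma ((z.re + par χ) / 2) := (norm_nonneg _).trans hG
      rw [hE]
      calc Real.exp (Real.log N / 2 * z.re) * ‖Gammaℝ (z + (par χ : ℂ))‖ * ‖LFunction χ z‖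
          ≤ Real.exp (Real.log N / 2 * z.re) * Real.Gamma ((z.re + par χ) / 2) * C2 := by
            gcongr; exact hC2 z hz
        _ = C2 * 1 * Real.exp (Real.log N / 2 * z.re) * Real.Gamma ((z.re + par χ) / 2) := by ring
        _ ≤ _ := by
          gcongr
          have : 0 ≤ N * |C1| := by positivity
          linarith

end DirichletCharacter

/-- `ξ(s)` for the Riemann zeta function. -/
noncomputable def xiZ (s : ℂ) : ℂ := s * (s - 1) * completedRiemannZeta₀ s + 1

lemma xiZ_eq {s : ℂ} (h0 : s ≠ 0) (h1 : s ≠ 1) :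
    xiZ s = s * (s - 1) * completedRiemannZeta s := by
  rw [xiZ, completedRiemannZeta_eq]
  have : 1 - s ≠ 0 := sub_ne_zero.mpr h1.symm
  field_simp
  ring

lemma xiZ_eq' {s : ℂ} (h0 : 0 < s.re) (h1 : s ≠ 1) :
    xiZ s = s * (s - 1) * Gammaℝ s * riemannZeta s := by
  have h : s ≠ 0 := by rintro rfl; simp at h0
  rw [xiZ_eq h h1, riemannZeta_def_of_ne_zero h]
  have := Complex.Gammaℝ_ne_zero_of_re_pos h0
  field_simp

lemma xiZ_differentiable : Differentiable ℂ xiZ := by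
  unfold xiZ
  have := differentiable_completedZeta₀
  fun_prop

lemma zeta_conj_re {z : ℂ} (hz : 1 < z.re) : riemannZeta (conj z) = conj (riemannZeta z) := by
  have h := DirichletCharacter.LFunction_inv_conj (1 : DirichletCharacter ℂ 1) hz
  rw [DirichletCharacter.LFunction_modOne_eq, DirichletCharacter.LFunction_modOne_eq] at h
  exact h

lemma xiZ_conj (z : ℂ) : xiZ (conj z) = conj (xiZ z) := by
  refine entire_conj_ext xiZ_differentiable xiZ_differentiable ?_ z
  intro z hz
  have h1 : z ≠ 1 := by rintro rfl; simp at hz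
  rw [xiZ_eq' (by linarith) h1, xiZ_eq' (by simp; linarith)
    (by intro h; apply h1; have := congrArg conj h; simpa using this), zeta_conj_re hz, Gammaℝ_conj]
  simp

lemma xiZ_symm (z : ℂ) : xiZ (1 - conj z) = 1 * conj (xiZ z) := by
  rw [← xiZ_conj, xiZ, xiZ, completedRiemannZeta₀_one_sub]; ring

lemma xiZ_ne_zero {z : ℂ} (hz : 1 < z.re) : xiZ z ≠ 0 := by
  have h1 : z ≠ 1 := by rintro rfl; simp at hz
  have h0 : z ≠ 0 := by rintro rfl; simp at hz; linarith
  rw [xiZ_eq' (by linarith) h1]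
  exact mul_ne_zero (mul_ne_zero (mul_ne_zero h0 (sub_ne_zero.mpr h1))
    (Complex.Gammaℝ_ne_zero_of_re_pos (by linarith))) (riemannZeta_ne_zero_of_one_lt_re hz)

theorem xiZ_xiLike : XiLike xiZ where
  diff := xiZ_differentiable
  symm := ⟨1, one_ne_zero, xiZ_symm⟩
  ne_zero := fun z hz => xiZ_ne_zero hz
  growth := by
    obtain ⟨C1, hC1⟩ := even₀_strip_bdd 0 (1 / 2) 2
    obtain ⟨C2, hC20, hC2⟩ := DirichletCharacter.LFunction_norm_bdd (1 : DirichletCharacter ℂ 1)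
    rw [DirichletCharacter.LFunction_modOne_eq] at hC2
    have hp : ∀ z : ℂ, ‖z * (z - 1)‖ ≤ (1 + ‖z‖) ^ 2 := by
      intro z
      rw [norm_mul]
      have : ‖z - 1‖ ≤ ‖z‖ + 1 := by simpa using norm_sub_le z 1
      nlinarith [norm_nonneg z, norm_nonneg (z - 1)]
    refine growth_of_bounds (a := 0) xiZ_symm (C := |C1| + 1 + C2)
      (A := 0) (by positivity) le_rfl le_rfl zero_le_one ?_ ?_
    · intro z h1 h2
      have h5 : (1:ℝ) ≤ (1 + ‖z‖) ^ 2 := by nlinarith [norm_nonneg z]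
      rw [xiZ]
      have h4 : ‖completedRiemannZeta₀ z‖ ≤ |C1| := (hC1 z h1 h2).trans (le_abs_self _)
      have h6 := norm_add_le (z * (z - 1) * completedRiemannZeta₀ z) 1
      rw [norm_mul, norm_one] at h6
      have h7 : ‖z * (z - 1)‖ * ‖completedRiemannZeta₀ z‖ ≤ (1 + ‖z‖) ^ 2 * |C1| := by
        gcongr; exact hp z
      have h8 : 0 ≤ C2 * (1 + ‖z‖) ^ 2 := by positivity
      nlinarith
    · intro z hz
      have h1 : z ≠ 1 := by rintro rfl; norm_num at hz
      rw [xiZ_eq' (by linarith) h1, norm_mul, norm_mul]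
      have hG : ‖Gammaℝ z‖ ≤ Real.Gamma (z.re / 2) := norm_Gammaℝ_le (by linarith)
      have hG0 : 0 ≤ Real.Gamma (z.re / 2) := (norm_nonneg _).trans hG
      rw [zero_mul, Real.exp_zero, mul_one, add_zero]
      calc ‖z * (z - 1)‖ * ‖Gammaℝ z‖ * ‖riemannZeta z‖
          ≤ (1 + ‖z‖) ^ 2 * Real.Gamma (z.re / 2) * C2 := by
            gcongr
            · exact hp z
            · exact hC2 z hz
        _ = C2 * (1 + ‖z‖) ^ 2 * Real.Gamma (z.re / 2) := by ring
        _ ≤ _ := by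
          gcongr
          have : 0 ≤ |C1| := by positivity
          linarith

open Complex Filter Topology Metric ComplexConjugate
open ArithmeticFunction (vonMangoldt)

lemma logDeriv_congr_pt {f g : ℂ → ℂ} {s : ℂ} (h : f =ᶠ[𝓝 s] g) : logDeriv f s = logDeriv g s := by
  rw [logDeriv_apply, logDeriv_apply, h.deriv_eq, h.eq_of_nhds]

lemma logDeriv_cpow_half (N : ℕ) (hN : N ≠ 0) (s : ℂ) :
    logDeriv (fun s : ℂ => (N : ℂ) ^ (s / 2)) s = (Real.log N : ℂ) / 2 := by
  have hN' : (N : ℂ) ≠ 0 := by exact_mod_cast hN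
  have h1 : HasDerivAt (fun s : ℂ => s / 2) (1 / 2) s := (hasDerivAt_id s).div_const 2
  have h := h1.const_cpow (c := (N : ℂ)) (Or.inl hN')
  rw [logDeriv_apply, h.deriv, Complex.natCast_log]
  have : (N : ℂ) ^ (s / 2) ≠ 0 := by rw [Complex.cpow_ne_zero_iff]; exact Or.inl hN'
  field_simp

lemma differentiableAt_Gamma_half {z : ℂ} (hz : 0 < z.re) :
    DifferentiableAt ℂ Complex.Gamma (z / 2) := by
  refine Complex.differentiableAt_Gamma _ fun m h => ?_
  have := congrArg Complex.re h
  simp at this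
  have hm : (0:ℝ) ≤ m := Nat.cast_nonneg m
  linarith

lemma differentiableAt_Gammaℝ {z : ℂ} (hz : 0 < z.re) : DifferentiableAt ℂ Complex.Gammaℝ z := by
  have h : Complex.Gammaℝ = fun s : ℂ => (Real.pi : ℂ) ^ (-s / 2) * Complex.Gamma (s / 2) := by
    ext s; exact Complex.Gammaℝ_def s
  rw [h]
  refine DifferentiableAt.mul ?_ ?_
  · exact (differentiableAt_id.neg.div_const 2).const_cpow
      (Or.inl (by exact_mod_cast Real.pi_pos.ne'))
  · exact (differentiableAt_Gamma_half hz).comp z (differentiableAt_id.div_const 2)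

lemma logDeriv_Gammaℝ {z : ℂ} (hz : 0 < z.re) :
    logDeriv Complex.Gammaℝ z = -(Real.log Real.pi : ℂ) / 2 + 1 / 2 * Complex.digamma (z / 2) := by
  have h : Complex.Gammaℝ = fun s : ℂ => (Real.pi : ℂ) ^ (-s / 2) * Complex.Gamma (s / 2) := by
    ext s; exact Complex.Gammaℝ_def s
  have hpi : (Real.pi : ℂ) ≠ 0 := by exact_mod_cast Real.pi_pos.ne'
  have h1 : HasDerivAt (fun s : ℂ => -s / 2) (-1 / 2) z := (hasDerivAt_id z).neg.div_const 2
  have h2 : HasDerivAt (fun s : ℂ => s / 2) (1 / 2) z := (hasDerivAt_id z).div_const 2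
  have ha := h1.const_cpow (c := (Real.pi : ℂ)) (Or.inl hpi)
  have hb := (differentiableAt_Gamma_half hz).hasDerivAt.comp z h2
  have hG : Complex.Gamma (z / 2) ≠ 0 := Complex.Gamma_ne_zero_of_re_pos (by simpa using hz)
  have hc : (Real.pi : ℂ) ^ (-z / 2) ≠ 0 := by rw [Complex.cpow_ne_zero_iff]; exact Or.inl hpi
  rw [h, logDeriv_apply]
  have hd := (ha.mul hb).deriv
  have hd' : deriv (fun s : ℂ => (Real.pi : ℂ) ^ (-s / 2) * Complex.Gamma (s / 2)) z = _ := hd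
  rw [hd', Complex.digamma_def, logDeriv_apply, Complex.ofReal_log Real.pi_pos.le]
  simp only [Function.comp]
  field_simp

namespace DirichletCharacter
variable {N : ℕ} [NeZero N] {χ : DirichletCharacter ℂ N}

lemma logDeriv_xiC (hχ : χ ≠ 1) {s : ℂ} (hs : 1 < s.re) :
    (logDeriv (xiC χ) s).re = Real.log N / 2 - Real.log Real.pi / 2
      + 1 / 2 * (Complex.digamma ((s + (par χ : ℂ)) / 2)).re + (logDeriv (LFunction χ) s).re := by
  have hpar : 0 ≤ par χ := by rcases par_cases χ with h | h <;> rw [h] <;> norm_num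
  have hpos : 0 < (s + (par χ : ℂ)).re := by simp; linarith
  have hev : xiC χ =ᶠ[𝓝 s] fun s => ((N : ℂ) ^ (s / 2) * Gammaℝ (s + (par χ : ℂ))) * LFunction χ s := by
    have : {z : ℂ | 0 < z.re} ∈ 𝓝 s :=
      (isOpen_lt continuous_const Complex.continuous_re).mem_nhds (by simp; linarith)
    filter_upwards [this] with z hz
    exact xiC_eq hχ hz
  have hN' : (N : ℂ) ≠ 0 := NeZero.ne _
  have d1 : DifferentiableAt ℂ (fun s : ℂ => (N : ℂ) ^ (s / 2)) s :=
    (differentiableAt_id.div_const 2).const_cpow (Or.inl hN')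
  have d2 : DifferentiableAt ℂ (fun s : ℂ => Gammaℝ (s + (par χ : ℂ))) s :=
    (differentiableAt_Gammaℝ hpos).comp s (differentiableAt_id.add_const _)
  have n1 : (N : ℂ) ^ (s / 2) ≠ 0 := by rw [Complex.cpow_ne_zero_iff]; exact Or.inl hN'
  have n2 : Gammaℝ (s + (par χ : ℂ)) ≠ 0 := Complex.Gammaℝ_ne_zero_of_re_pos hpos
  have n3 : LFunction χ s ≠ 0 := LFunction_ne_zero_of_one_le_re χ (Or.inl hχ) hs.le
  rw [logDeriv_congr_pt hev, logDeriv_mul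
    (f := fun s : ℂ => (N : ℂ) ^ (s / 2) * Gammaℝ (s + (par χ : ℂ))) s (mul_ne_zero n1 n2) n3
    (d1.mul d2) (differentiable_LFunction hχ s), logDeriv_mul (f := fun s : ℂ => (N : ℂ) ^ (s / 2))
    (g := fun s : ℂ => Gammaℝ (s + (par χ : ℂ))) s n1 n2 d1 d2, logDeriv_cpow_half N (NeZero.ne N)]
  have h3 : logDeriv (fun s : ℂ => Gammaℝ (s + (par χ : ℂ))) s = logDeriv Gammaℝ (s + (par χ : ℂ)) := by
    rw [logDeriv_apply, logDeriv_apply, deriv_comp_add_const]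
  rw [h3, logDeriv_Gammaℝ hpos]
  have e1 : ((Real.log N : ℂ) / 2).re = Real.log N / 2 := by
    rw [← Complex.ofReal_ofNat, ← Complex.ofReal_div, Complex.ofReal_re]
  have e2 : (-(Real.log Real.pi : ℂ) / 2).re = - Real.log Real.pi / 2 := by
    rw [← Complex.ofReal_neg, ← Complex.ofReal_ofNat, ← Complex.ofReal_div, Complex.ofReal_re]
  have e3 : ∀ z : ℂ, (1 / 2 * z).re = 1 / 2 * z.re := by
    intro z
    have : (1 / 2 : ℂ) = ((1 / 2 : ℝ) : ℂ) := by push_cast; rfl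
    rw [this, Complex.re_ofReal_mul]
  rw [Complex.add_re, Complex.add_re, Complex.add_re, e1, e2, e3]
  ring

end DirichletCharacter

lemma logDeriv_xiZ {s : ℂ} (hs : 1 < s.re) :
    (logDeriv xiZ s).re = gk s.re s.im + gk (s.re - 1) s.im - Real.log Real.pi / 2
      + 1 / 2 * (Complex.digamma (s / 2)).re + (logDeriv riemannZeta s).re := by
  have hpos : 0 < s.re := by linarith
  have hs1 : s ≠ 1 := by rintro rfl; simp at hs
  have hs0 : s ≠ 0 := by rintro rfl; simp at hs; linarith
  have hev : xiZ =ᶠ[𝓝 s] fun s => (s * (s - 1)) * Gammaℝ s * riemannZeta s := by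
    have : {z : ℂ | 1 < z.re} ∈ 𝓝 s :=
      (isOpen_lt continuous_const Complex.continuous_re).mem_nhds hs
    filter_upwards [this] with z hz
    exact xiZ_eq' (lt_trans zero_lt_one hz) (by rintro rfl; simp at hz)
  have d1 : DifferentiableAt ℂ (fun s : ℂ => s * (s - 1)) s := by fun_prop
  have d2 : DifferentiableAt ℂ Gammaℝ s := differentiableAt_Gammaℝ hpos
  have n1 : s * (s - 1) ≠ 0 := mul_ne_zero hs0 (sub_ne_zero.mpr hs1)
  have n2 : Gammaℝ s ≠ 0 := Complex.Gammaℝ_ne_zero_of_re_pos hpos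
  have n3 : riemannZeta s ≠ 0 := riemannZeta_ne_zero_of_one_lt_re hs
  rw [logDeriv_congr_pt hev, logDeriv_mul
    (f := fun s : ℂ => s * (s - 1) * Gammaℝ s) s (mul_ne_zero n1 n2) n3 (d1.mul d2)
    (differentiableAt_riemannZeta hs1), logDeriv_mul (f := fun s : ℂ => s * (s - 1)) s n1 n2 d1 d2]
  have h3 : logDeriv (fun s : ℂ => s * (s - 1)) s = 1 / s + 1 / (s - 1) := by
    rw [logDeriv_mul (f := fun s : ℂ => s) (g := fun s : ℂ => s - 1) s hs0
      (sub_ne_zero.mpr hs1) differentiableAt_fun_id (by fun_prop)]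
    congr 1
    · rw [logDeriv_apply]; simp
    · rw [logDeriv_apply]; simp
  have e2 : (-(Real.log Real.pi : ℂ) / 2).re = - Real.log Real.pi / 2 := by
    rw [← Complex.ofReal_neg, ← Complex.ofReal_ofNat, ← Complex.ofReal_div, Complex.ofReal_re]
  have e3 : ∀ z : ℂ, (1 / 2 * z).re = 1 / 2 * z.re := by
    intro z
    have : (1 / 2 : ℂ) = ((1 / 2 : ℝ) : ℂ) := by push_cast; rfl
    rw [this, Complex.re_ofReal_mul]
  rw [h3, logDeriv_Gammaℝ hpos, Complex.add_re, Complex.add_re, Complex.add_re, Complex.add_re,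
    re_inv_eq, re_inv_eq, e2, e3]
  simp
  ring

/-- The weight. -/
noncomputable def wn (n : ℕ) : ℝ := 1 - 136 / 125 * (n : ℝ) ^ (-1 : ℝ) + 3 / 5 * (n : ℝ) ^ (-(3 / 2) : ℝ)

/-- The summand. -/
noncomputable def Sterm {N : ℕ} (χ : DirichletCharacter ℂ N) (s : ℂ) (n : ℕ) : ℝ :=
  vonMangoldt n * wn n * (χ n * (n : ℂ) ^ (-s)).re

lemma hasSum_re_logDeriv {N : ℕ} [NeZero N] (χ : DirichletCharacter ℂ N) {s : ℂ} (hs : 1 < s.re) :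
    HasSum (fun n : ℕ => vonMangoldt n * (χ n * (n : ℂ) ^ (-s)).re)
      (-(logDeriv (DirichletCharacter.LFunction χ) s).re) := by
  have h1 := (DirichletCharacter.LSeriesSummable_twist_vonMangoldt χ hs).LSeriesHasSum
  rw [DirichletCharacter.LSeries_twist_vonMangoldt_eq χ hs,
    ← DirichletCharacter.deriv_LFunction_eq_deriv_LSeries χ hs,
    ← DirichletCharacter.LFunction_eq_LSeries χ hs, neg_div, ← logDeriv_apply] at h1
  have h2 := Complex.hasSum_re h1
  rw [Complex.neg_re] at h2
  refine h2.congr_fun ?_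
  intro n
  rcases eq_or_ne n 0 with rfl | hn
  · simp
  · rw [LSeries.term_of_ne_zero hn, Complex.cpow_neg, ← div_eq_mul_inv]
    simp only [Pi.mul_apply]
    rw [mul_comm (χ n), mul_div_assoc, Complex.re_ofReal_mul]

lemma Sterm_hasSum {N : ℕ} [NeZero N] (χ : DirichletCharacter ℂ N) {s : ℂ} (hs : 1 < s.re) :
    HasSum (Sterm χ s) (-Dop (DirichletCharacter.LFunction χ) s) := by
  have h0 := hasSum_re_logDeriv χ hs
  have h1 := hasSum_re_logDeriv χ (s := s + 1) (by simp; linarith)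
  have h2 := hasSum_re_logDeriv χ (s := s + 3 / 2) (by simp; norm_num; linarith)
  have h := (h0.sub (h1.mul_left (136 / 125))).add (h2.mul_left (3 / 5))
  have e : -(logDeriv (DirichletCharacter.LFunction χ) s).re -
      136 / 125 * -(logDeriv (DirichletCharacter.LFunction χ) (s + 1)).re +
      3 / 5 * -(logDeriv (DirichletCharacter.LFunction χ) (s + 3 / 2)).re
      = -Dop (DirichletCharacter.LFunction χ) s := by rw [Dop]; ring
  rw [e] at h
  refine h.congr_fun ?_
  intro n
  rcases eq_or_ne n 0 with rfl | hn
  · simp [Sterm]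
  · have hn0 : (0:ℝ) < n := by exact_mod_cast Nat.pos_of_ne_zero hn
    have hn' : (n : ℂ) ≠ 0 := by exact_mod_cast hn
    have key : ∀ r : ℝ, (χ n * (n : ℂ) ^ (-(s + (r : ℂ)))).re
        = (n : ℝ) ^ (-r) * (χ n * (n : ℂ) ^ (-s)).re := by
      intro r
      rw [neg_add, Complex.cpow_add _ _ hn', ← Complex.re_ofReal_mul, Complex.ofReal_cpow hn0.le]
      push_cast
      congr 1; ring
    have k1 := key 1
    have k2 := key (3 / 2)
    push_cast at k1 k2
    rw [k1, k2, Sterm, wn]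
    ring

open Complex Filter Topology Metric ComplexConjugate
open ArithmeticFunction (vonMangoldt)

open Classical in
/-- xi of a primitive character. -/
noncomputable def xiG {N : ℕ} [NeZero N] (ψ : DirichletCharacter ℂ N) : ℂ → ℂ :=
  if ψ = 1 then xiZ else DirichletCharacter.xiC ψ

open Classical in
/-- pole indicator -/
noncomputable def pole {N : ℕ} (ψ : DirichletCharacter ℂ N) : ℝ := if ψ = 1 then 1 else 0

lemma xiG_xiLike {N : ℕ} [NeZero N] {ψ : DirichletCharacter ℂ N} (hp : ψ.IsPrimitive) :
    XiLike (xiG ψ) := by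
  unfold xiG
  split_ifs with h
  · exact xiZ_xiLike
  · exact DirichletCharacter.xiC_xiLike h hp

lemma prim_one_level {N : ℕ} {ψ : DirichletCharacter ℂ N} (hN : N ≠ 0) (hp : ψ.IsPrimitive)
    (h : ψ = 1) : N = 1 := by
  subst h
  have : NeZero N := ⟨hN⟩
  rw [DirichletCharacter.IsPrimitive, DirichletCharacter.conductor_one] at hp
  exact hp.symm

lemma xiG_conj {N : ℕ} [NeZero N] (ψ : DirichletCharacter ℂ N) (z : ℂ) :
    xiG ψ⁻¹ (conj z) = conj (xiG ψ z) := by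
  unfold xiG
  by_cases h : ψ = 1
  · rw [if_pos h, if_pos (by rw [h]; simp), xiZ_conj]
  · rw [if_neg h, if_neg (DirichletCharacter.inv_ne_one h), DirichletCharacter.xiC_conj h]

lemma xiG_eq_zero {N : ℕ} [NeZero N] {ψ : DirichletCharacter ℂ N} (hp : ψ.IsPrimitive) {ρ : ℂ}
    (h0 : 0 < ρ.re) (h1 : ρ ≠ 1) : xiG ψ ρ = 0 ↔ DirichletCharacter.LFunction ψ ρ = 0 := by
  unfold xiG
  split_ifs with h
  · obtain rfl := prim_one_level (NeZero.ne N) hp h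
    rw [DirichletCharacter.LFunction_modOne_eq, xiZ_eq' h0 h1]
    have : ρ ≠ 0 := by rintro rfl; simp at h0
    simp [this, sub_ne_zero.mpr h1, Complex.Gammaℝ_ne_zero_of_re_pos h0]
  · rw [DirichletCharacter.xiC_eq h h0]
    have h2 : Gammaℝ (ρ + (DirichletCharacter.par ψ : ℂ)) ≠ 0 := by
      refine Complex.Gammaℝ_ne_zero_of_re_pos ?_
      rcases DirichletCharacter.par_cases ψ with h | h <;> simp [h] <;> linarith
    have h3 : (N : ℂ) ^ (ρ / 2) ≠ 0 := by
      rw [Complex.cpow_ne_zero_iff]; exact Or.inl (NeZero.ne _)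
    simp [h2, h3]

lemma S_eq_nonprincipal {N : ℕ} [NeZero N] {ψ : DirichletCharacter ℂ N} (h : ψ ≠ 1)
    {σ τ : ℝ} (hσ : 1 < σ) :
    -Dop (DirichletCharacter.LFunction ψ) ⟨σ, τ⟩ = 32 / 125 * Real.log N
      + Tg (σ + DirichletCharacter.par ψ) τ - Dop (DirichletCharacter.xiC ψ) ⟨σ, τ⟩ := by
  have h0 := DirichletCharacter.logDeriv_xiC h (s := ⟨σ, τ⟩) hσ
  have h1 := DirichletCharacter.logDeriv_xiC h (s := (⟨σ, τ⟩ : ℂ) + 1) (by simp; linarith)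
  have h2 := DirichletCharacter.logDeriv_xiC h (s := (⟨σ, τ⟩ : ℂ) + 3 / 2)
    (by simp; norm_num; linarith)
  unfold Dop Tg
  rw [h0, h1, h2]
  set a := DirichletCharacter.par ψ
  have e0 : ((⟨σ, τ⟩ : ℂ) + (a : ℂ)) / 2 = ⟨(σ + a) / 2, τ / 2⟩ := by
    apply Complex.ext <;> simp
  have e1 : ((⟨σ, τ⟩ : ℂ) + 1 + (a : ℂ)) / 2 = ⟨(σ + a + 1) / 2, τ / 2⟩ := by
    apply Complex.ext <;> simp <;> ring
  have e2 : ((⟨σ, τ⟩ : ℂ) + 3 / 2 + (a : ℂ)) / 2 = ⟨(σ + a + 3 / 2) / 2, τ / 2⟩ := by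
    apply Complex.ext <;> simp <;> ring
  rw [e0, e1, e2]
  ring

lemma S_eq_zeta {σ τ : ℝ} (hσ : 1 < σ) :
    -Dop riemannZeta ⟨σ, τ⟩ = hk σ τ + hk (σ - 1) τ + Tg σ τ - Dop xiZ ⟨σ, τ⟩ := by
  have h0 := logDeriv_xiZ (s := ⟨σ, τ⟩) hσ
  have h1 := logDeriv_xiZ (s := (⟨σ, τ⟩ : ℂ) + 1) (by simp; linarith)
  have h2 := logDeriv_xiZ (s := (⟨σ, τ⟩ : ℂ) + 3 / 2)
    (by simp; norm_num; linarith)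
  unfold Dop Tg hk
  rw [h0, h1, h2]
  have e0 : ((⟨σ, τ⟩ : ℂ)) / 2 = ⟨σ / 2, τ / 2⟩ := by
    apply Complex.ext <;> simp
  have e1 : ((⟨σ, τ⟩ : ℂ) + 1) / 2 = ⟨(σ + 1) / 2, τ / 2⟩ := by
    apply Complex.ext <;> simp
  have e2 : ((⟨σ, τ⟩ : ℂ) + 3 / 2) / 2 = ⟨(σ + 3 / 2) / 2, τ / 2⟩ := by
    apply Complex.ext <;> simp
  rw [e0, e1, e2]
  have r1 : ((⟨σ, τ⟩ : ℂ) + 1).re = σ + 1 := by simp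
  have r2 : ((⟨σ, τ⟩ : ℂ) + 3 / 2).re = σ + 3 / 2 := by simp
  have i1 : ((⟨σ, τ⟩ : ℂ) + 1).im = τ := by simp
  have i2 : ((⟨σ, τ⟩ : ℂ) + 3 / 2).im = τ := by simp
  rw [r1, r2, i1, i2]
  have s1 : σ + 1 - 1 = σ - 1 + 1 := by ring
  have s2 : σ + 3 / 2 - 1 = σ - 1 + 3 / 2 := by ring
  simp only [s1, s2]
  ring

open Classical in
theorem S_le {N : ℕ} [NeZero N] {ψ : DirichletCharacter ℂ N} (hp : ψ.IsPrimitive) {l τ : ℝ}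
    (hl0 : 0 < l) (hl : l ≤ 1 ∨ (ψ = 1 ∧ l ≤ 2)) (W : Finset ℂ) (hW : ∀ ρ ∈ W, xiG ψ ρ = 0)
    (hWre : ∀ ρ ∈ W, 1 / 2 < ρ.re) :
    ∑' n, Sterm ψ ⟨1 + l, τ⟩ n ≤ pole ψ * gk l τ + 32 / 125 * Real.log N + Eg τ
      - ∑ ρ ∈ W, ((if deriv (xiG ψ) ρ = 0 then 2 else 1 : ℕ) : ℝ) *
        (gk (l + (1 - ρ.re)) (τ - ρ.im) - 8 / 25 * (1 - ρ.re)) := by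
  have hx := xiG_xiLike hp
  have hD := hx.D_ge (s := ⟨1 + l, τ⟩) (by simp; linarith) W hW hWre
    (fun β u h0 h1 => Hk_nonneg hl0 h0 h1)
  have hD2 : ∑ ρ ∈ W, ((if deriv (xiG ψ) ρ = 0 then 2 else 1 : ℕ) : ℝ) *
        (gk (l + (1 - ρ.re)) (τ - ρ.im) - 8 / 25 * (1 - ρ.re)) ≤ Dop (xiG ψ) ⟨1 + l, τ⟩ := by
    refine le_trans (Finset.sum_le_sum fun ρ hρ => ?_) hD
    refine mul_le_mul_of_nonneg_left ?_ (Nat.cast_nonneg _)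
    have h1 : ρ.re ≤ 1 := hx.re_le (hW ρ hρ)
    have h2 := hWre ρ hρ
    have h3 := Hk_lower (l := l) (η := 1 - ρ.re) (u := τ - ρ.im) hl0 (by linarith) (by linarith)
    simpa using h3
  rw [(Sterm_hasSum ψ (s := ⟨1 + l, τ⟩) (by simp; linarith)).tsum_eq]
  unfold pole
  by_cases h : ψ = 1
  · have hl2 : l ≤ 2 := by rcases hl with h | h <;> linarith
    obtain rfl := prim_one_level (NeZero.ne N) hp h
    have hxi : xiG ψ = xiZ := by unfold xiG; rw [if_pos h]
    rw [DirichletCharacter.LFunction_modOne_eq, S_eq_zeta (by linarith), if_pos h]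
    have hT := Tg_dhat_le_Eg l τ hl0.le hl2
    have hid : hk l τ + hk (1 + l) τ = gk l τ + dhat l τ := by
      unfold hk dhat
      have a1 : l + 1 = 1 + l := by ring
      have a2 : l + 3 / 2 = 3 / 2 + l := by ring
      have a3 : 1 + l + 1 = 2 + l := by ring
      have a4 : 1 + l + 3 / 2 = 5 / 2 + l := by ring
      rw [a1, a2, a3, a4]; ring
    have e : 1 + l - 1 = l := by ring
    rw [e]
    rw [hxi] at hD2 ⊢
    simp only [Nat.cast_one, Real.log_one, mul_zero]
    linarith
  · have hl1 : l ≤ 1 := by rcases hl with h' | h'; exacts [h', absurd h'.1 h]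
    have hxi : xiG ψ = DirichletCharacter.xiC ψ := by unfold xiG; rw [if_neg h]
    rw [S_eq_nonprincipal h (by linarith), if_neg h]
    have hT : Tg (1 + l + DirichletCharacter.par ψ) τ ≤ Eg τ := by
      rcases DirichletCharacter.par_cases ψ with hh | hh <;> rw [hh]
      · exact Tg_le_Eg _ _ (by linarith) (by linarith)
      · exact Tg_le_Eg _ _ (by linarith) (by linarith)
    rw [hxi] at hD2 ⊢
    linarith

open Complex Filter Topology Metric ComplexConjugate
open ArithmeticFunction (vonMangoldt)

instance conductor_neZero {q : ℕ} [NeZero q] (χ : DirichletCharacter ℂ q) : NeZero χ.conductor :=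
  ⟨χ.conductor_ne_zero⟩

/-- Values of the inducing primitive character. -/
noncomputable def pv {q : ℕ} (χ : DirichletCharacter ℂ q) (n : ℕ) : ℂ := χ.primitiveCharacter n

section
variable {q : ℕ} [NeZero q]

lemma pv_eq_zero (χ : DirichletCharacter ℂ q) (n : ℕ) (h : ¬ n.Coprime χ.conductor) :
    pv χ n = 0 := by
  have := (DirichletCharacter.apply_eq_zero_iff χ.primitiveCharacter (n : ℤ)).mpr
    (by rwa [Nat.isCoprime_iff_coprime])
  simpa [pv] using this

lemma pv_norm_le (χ : DirichletCharacter ℂ q) (n : ℕ) : ‖pv χ n‖ ≤ 1 :=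
  DirichletCharacter.norm_le_one _ _

lemma pv_one (n : ℕ) : pv (1 : DirichletCharacter ℂ q) n = 1 := by
  unfold pv
  rw [DirichletCharacter.primitiveCharacter_one]
  have h : (n : ZMod (DirichletCharacter.conductor (1 : DirichletCharacter ℂ q))) = 1 := by
    have h1 : DirichletCharacter.conductor (1 : DirichletCharacter ℂ q) = 1 :=
      DirichletCharacter.conductor_one
    generalize hN : DirichletCharacter.conductor (1 : DirichletCharacter ℂ q) = N at *
    subst h1
    exact Subsingleton.elim _ _
  rw [h, map_one]

lemma pv_mul (χ ψ : DirichletCharacter ℂ q) (n : ℕ) (h1 : n.Coprime χ.conductor)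
    (h2 : n.Coprime ψ.conductor) : pv (χ * ψ) n = pv χ n * pv ψ n := by
  have h := Nat.lcm_dvd χ.conductor_dvd_level ψ.conductor_dvd_level
  have hM : NeZero (χ.conductor.lcm ψ.conductor) :=
    ⟨Nat.lcm_ne_zero (NeZero.ne _) (NeZero.ne _)⟩
  have hcl : DirichletCharacter.changeLevel h
      (χ.primitiveCharacter.mul ψ.primitiveCharacter) = χ * ψ := by
    rw [DirichletCharacter.mul, MonoidHom.map_mul, ← DirichletCharacter.changeLevel_trans,
      ← DirichletCharacter.changeLevel_trans,
      DirichletCharacter.changeLevel_primitiveCharacter,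
      DirichletCharacter.changeLevel_primitiveCharacter]
  have hcop : n.Coprime (χ.conductor.lcm ψ.conductor) :=
    Nat.Coprime.coprime_dvd_right (Nat.lcm_dvd_mul _ _) (Nat.Coprime.mul_right h1 h2)
  have hcop' : IsCoprime (n : ℤ) (χ.conductor.lcm ψ.conductor : ℕ) :=
    Nat.isCoprime_iff_coprime.mpr hcop
  have e := DirichletCharacter.primitiveCharacter_changeLevel_apply h
    (χ.primitiveCharacter.mul ψ.primitiveCharacter) (n : ℤ)
  rw [hcl, DirichletCharacter.primitiveCharacter_apply_of_isCoprime _ hcop',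
    DirichletCharacter.mul, MulChar.mul_apply,
    DirichletCharacter.changeLevel_eq_cast_of_dvd' _ _ hcop',
    DirichletCharacter.changeLevel_eq_cast_of_dvd' _ _ hcop'] at e
  simpa [pv] using e

lemma coprime_cond_mul {χ ψ : DirichletCharacter ℂ q} {n : ℕ} (h1 : n.Coprime χ.conductor)
    (h2 : n.Coprime ψ.conductor) : n.Coprime (χ * ψ).conductor :=
  Nat.Coprime.coprime_dvd_right
    ((DirichletCharacter.conductor_mul_dvd_lcm_conductor χ ψ).trans (Nat.lcm_dvd_mul _ _))
    (Nat.Coprime.mul_right h1 h2)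

lemma coprime_cond_inv {χ : DirichletCharacter ℂ q} {n : ℕ} (h1 : n.Coprime χ.conductor) :
    n.Coprime (χ⁻¹).conductor := by rwa [DirichletCharacter.conductor_inv]

lemma pv_pow (χ : DirichletCharacter ℂ q) (n : ℕ) (h1 : n.Coprime χ.conductor) (k : ℕ) :
    pv (χ ^ k) n = pv χ n ^ k := by
  induction k with
  | zero => simp [pv_one]
  | succ k ih =>
    rw [pow_succ, pow_succ, pv_mul _ _ _ (Nat.Coprime.coprime_dvd_right
      (DirichletCharacter.conductor_pow_dvd χ k) h1) h1, ih]

lemma pv_norm_eq (χ : DirichletCharacter ℂ q) (n : ℕ) (h1 : n.Coprime χ.conductor) :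
    ‖pv χ n‖ = 1 := by
  have h := pv_mul χ χ⁻¹ n h1 (coprime_cond_inv h1)
  rw [mul_inv_cancel, pv_one] at h
  have h2 := congrArg norm h
  rw [norm_mul, norm_one] at h2
  have h3 := pv_norm_le χ n
  have h4 := pv_norm_le χ⁻¹ n
  nlinarith [norm_nonneg (pv χ n), norm_nonneg (pv χ⁻¹ n)]

lemma trig_nonneg (w : ℂ) (hw : ‖w‖ = 1) :
    0 ≤ 18 + 30 * w.re + 17 * (w ^ 2).re + 6 * (w ^ 3).re + (w ^ 4).re := by
  have h : w.re * w.re + w.im * w.im = 1 := by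
    have := Complex.sq_norm w
    rw [hw, Complex.normSq_apply] at this; linarith
  have him : w.im * w.im = 1 - w.re * w.re := by linarith
  have e2 : (w ^ 2).re = 2 * w.re ^ 2 - 1 := by
    simp [pow_succ]; nlinarith
  have e3 : (w ^ 3).re = 4 * w.re ^ 3 - 3 * w.re := by
    simp [pow_succ]
    linear_combination (-3 * w.re) * him
  have e4 : (w ^ 4).re = 8 * w.re ^ 4 - 8 * w.re ^ 2 + 1 := by
    simp [pow_succ]
    linear_combination (w.im * w.im - 7 * w.re ^ 2 + 1) * him
  rw [e2, e3, e4]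
  have : 18 + 30 * w.re + 17 * (2 * w.re ^ 2 - 1) + 6 * (4 * w.re ^ 3 - 3 * w.re)
      + (8 * w.re ^ 4 - 8 * w.re ^ 2 + 1) = 2 * ((1 + w.re) * (1 + 2 * w.re)) ^ 2 := by ring
  rw [this]; positivity

/-- Coefficients. -/
def ac (k : Fin 5) : ℝ := ![18, 30, 17, 6, 1] k

lemma Q_nonneg (χ : DirichletCharacter ℂ q) (n : ℕ) (z : ℂ) (hz : ‖z‖ = 1) :
    0 ≤ ∑ k : Fin 5, ac k * (pv (χ ^ (k : ℕ)) n * z ^ (k : ℕ)).re := by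
  have hb : ∀ k : ℕ, -1 ≤ (pv (χ ^ k) n * z ^ k).re := by
    intro k
    have h1 : ‖pv (χ ^ k) n * z ^ k‖ ≤ 1 := by
      rw [norm_mul, norm_pow, hz, one_pow, mul_one]; exact pv_norm_le _ _
    have := Complex.abs_re_le_norm (pv (χ ^ k) n * z ^ k)
    have := neg_abs_le (pv (χ ^ k) n * z ^ k).re
    linarith
  have h0 : (pv (χ ^ 0) n * z ^ 0).re = 1 := by simp [pv_one]
  have hz0 : ∀ k : ℕ, ¬ n.Coprime (χ ^ k).conductor → (pv (χ ^ k) n * z ^ k).re = 0 := by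
    intro k hk; rw [pv_eq_zero _ _ hk]; simp
  simp only [Fin.sum_univ_five, ac]
  simp only [Fin.isValue, Matrix.cons_val, Fin.coe_ofNat_eq_mod]
  norm_num only
  simp only [h0]
  by_cases h1 : n.Coprime χ.conductor
  · simp only [pv_pow χ n h1, ← mul_pow]
    have := trig_nonneg (pv χ n * z) (by rw [norm_mul, hz, pv_norm_eq χ n h1, one_mul])
    simp only [pow_one] at *
    linarith
  · have h1' : ¬ n.Coprime (χ ^ 1).conductor := by rwa [pow_one]
    rw [hz0 1 h1']
    by_cases h3 : n.Coprime (χ ^ 3).conductor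
    · have h2 : ¬ n.Coprime (χ ^ 2).conductor := by
        intro h2
        apply h1
        have := coprime_cond_mul h3 (coprime_cond_inv h2)
        have e : χ ^ 3 * (χ ^ 2)⁻¹ = χ := by group
        rwa [e] at this
      have h4 : ¬ n.Coprime (χ ^ 4).conductor := by
        intro h4
        apply h1
        have := coprime_cond_mul h4 (coprime_cond_inv h3)
        have e : χ ^ 4 * (χ ^ 3)⁻¹ = χ := by group
        rwa [e] at this
      rw [hz0 2 h2, hz0 4 h4]
      linarith [hb 3]
    · rw [hz0 3 h3]
      linarith [hb 2, hb 4]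

/-- Value of the weighted sum. -/
noncomputable def Sval (χ : DirichletCharacter ℂ q) (σ τ : ℝ) : ℝ :=
  ∑' n, Sterm χ.primitiveCharacter ⟨σ, τ⟩ n

lemma wn_nonneg {n : ℕ} (hn : 1 ≤ n) : 0 ≤ wn n := by
  have hn1 : (1:ℝ) ≤ n := by exact_mod_cast hn
  have hn0 : (0:ℝ) ≤ n := by linarith
  set t := (n:ℝ) ^ (-(1/2) : ℝ) with ht
  have ht0 : 0 ≤ t := Real.rpow_nonneg hn0 _
  have ht1 : t ≤ 1 := Real.rpow_le_one_of_one_le_of_nonpos hn1 (by norm_num)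
  have e2 : (n:ℝ) ^ (-1 : ℝ) = t ^ 2 := by
    rw [ht, ← Real.rpow_natCast, ← Real.rpow_mul hn0]; norm_num
  have e3 : (n:ℝ) ^ (-(3/2) : ℝ) = t ^ 3 := by
    rw [ht, ← Real.rpow_natCast, ← Real.rpow_mul hn0]; norm_num
  unfold wn
  rw [e2, e3]
  nlinarith [mul_nonneg ht0 (sub_nonneg.mpr ht1), pow_nonneg ht0 2, pow_nonneg ht0 3,
    mul_nonneg (pow_nonneg ht0 2) (sub_nonneg.mpr ht1)]

/-- unit complex `n^{-iτ}` -/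
noncomputable def nit (n : ℕ) (τ : ℝ) : ℂ := (n : ℂ) ^ (-((τ : ℂ) * I))

lemma nit_norm {n : ℕ} (hn : 1 ≤ n) (τ : ℝ) : ‖nit n τ‖ = 1 := by
  rw [nit, Complex.norm_natCast_cpow_of_pos hn]; simp

lemma nit_add {n : ℕ} (hn : 1 ≤ n) (a b : ℝ) : nit n (a + b) = nit n a * nit n b := by
  have : (n : ℂ) ≠ 0 := by exact_mod_cast (by omega : n ≠ 0)
  rw [nit, nit, nit, ← Complex.cpow_add _ _ this]; congr 1; push_cast; ring

lemma nit_nat_mul (n : ℕ) (k : ℕ) (a : ℝ) : nit n (k * a) = nit n a ^ k := by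
  rw [nit, nit, ← Complex.cpow_nat_mul]; congr 1; push_cast; ring

lemma nit_neg (n : ℕ) (a : ℝ) : nit n (-a) = conj (nit n a) := by
  rw [nit, nit, ← natCast_cpow_conj]; congr 1; simp

lemma Sterm_eq (χ : DirichletCharacter ℂ q) (σ τ : ℝ) (n : ℕ) (hn : 1 ≤ n) :
    Sterm χ.primitiveCharacter ⟨σ, τ⟩ n
      = vonMangoldt n * wn n * (n : ℝ) ^ (-σ) * (pv χ n * nit n τ).re := by
  have h0 : (n : ℂ) ≠ 0 := by exact_mod_cast (by omega : n ≠ 0)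
  have e : (n : ℂ) ^ (-(⟨σ, τ⟩ : ℂ)) = ((n : ℝ) ^ (-σ) : ℝ) * nit n τ := by
    have : (-(⟨σ, τ⟩ : ℂ)) = ((-σ : ℝ) : ℂ) + (-((τ : ℂ) * I)) := by
      apply Complex.ext <;> simp
    rw [this, Complex.cpow_add _ _ h0, nit, Complex.ofReal_cpow (Nat.cast_nonneg n)]
    simp
  rw [Sterm, e]
  have : χ.primitiveCharacter (n : ZMod _) * (((n : ℝ) ^ (-σ) : ℝ) * nit n τ)
      = (((n : ℝ) ^ (-σ) : ℝ) : ℂ) * (pv χ n * nit n τ) := by rw [pv]; ring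
  rw [this, Complex.re_ofReal_mul]
  ring

lemma Sterm_zero (χ : DirichletCharacter ℂ q) (σ τ : ℝ) :
    Sterm χ.primitiveCharacter ⟨σ, τ⟩ 0 = 0 := by simp [Sterm]

lemma Sval_summable (χ : DirichletCharacter ℂ q) {σ : ℝ} (hσ : 1 < σ) (τ : ℝ) :
    Summable (Sterm χ.primitiveCharacter ⟨σ, τ⟩) :=
  (Sterm_hasSum χ.primitiveCharacter (s := ⟨σ, τ⟩) hσ).summable

/-- General positivity. -/
lemma Sval_pos_general {ι : Type*} (A : Finset ι) (c : ι → ℝ) (X : ι → DirichletCharacter ℂ q)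
    (T : ι → ℝ) {σ : ℝ} (hσ : 1 < σ)
    (h : ∀ n : ℕ, 1 ≤ n → 0 ≤ ∑ i ∈ A, c i * (pv (X i) n * nit n (T i)).re) :
    0 ≤ ∑ i ∈ A, c i * Sval (X i) σ (T i) := by
  have hs : HasSum (fun n => ∑ i ∈ A, c i * Sterm (X i).primitiveCharacter ⟨σ, T i⟩ n)
      (∑ i ∈ A, c i * Sval (X i) σ (T i)) :=
    hasSum_sum fun i _ => (Sval_summable (X i) hσ (T i)).hasSum.mul_left (c i)
  rw [← hs.tsum_eq]
  refine tsum_nonneg fun n => ?_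
  rcases Nat.eq_zero_or_pos n with rfl | hn
  · simp [Sterm_zero]
  · have e : ∑ i ∈ A, c i * Sterm (X i).primitiveCharacter ⟨σ, T i⟩ n
        = vonMangoldt n * wn n * (n : ℝ) ^ (-σ) * ∑ i ∈ A, c i * (pv (X i) n * nit n (T i)).re := by
      rw [Finset.mul_sum]
      refine Finset.sum_congr rfl fun i _ => ?_
      rw [Sterm_eq _ _ _ _ hn]; ring
    rw [e]
    have := wn_nonneg hn
    have h1 : (0:ℝ) ≤ (n : ℝ) ^ (-σ) := Real.rpow_nonneg (Nat.cast_nonneg n) _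
    exact mul_nonneg (mul_nonneg (mul_nonneg ArithmeticFunction.vonMangoldt_nonneg this) h1) (h n hn)

end

open Complex Filter Topology Metric ComplexConjugate

section
variable {q : ℕ} [NeZero q]

/-- Zero of the completed function of the inducing character. -/
def IsZ (χ : DirichletCharacter ℂ q) (ρ : ℂ) : Prop := xiG χ.primitiveCharacter ρ = 0

/-- Euler factor. -/
noncomputable def eul (χ : DirichletCharacter ℂ q) (s : ℂ) : ℂ :=
  ∏ p ∈ q.primeFactors, (1 - χ.primitiveCharacter p * (p : ℂ) ^ (-s))

lemma LF_eq (χ : DirichletCharacter ℂ q) {s : ℂ} (hs : s ≠ 1) :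
    DirichletCharacter.LFunction χ s
      = DirichletCharacter.LFunction χ.primitiveCharacter s * eul χ s := by
  conv_lhs => rw [← χ.changeLevel_primitiveCharacter]
  rw [DirichletCharacter.LFunction_changeLevel _ _ (Or.inr hs)]
  rfl

lemma eul_ne_zero (χ : DirichletCharacter ℂ q) {s : ℂ} (hs : 0 < s.re) : eul χ s ≠ 0 := by
  unfold eul
  rw [Finset.prod_ne_zero_iff]
  intro p hp
  have hp' := Nat.prime_of_mem_primeFactors hp
  intro h
  have h1 : χ.primitiveCharacter p * (p : ℂ) ^ (-s) = 1 := by linear_combination -h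
  have h2 := congrArg norm h1
  rw [norm_mul, norm_one, Complex.norm_natCast_cpow_of_pos hp'.pos] at h2
  have h3 : ‖χ.primitiveCharacter p‖ ≤ 1 := DirichletCharacter.norm_le_one _ _
  have h4 : (p : ℝ) ^ (-s).re < 1 := by
    apply Real.rpow_lt_one_of_one_lt_of_neg
    · exact_mod_cast hp'.one_lt
    · simpa using hs
  have h5 : (0:ℝ) ≤ (p : ℝ) ^ (-s).re := Real.rpow_nonneg (Nat.cast_nonneg _) _
  nlinarith [norm_nonneg (χ.primitiveCharacter p)]

lemma ne_one_of_re {s : ℂ} (h : s.re < 1) : s ≠ 1 := by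
  rintro rfl; simp at h

lemma isZ_iff (χ : DirichletCharacter ℂ q) {ρ : ℂ} (h0 : 0 < ρ.re) (h1 : ρ.re < 1) :
    IsZ χ ρ ↔ DirichletCharacter.LFunction χ ρ = 0 := by
  unfold IsZ
  rw [xiG_eq_zero χ.primitiveCharacter_isPrimitive h0 (ne_one_of_re h1), LF_eq χ (ne_one_of_re h1)]
  simp [eul_ne_zero χ h0]

lemma prim_eq_one_iff (χ : DirichletCharacter ℂ q) : χ.primitiveCharacter = 1 ↔ χ = 1 := by
  constructor
  · intro h
    rw [← χ.changeLevel_primitiveCharacter, h]; simp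
  · rintro rfl
    exact DirichletCharacter.primitiveCharacter_one

lemma isZ_conj (χ : DirichletCharacter ℂ q) {ρ : ℂ} (h0 : 0 < ρ.re) (h1 : ρ.re < 1)
    (h : IsZ χ ρ) : IsZ χ⁻¹ (conj ρ) := by
  by_cases hχ : χ = 1
  · subst hχ
    rw [inv_one]
    unfold IsZ at h ⊢
    rw [(prim_eq_one_iff (1 : DirichletCharacter ℂ q)).mpr rfl] at h ⊢
    have := xiG_conj (1 : DirichletCharacter ℂ (DirichletCharacter.conductor (1 : DirichletCharacter ℂ q))) ρ
    rw [inv_one, h, map_zero] at this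
    exact this
  · rw [isZ_iff _ h0 h1] at h
    rw [isZ_iff _ (by simpa using h0) (by simpa using h1)]
    have := entire_conj_ext (DirichletCharacter.differentiable_LFunction hχ)
      (DirichletCharacter.differentiable_LFunction (DirichletCharacter.inv_ne_one hχ))
      (fun z hz => DirichletCharacter.LFunction_inv_conj χ hz) ρ
    rw [this, h, map_zero]

open Classical in
/-- main term of the upper bound -/
noncomputable def pc (χ : DirichletCharacter ℂ q) (l τ : ℝ) : ℝ :=
  if χ = 1 then gk l τ else 32 / 125 * Real.log q

lemma pc_le (χ : DirichletCharacter ℂ q) (l τ : ℝ) :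
    pole χ.primitiveCharacter * gk l τ + 32 / 125 * Real.log χ.conductor ≤ pc χ l τ := by
  unfold pole pc
  by_cases h : χ = 1
  · rw [if_pos ((prim_eq_one_iff χ).mpr h), if_pos h,
      (DirichletCharacter.eq_one_iff_conductor_eq_one).mp h]
    simp
  · rw [if_neg (fun h' => h ((prim_eq_one_iff χ).mp h')), if_neg h]
    have h1 : Real.log χ.conductor ≤ Real.log q := by
      apply Real.log_le_log
      · exact_mod_cast Nat.pos_of_ne_zero (NeZero.ne _)
      · exact_mod_cast Nat.le_of_dvd (Nat.pos_of_ne_zero (NeZero.ne q)) χ.conductor_dvd_level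
    linarith

open Classical in
lemma Sval_le_mult (χ : DirichletCharacter ℂ q) {l τ : ℝ} (hl0 : 0 < l)
    (hl : l ≤ 1 ∨ (χ = 1 ∧ l ≤ 2)) (W : Finset ℂ) (hW : ∀ ρ ∈ W, IsZ χ ρ)
    (hWre : ∀ ρ ∈ W, 1 / 2 < ρ.re) :
    Sval χ (1 + l) τ ≤ pc χ l τ + Eg τ
      - ∑ ρ ∈ W, ((if deriv (xiG χ.primitiveCharacter) ρ = 0 then 2 else 1 : ℕ) : ℝ)
        * (gk (l + (1 - ρ.re)) (τ - ρ.im) - 8 / 25 * (1 - ρ.re)) := by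
  have := S_le χ.primitiveCharacter_isPrimitive (τ := τ) hl0
    (hl.imp_right fun h => ⟨(prim_eq_one_iff χ).mpr h.1, h.2⟩) W hW hWre
  have h2 := pc_le χ l τ
  unfold Sval
  linarith

open Classical in
lemma Sval_le (χ : DirichletCharacter ℂ q) {l τ : ℝ} (hl0 : 0 < l)
    (hl : l ≤ 1 ∨ (χ = 1 ∧ l ≤ 2)) (W : Finset ℂ) (hW : ∀ ρ ∈ W, IsZ χ ρ)
    (hWre : ∀ ρ ∈ W, 1 / 2 < ρ.re) :
    Sval χ (1 + l) τ ≤ pc χ l τ + Eg τ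
      - ∑ ρ ∈ W, (gk (l + (1 - ρ.re)) (τ - ρ.im) - 8 / 25 * (1 - ρ.re)) := by
  set F : ℂ → ℝ := fun ρ => gk (l + (1 - ρ.re)) (τ - ρ.im) - 8 / 25 * (1 - ρ.re) with hF
  have h := Sval_le_mult χ (τ := τ) hl0 hl (W.filter fun ρ => 0 ≤ F ρ)
    (fun ρ hρ => hW ρ (Finset.mem_of_mem_filter ρ hρ))
    (fun ρ hρ => hWre ρ (Finset.mem_of_mem_filter ρ hρ))
  have h2 : ∑ ρ ∈ W, F ρ ≤ ∑ ρ ∈ W.filter fun ρ => 0 ≤ F ρ,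
      ((if deriv (xiG χ.primitiveCharacter) ρ = 0 then 2 else 1 : ℕ) : ℝ) * F ρ := by
    rw [Finset.sum_filter]
    refine Finset.sum_le_sum fun ρ _ => ?_
    split_ifs with h1 h2 <;> push_cast <;> linarith
  change _ ≤ pc χ l τ + Eg τ - ∑ ρ ∈ W, F ρ
  linarith

lemma Sval_le_empty (χ : DirichletCharacter ℂ q) {l τ : ℝ} (hl0 : 0 < l) (hl : l ≤ 1) :
    Sval χ (1 + l) τ ≤ pc χ l τ + Eg τ := by
  have := Sval_le χ (τ := τ) hl0 (Or.inl hl) ∅ (by simp) (by simp)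
  simpa using this

lemma Sval_le_one (χ : DirichletCharacter ℂ q) {l τ : ℝ} (hl0 : 0 < l)
    (hl : l ≤ 1 ∨ (χ = 1 ∧ l ≤ 2)) {ρ : ℂ} (hz : IsZ χ ρ) (hr : 1 / 2 < ρ.re) :
    Sval χ (1 + l) τ ≤ pc χ l τ + Eg τ
      - (gk (l + (1 - ρ.re)) (τ - ρ.im) - 8 / 25 * (1 - ρ.re)) := by
  have := Sval_le χ (τ := τ) hl0 hl {ρ} (by simpa using hz) (by simpa using hr)
  simpa using this

lemma Sval_le_two (χ : DirichletCharacter ℂ q) {l τ : ℝ} (hl0 : 0 < l)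
    (hl : l ≤ 1 ∨ (χ = 1 ∧ l ≤ 2)) {ρ ρ' : ℂ} (hz : IsZ χ ρ) (hr : 1 / 2 < ρ.re)
    (hz' : IsZ χ ρ') (hr' : 1 / 2 < ρ'.re) (hne : ρ ≠ ρ') :
    Sval χ (1 + l) τ ≤ pc χ l τ + Eg τ
      - (gk (l + (1 - ρ.re)) (τ - ρ.im) - 8 / 25 * (1 - ρ.re))
      - (gk (l + (1 - ρ'.re)) (τ - ρ'.im) - 8 / 25 * (1 - ρ'.re)) := by
  classical
  have := Sval_le χ (τ := τ) hl0 hl {ρ, ρ'} (by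
    intro x hx; simp at hx; rcases hx with rfl | rfl <;> assumption) (by
    intro x hx; simp only [Finset.mem_insert, Finset.mem_singleton] at hx
    rcases hx with rfl | rfl <;> assumption)
  rw [Finset.sum_pair hne] at this
  linarith

lemma Sval_le_dbl (χ : DirichletCharacter ℂ q) {l τ : ℝ} (hl0 : 0 < l)
    (hl : l ≤ 1 ∨ (χ = 1 ∧ l ≤ 2)) {ρ : ℂ} (hz : IsZ χ ρ) (hr : 1 / 2 < ρ.re)
    (hd : deriv (xiG χ.primitiveCharacter) ρ = 0) :
    Sval χ (1 + l) τ ≤ pc χ l τ + Eg τ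
      - 2 * (gk (l + (1 - ρ.re)) (τ - ρ.im) - 8 / 25 * (1 - ρ.re)) := by
  have := Sval_le_mult χ (τ := τ) hl0 hl {ρ} (by simpa using hz) (by simpa using hr)
  rw [Finset.sum_singleton, if_pos hd] at this
  push_cast at this
  linarith

end

open Complex Filter Topology Metric ComplexConjugate

/-- bump weights -/
noncomputable def al (j : Fin 21) : ℝ := 121 - ((j : ℝ) - 10) ^ 2

lemma al_nonneg (j : Fin 21) : 0 ≤ al j := by
  have h : ((j : ℕ) : ℝ) ≤ 20 := by exact_mod_cast Nat.lt_succ_iff.mp j.2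
  have h0 : (0:ℝ) ≤ ((j : ℕ) : ℝ) := Nat.cast_nonneg _
  unfold al; nlinarith

lemma bump_pos {q : ℕ} [NeZero q] (χ : DirichletCharacter ℂ q) (γ ω : ℝ) {σ : ℝ} (hσ : 1 < σ) :
    0 ≤ ∑ p : Fin 21 × Fin 21, al p.1 * al p.2 *
      ∑ k : Fin 5, ac k * Sval (χ ^ (k : ℕ)) σ ((k : ℕ) * γ + ((p.1 : ℝ) - p.2) * ω) := by
  have h := Sval_pos_general (q := q) (Finset.univ : Finset ((Fin 21 × Fin 21) × Fin 5))
    (fun i => al i.1.1 * al i.1.2 * ac i.2) (fun i => χ ^ (i.2 : ℕ))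
    (fun i => (i.2 : ℕ) * γ + ((i.1.1 : ℝ) - i.1.2) * ω) hσ ?_
  · rw [Fintype.sum_prod_type] at h
    refine h.trans (le_of_eq ?_)
    refine Finset.sum_congr rfl fun p _ => ?_
    rw [Finset.mul_sum]
    exact Finset.sum_congr rfl fun k _ => by ring
  · intro n hn
    have hQ := Q_nonneg χ n (nit n γ) (nit_norm hn γ)
    set D : ℂ := ∑ i : Fin 21, (al i : ℂ) * nit n ((i : ℝ) * ω) with hD
    have e : ∑ i : (Fin 21 × Fin 21) × Fin 5, al i.1.1 * al i.1.2 * ac i.2 *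
        (pv (χ ^ (i.2 : ℕ)) n * nit n ((i.2 : ℕ) * γ + ((i.1.1 : ℝ) - i.1.2) * ω)).re
        = Complex.normSq D * ∑ k : Fin 5, ac k * (pv (χ ^ (k:ℕ)) n * nit n γ ^ (k:ℕ)).re := by
      have e1 : D * conj D = ∑ p : Fin 21 × Fin 21,
          ((al p.1 * al p.2 : ℝ) : ℂ) * nit n (((p.1 : ℝ) - p.2) * ω) := by
        rw [hD, map_sum, Finset.sum_mul_sum, Fintype.sum_prod_type]
        refine Finset.sum_congr rfl fun i _ => Finset.sum_congr rfl fun j _ => ?_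
        rw [map_mul, Complex.conj_ofReal, ← nit_neg]
        have : ((i : ℝ) - j) * ω = (i : ℝ) * ω + -((j : ℝ) * ω) := by ring
        simp only [this, nit_add hn]
        push_cast; ring
      have e2 : ((Complex.normSq D : ℝ) : ℂ) * ∑ k : Fin 5, (ac k : ℂ) *
            (pv (χ ^ (k:ℕ)) n * nit n γ ^ (k:ℕ))
          = ∑ i : (Fin 21 × Fin 21) × Fin 5, ((al i.1.1 * al i.1.2 * ac i.2 : ℝ) : ℂ) *
        (pv (χ ^ (i.2 : ℕ)) n * nit n ((i.2 : ℕ) * γ + ((i.1.1 : ℝ) - i.1.2) * ω)) := by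
        rw [← Complex.mul_conj, e1, Finset.sum_mul_sum]
        refine Eq.trans ?_ (Fintype.sum_prod_type _).symm
        refine Finset.sum_congr rfl fun p _ => Finset.sum_congr rfl fun k _ => ?_
        rw [nit_add hn, nit_nat_mul]
        push_cast; ring
      have e3 := congrArg Complex.re e2
      rw [Complex.re_ofReal_mul, Complex.re_sum, Complex.re_sum] at e3
      simp only [Complex.re_ofReal_mul] at e3
      exact e3.symm
    rw [e]
    exact mul_nonneg (Complex.normSq_nonneg _) hQ

/-- rational kernel -/
def vq (d : ℤ) : ℚ :=
  30 * (31 / 20) / ((31 / 20) ^ 2 + (d * (19 / 50)) ^ 2)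
    - 18 * (11 / 20) / ((11 / 20) ^ 2 + (d * (19 / 50)) ^ 2)

def alz (j : ℕ) : ℤ := 121 - ((j : ℤ) - 10) ^ 2

lemma numeric_V : (54 * (32 / 125) : ℚ) *
      (∑ i ∈ Finset.range 21, ∑ j ∈ Finset.range 21, ((alz i * alz j : ℤ) : ℚ))
    < (63970 / 10000) * ∑ i ∈ Finset.range 21, ∑ j ∈ Finset.range 21,
      ((alz i * alz j : ℤ) : ℚ) * vq ((i : ℤ) - j) := by
  decide +kernel

lemma numeric_V' : (54 * (32 / 125) : ℝ) * (∑ p : Fin 21 × Fin 21, al p.1 * al p.2)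
    < (63970 / 10000) * ∑ p : Fin 21 × Fin 21, al p.1 * al p.2 *
      (30 * (31 / 20) / ((31 / 20) ^ 2 + (((p.1 : ℝ) - p.2) * (19 / 50)) ^ 2)
        - 18 * (11 / 20) / ((11 / 20) ^ 2 + (((p.1 : ℝ) - p.2) * (19 / 50)) ^ 2)) := by
  have h := (Rat.cast_lt (K := ℝ)).mpr numeric_V
  rw [Fintype.sum_prod_type, Fintype.sum_prod_type]
  simp only [Finset.sum_range, vq, alz] at h
  push_cast at h
  simpa only [al] using h

lemma numeric_scaled {η L : ℝ} (hη : 0 < η) (hL : 0 < L) (h : 6.397 * L * η ≤ 1) :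
    ∑ p : Fin 21 × Fin 21, al p.1 * al p.2 *
      (18 * gk (11 / 20 * η) (((p.1 : ℝ) - p.2) * (19 / 50 * η))
        - 30 * gk (11 / 20 * η + η) (((p.1 : ℝ) - p.2) * (19 / 50 * η))
        + 54 * (32 / 125) * L) < 0 := by
  have hV := numeric_V'
  set B := ∑ p : Fin 21 × Fin 21, al p.1 * al p.2 with hB
  set V := ∑ p : Fin 21 × Fin 21, al p.1 * al p.2 *
      (30 * (31 / 20) / ((31 / 20) ^ 2 + (((p.1 : ℝ) - p.2) * (19 / 50)) ^ 2)
        - 18 * (11 / 20) / ((11 / 20) ^ 2 + (((p.1 : ℝ) - p.2) * (19 / 50)) ^ 2)) with hVd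
  have e : ∑ p : Fin 21 × Fin 21, al p.1 * al p.2 *
      (18 * gk (11 / 20 * η) (((p.1 : ℝ) - p.2) * (19 / 50 * η))
        - 30 * gk (11 / 20 * η + η) (((p.1 : ℝ) - p.2) * (19 / 50 * η))
        + 54 * (32 / 125) * L) = - (V / η) + 54 * (32 / 125) * L * B := by
    rw [hVd, hB, Finset.sum_div, ← Finset.sum_neg_distrib, Finset.mul_sum, ← Finset.sum_add_distrib]
    refine Finset.sum_congr rfl fun p _ => ?_
    have hk : ∀ a u : ℝ, 0 < a → gk (a * η) (u * η) = a / (a ^ 2 + u ^ 2) / η := by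
      intro a u ha
      unfold gk
      have : a ^ 2 + u ^ 2 ≠ 0 := by positivity
      have : (a * η) ^ 2 + (u * η) ^ 2 ≠ 0 := by positivity
      field_simp
    have h1 := hk (11 / 20) (((p.1 : ℝ) - p.2) * (19 / 50)) (by norm_num)
    have h2 := hk (31 / 20) (((p.1 : ℝ) - p.2) * (19 / 50)) (by norm_num)
    have e1 : ((p.1 : ℝ) - p.2) * (19 / 50 * η) = ((p.1 : ℝ) - p.2) * (19 / 50) * η := by ring
    have e2 : 11 / 20 * η + η = 31 / 20 * η := by ring
    rw [e1, e2, h1, h2]; ring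
  rw [e]
  have hB0 : 0 ≤ B := Finset.sum_nonneg fun p _ => mul_nonneg (al_nonneg _) (al_nonneg _)
  have hV0 : 0 < V := by
    have : (0:ℝ) ≤ 54 * (32 / 125) * B := by positivity
    linarith
  have h1 : 6.397 * L ≤ 1 / η := by rw [le_div_iff₀ hη]; exact h
  have h2 : V / η = V * (1 / η) := by ring
  have h3 : V * (6.397 * L) ≤ V * (1 / η) := mul_le_mul_of_nonneg_left h1 hV0.le
  have h4 := mul_lt_mul_of_pos_right hV hL
  rw [h2]
  norm_num at h4 h3 ⊢
  linarith

open Complex Filter Topology Metric ComplexConjugate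

lemma log_three_lower : (1.0985 : ℝ) ≤ Real.log 3 :=
  le_trans (by norm_num) Real.log_three_gt_d9.le

lemma Eg_small {u η : ℝ} (hη : η ≤ 0.1424) (hu : |u| ≤ 7.6 * η) : Eg u ≤ -(0.0887) := by
  have h1 : |u| ≤ 1.0823 := by linarith
  have h2 : u ^ 2 ≤ 1.0823 ^ 2 := by
    rw [← sq_abs]; exact pow_le_pow_left₀ (abs_nonneg u) h1 2
  have h3 : Real.log ((u ^ 2 + 13) / 39) ≤ Real.log (1 / 2) := by
    apply Real.log_le_log (by positivity)
    rw [div_le_div_iff₀ (by norm_num) (by norm_num)]; norm_num at h2 ⊢; linarith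
  rw [one_div, Real.log_inv] at h3
  have := Real.log_two_gt_d9
  unfold Eg; norm_num at *; linarith

lemma Eg_le {u η γ : ℝ} (hη : η ≤ 0.1424) (hγ : 0 ≤ γ) (hu : |u| ≤ 4 * γ + 7.6 * η) :
    Eg u ≤ 32 / 125 * Real.log (max 1 γ) := by
  set M := max 1 γ with hM
  have hM1 : 1 ≤ M := le_max_left _ _
  have hMγ : γ ≤ M := le_max_right _ _
  have h1 : |u| ≤ 5.0823 * M := by linarith
  have h2 : u ^ 2 ≤ (5.0823 * M) ^ 2 := by
    rw [← sq_abs]; exact pow_le_pow_left₀ (abs_nonneg u) h1 2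
  have h3 : Real.log ((u ^ 2 + 13) / 39) ≤ Real.log (M ^ 2) := by
    apply Real.log_le_log (by positivity)
    rw [div_le_iff₀ (by norm_num)]
    nlinarith
  rw [Real.log_pow] at h3
  unfold Eg; push_cast at h3; linarith

section
variable {q : ℕ} [NeZero q]

open Classical in
/-- cancellation term -/
noncomputable def Kf (χ : DirichletCharacter ℂ q) (k : ℕ) (l η u : ℝ) : ℝ :=
  if χ ^ k = 1 then gk (l + η) u - 8 / 25 * η else 0

lemma brk (χ : DirichletCharacter ℂ q) (k : ℕ) {a b l η u : ℝ} (ha : 0 ≤ a)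
    (h1 : χ ^ k = 1 → a * gk l u ≤ b * gk (l + η) u)
    (h2 : b * (8 / 25 * η) ≤ a * (32 / 125 * Real.log q)) :
    a * pc (χ ^ k) l u - b * Kf χ k l η u ≤ a * (32 / 125 * Real.log q) := by
  unfold pc Kf
  split_ifs with h
  · have := h1 h
    linarith
  · linarith

lemma gk_cmp {a b l m u : ℝ} (hl : 0 < l) (hm : 0 < m)
    (h : a * l * (m ^ 2 + u ^ 2) ≤ b * m * (l ^ 2 + u ^ 2)) : a * gk l u ≤ b * gk m u := by
  unfold gk
  rw [← mul_div_assoc, ← mul_div_assoc, div_le_div_iff₀ (by positivity) (by positivity)]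
  exact h

lemma pow_pred_zero (χ : DirichletCharacter ℂ q) {ρ : ℂ} (h0 : 0 < ρ.re) (h1 : ρ.re < 1)
    (hz : IsZ χ ρ) (k : ℕ) (hk : χ ^ (k + 1) = 1) : IsZ (χ ^ k) (conj ρ) := by
  have : χ ^ k = χ⁻¹ := by rw [eq_inv_iff_mul_eq_one, ← pow_succ, hk]
  rw [this]; exact isZ_conj χ h0 h1 hz

lemma Sk_le (χ : DirichletCharacter ℂ q) {ρ : ℂ} (h0 : 1 / 2 < ρ.re) (h1 : ρ.re < 1)
    (hz : IsZ χ ρ) (k : ℕ) {l x : ℝ} (hl0 : 0 < l) (hl : l ≤ 1) :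
    Sval (χ ^ k) (1 + l) (k * ρ.im + x) ≤ pc (χ ^ k) l (k * ρ.im + x) + Eg (k * ρ.im + x)
      - Kf χ (k + 1) l (1 - ρ.re) ((k + 1 : ℕ) * ρ.im + x) := by
  unfold Kf
  split_ifs with hk
  · have := Sval_le_one (χ ^ k) (τ := k * ρ.im + x) hl0 (Or.inl hl)
      (pow_pred_zero χ (by linarith) h1 hz k hk) (by simpa using h0)
    simp only [Complex.conj_re, Complex.conj_im] at this
    have e : (k : ℝ) * ρ.im + x - -ρ.im = (k + 1 : ℕ) * ρ.im + x := by push_cast; ring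
    rw [e] at this
    exact this
  · have := Sval_le_empty (χ ^ k) (τ := k * ρ.im + x) hl0 hl
    linarith

lemma S1_le (χ : DirichletCharacter ℂ q) {ρ : ℂ} (h0 : 1 / 2 < ρ.re) (h1 : ρ.re < 1)
    (hz : IsZ χ ρ) {l x : ℝ} (hl0 : 0 < l) (hl : l ≤ 1) (hg : χ ^ 2 = 1 → ρ.im ≠ 0) :
    Sval (χ ^ 1) (1 + l) ((1 : ℕ) * ρ.im + x) ≤ pc (χ ^ 1) l ((1 : ℕ) * ρ.im + x)
      + Eg ((1 : ℕ) * ρ.im + x)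
      - Kf χ 2 l (1 - ρ.re) ((2 : ℕ) * ρ.im + x)
      - (gk (l + (1 - ρ.re)) x - 8 / 25 * (1 - ρ.re)) := by
  have hz1 : IsZ (χ ^ 1) ρ := by rwa [pow_one]
  have e1 : ((1:ℕ):ℝ) * ρ.im + x - ρ.im = x := by push_cast; ring
  unfold Kf
  split_ifs with hk
  · have hne : ρ ≠ conj ρ := by
      intro h
      have := congrArg Complex.im h
      rw [Complex.conj_im] at this
      exact hg hk (by linarith)
    have := Sval_le_two (χ ^ 1) (τ := (1:ℕ) * ρ.im + x) hl0 (Or.inl hl) hz1 h0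
      (pow_pred_zero χ (by linarith) h1 hz 1 hk) (by simpa using h0) hne
    simp only [Complex.conj_re, Complex.conj_im, e1] at this
    have e : ((1:ℕ) : ℝ) * ρ.im + x - -ρ.im = (2 : ℕ) * ρ.im + x := by push_cast; ring
    rw [e] at this
    linarith
  · have := Sval_le_one (χ ^ 1) (τ := (1:ℕ) * ρ.im + x) hl0 (Or.inl hl) hz1 h0
    rw [e1] at this
    linarith

lemma pt_bound (hq : 3 ≤ q) (χ : DirichletCharacter ℂ q) {ρ : ℂ} (h1 : ρ.re < 1)
    (hz : IsZ χ ρ) (hη : 1 - ρ.re ≤ 0.1424) (hγ : 0 ≤ ρ.im)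
    (hd2 : χ ^ 2 = 1 → 4.1 * (1 - ρ.re) ≤ ρ.im) (hd1 : χ = 1 → 9.3 * (1 - ρ.re) ≤ ρ.im)
    {x : ℝ} (hx : |x| ≤ 7.6 * (1 - ρ.re)) :
    ∑ k : Fin 5, ac k * Sval (χ ^ (k : ℕ)) (1 + 11 / 20 * (1 - ρ.re)) ((k : ℕ) * ρ.im + x)
      ≤ 18 * gk (11 / 20 * (1 - ρ.re)) x - 30 * gk (11 / 20 * (1 - ρ.re) + (1 - ρ.re)) x
        + 54 * (32 / 125) * (Real.log q + Real.log (max 1 ρ.im)) := by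
  set η := 1 - ρ.re with hηd
  set γ := ρ.im with hγd
  have hη0 : 0 < η := by rw [hηd]; linarith
  have h0 : 1 / 2 < ρ.re := by norm_num at hη; linarith
  have hLq : 1.0985 ≤ Real.log q := log_three_lower.trans
    (Real.log_le_log (by norm_num) (by exact_mod_cast hq))
  have hl0 : 0 < 11 / 20 * η := by positivity
  have hm0 : 0 < 11 / 20 * η + η := by positivity
  have hl1 : 11 / 20 * η ≤ 1 := by norm_num at hη; linarith
  have ha := abs_le.mp hx
  have hE : ∀ k : ℕ, k ≤ 4 → Eg (k * γ + x) ≤ 32 / 125 * Real.log (max 1 γ) := by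
    intro k hk
    refine Eg_le hη hγ ((abs_add_le _ _).trans ?_)
    have : (k:ℝ) ≤ 4 := by exact_mod_cast hk
    rw [abs_of_nonneg (by positivity)]
    have := mul_le_mul_of_nonneg_right this hγ
    linarith
  have hE0 : Eg ((0:ℕ) * γ + x) ≤ -(0.0887) := by
    refine Eg_small hη ?_
    simpa using hx
  have s0 := Sk_le χ h0 h1 hz 0 (x := x) hl0 hl1
  have s1 := S1_le χ h0 h1 hz (x := x) hl0 hl1 (fun h => by
    have := hd2 h
    have : 0 < γ := by linarith
    exact this.ne')
  have s2 := Sk_le χ h0 h1 hz 2 (x := x) hl0 hl1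
  have s3 := Sk_le χ h0 h1 hz 3 (x := x) hl0 hl1
  have s4 := Sval_le_empty (χ ^ 4) (τ := (4:ℕ) * ρ.im + x) hl0 hl1
  have b1 := brk χ 1 (a := 30) (b := 18) (l := 11 / 20 * η) (η := η) (u := (1:ℕ) * γ + x)
    (by norm_num) (fun h => gk_cmp hl0 hm0 (by
      rw [pow_one] at h
      have h9 := hd1 h
      have hu : 1.7 * η ≤ (1:ℕ) * γ + x := by push_cast; linarith
      have hs : (1.7 * η) ^ 2 ≤ ((1:ℕ) * γ + x) ^ 2 :=
        pow_le_pow_left₀ (by positivity) hu 2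
      have e : 18 * (11 / 20 * η + η) * ((11 / 20 * η) ^ 2 + ((1:ℕ) * γ + x) ^ 2)
        - 30 * (11 / 20 * η) * ((11 / 20 * η + η) ^ 2 + ((1:ℕ) * γ + x) ^ 2)
        = η * (11.4 * ((1:ℕ) * γ + x) ^ 2 - 31.2015 * η ^ 2) := by ring
      have : 0 ≤ η * (11.4 * ((1:ℕ) * γ + x) ^ 2 - 31.2015 * η ^ 2) :=
        mul_nonneg hη0.le (by nlinarith [sq_nonneg η])
      linarith)) (by norm_num at hη hLq ⊢; linarith)
  have b2 := brk χ 2 (a := 17) (b := 30) (l := 11 / 20 * η) (η := η) (u := (2:ℕ) * γ + x)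
    (by norm_num) (fun h => gk_cmp hl0 hm0 (by
      have h9 := hd2 h
      have hu : 0.6 * η ≤ (2:ℕ) * γ + x := by push_cast; linarith
      have hs : (0.6 * η) ^ 2 ≤ ((2:ℕ) * γ + x) ^ 2 :=
        pow_le_pow_left₀ (by positivity) hu 2
      have e : 30 * (11 / 20 * η + η) * ((11 / 20 * η) ^ 2 + ((2:ℕ) * γ + x) ^ 2)
        - 17 * (11 / 20 * η) * ((11 / 20 * η + η) ^ 2 + ((2:ℕ) * γ + x) ^ 2)
        = η * (37.15 * ((2:ℕ) * γ + x) ^ 2 - 8.397125 * η ^ 2) := by ring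
      have : 0 ≤ η * (37.15 * ((2:ℕ) * γ + x) ^ 2 - 8.397125 * η ^ 2) :=
        mul_nonneg hη0.le (by nlinarith [sq_nonneg η])
      linarith)) (by norm_num at hη hLq ⊢; linarith)
  have b3 := brk χ 3 (a := 6) (b := 17) (l := 11 / 20 * η) (η := η) (u := (3:ℕ) * γ + x)
    (by norm_num) (fun h => gk_cmp hl0 hm0 (by
      have e : 17 * (11 / 20 * η + η) * ((11 / 20 * η) ^ 2 + ((3:ℕ) * γ + x) ^ 2)
        - 6 * (11 / 20 * η) * ((11 / 20 * η + η) ^ 2 + ((3:ℕ) * γ + x) ^ 2)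
        = η * (0.042625 * η ^ 2 + 23.05 * ((3:ℕ) * γ + x) ^ 2) := by ring
      have : 0 ≤ η * (0.042625 * η ^ 2 + 23.05 * ((3:ℕ) * γ + x) ^ 2) := by positivity
      linarith)) (by norm_num at hη hLq ⊢; linarith)
  have b4 := brk χ 4 (a := 1) (b := 6) (l := 11 / 20 * η) (η := η) (u := (4:ℕ) * γ + x)
    (by norm_num) (fun h => gk_cmp hl0 hm0 (by
      have e : 6 * (11 / 20 * η + η) * ((11 / 20 * η) ^ 2 + ((4:ℕ) * γ + x) ^ 2)
        - 1 * (11 / 20 * η) * ((11 / 20 * η + η) ^ 2 + ((4:ℕ) * γ + x) ^ 2)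
        = η * (1.491875 * η ^ 2 + 8.75 * ((4:ℕ) * γ + x) ^ 2) := by ring
      have : 0 ≤ η * (1.491875 * η ^ 2 + 8.75 * ((4:ℕ) * γ + x) ^ 2) := by positivity
      linarith)) (by norm_num at hη hLq ⊢; linarith)
  have p0 : pc (χ ^ 0) (11 / 20 * η) ((0:ℕ) * γ + x) = gk (11 / 20 * η) x := by
    unfold pc; rw [if_pos (pow_zero χ)]; simp
  have e1 := hE 1 (by norm_num)
  have e2 := hE 2 (by norm_num)
  have e3 := hE 3 (by norm_num)
  have e4 := hE 4 (by norm_num)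
  rw [p0] at s0
  simp only [← hγd, ← hηd, zero_add, Nat.reduceAdd] at s0 s1 s2 s3 s4
  simp only [Fin.sum_univ_five, ac]
  simp only [Fin.isValue, Matrix.cons_val, Fin.coe_ofNat_eq_mod]
  simp only [Nat.reduceMod]
  have hkap : 30 * (8 / 25 * η) ≤ 18 * 0.0887 := by norm_num at hη ⊢; linarith
  linarith

theorem main_contra (hq : 3 ≤ q) (χ : DirichletCharacter ℂ q) {ρ : ℂ} (h1 : ρ.re < 1)
    (hz : IsZ χ ρ) (hη : 1 - ρ.re ≤ 0.1424) (hγ : 0 ≤ ρ.im)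
    (hL : 6.397 * (Real.log q + Real.log (max 1 ρ.im)) * (1 - ρ.re) ≤ 1)
    (hd2 : χ ^ 2 = 1 → 4.1 * (1 - ρ.re) ≤ ρ.im) (hd1 : χ = 1 → 9.3 * (1 - ρ.re) ≤ ρ.im) :
    False := by
  have hη0 : 0 < 1 - ρ.re := by linarith
  have hLq : 1.0985 ≤ Real.log q := log_three_lower.trans
    (Real.log_le_log (by norm_num) (by exact_mod_cast hq))
  have hM : 0 ≤ Real.log (max 1 ρ.im) := Real.log_nonneg (le_max_left _ _)
  have hpos := bump_pos χ ρ.im (19 / 50 * (1 - ρ.re)) (σ := 1 + 11 / 20 * (1 - ρ.re)) (by linarith)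
  have hneg := numeric_scaled hη0 (L := Real.log q + Real.log (max 1 ρ.im))
    (by norm_num at hLq; linarith) hL
  refine absurd (hpos.trans (Finset.sum_le_sum fun p _ => mul_le_mul_of_nonneg_left ?_
    (mul_nonneg (al_nonneg p.1) (al_nonneg p.2)))) (not_le.mpr hneg)
  refine pt_bound hq χ h1 hz hη hγ hd2 hd1 ?_
  have a1 : ((p.1 : ℕ) : ℝ) ≤ 20 := by exact_mod_cast Nat.lt_succ_iff.mp p.1.2
  have a2 : ((p.2 : ℕ) : ℝ) ≤ 20 := by exact_mod_cast Nat.lt_succ_iff.mp p.2.2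
  have a3 : (0:ℝ) ≤ ((p.1 : ℕ) : ℝ) := Nat.cast_nonneg _
  have a4 : (0:ℝ) ≤ ((p.2 : ℕ) : ℝ) := Nat.cast_nonneg _
  rw [abs_mul, abs_of_pos (show (0:ℝ) < 19 / 50 * (1 - ρ.re) by positivity)]
  have : |((p.1 : ℕ) : ℝ) - ((p.2 : ℕ) : ℝ)| ≤ 20 := abs_le.mpr ⟨by linarith, by linarith⟩
  nlinarith

end

open Complex Filter Topology Metric ComplexConjugate

lemma gk_zero {p : ℝ} (hp : 0 < p) : gk p 0 = 1 / p := by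
  unfold gk; field_simp; ring

lemma Eg_zero : Eg 0 ≤ -(0.14) := by
  have : Real.log ((0 ^ 2 + 13) / 39) = - Real.log 3 := by
    rw [← Real.log_inv]; norm_num
  unfold Eg
  rw [this]
  have := log_three_lower
  norm_num at *; linarith

section
variable {q : ℕ} [NeZero q]

lemma nit_zero (n : ℕ) : nit n 0 = 1 := by simp [nit]

lemma pv_re_ge (χ : DirichletCharacter ℂ q) (n : ℕ) : -1 ≤ (pv χ n).re := by
  have h1 := pv_norm_le χ n
  have := Complex.abs_re_le_norm (pv χ n)
  have := neg_abs_le (pv χ n).re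
  linarith

lemma pos_zeta {σ : ℝ} (hσ : 1 < σ) : 0 ≤ Sval (1 : DirichletCharacter ℂ q) σ 0 := by
  have := Sval_pos_general (q := q) (Finset.univ : Finset (Fin 1)) (fun _ => 1) (fun _ => 1)
    (fun _ => 0) hσ (by intro n _; simp [pv_one, nit_zero])
  simpa using this

lemma pos_two (χ : DirichletCharacter ℂ q) {σ : ℝ} (hσ : 1 < σ) :
    0 ≤ Sval (1 : DirichletCharacter ℂ q) σ 0 + Sval χ σ 0 := by
  have := Sval_pos_general (q := q) (Finset.univ : Finset (Fin 2)) (fun _ => 1) ![1, χ]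
    (fun _ => 0) hσ (by
      intro n _
      have := pv_re_ge χ n
      simp [pv_one, nit_zero, Fin.sum_univ_two]; linarith)
  simpa [Fin.sum_univ_two] using this

lemma pv_sq_one {χ : DirichletCharacter ℂ q} (h : χ ^ 2 = 1) {n : ℕ}
    (hn : n.Coprime χ.conductor) : pv χ n = 1 ∨ pv χ n = -1 := by
  have := pv_pow χ n hn 2
  rw [h, pv_one] at this
  have h3 : (pv χ n - 1) * (pv χ n + 1) = 0 := by linear_combination -this
  rcases mul_eq_zero.mp h3 with h | h
  · exact Or.inl (by linear_combination h)
  · exact Or.inr (by linear_combination h)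

lemma pos_four {χ ψ : DirichletCharacter ℂ q} (h1 : χ ^ 2 = 1) (h2 : ψ ^ 2 = 1) {σ : ℝ}
    (hσ : 1 < σ) :
    0 ≤ Sval (1 : DirichletCharacter ℂ q) σ 0 + Sval χ σ 0 + Sval ψ σ 0 + Sval (χ * ψ) σ 0 := by
  have h1' : χ * χ = 1 := by rw [← pow_two, h1]
  have h2' : ψ * ψ = 1 := by rw [← pow_two, h2]
  have := Sval_pos_general (q := q) (Finset.univ : Finset (Fin 4)) (fun _ => 1) ![1, χ, ψ, χ * ψ]
    (fun _ => 0) hσ (by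
      intro n _
      have key : 0 ≤ 1 + (pv χ n).re + (pv ψ n).re + (pv (χ * ψ) n).re := by
        by_cases c1 : n.Coprime χ.conductor
        · by_cases c2 : n.Coprime ψ.conductor
          · rw [pv_mul _ _ _ c1 c2]
            rcases pv_sq_one h1 c1 with e | e <;> rcases pv_sq_one h2 c2 with e' | e' <;>
              simp [e, e'] <;> norm_num
          · have c3 : ¬ n.Coprime (χ * ψ).conductor := by
              intro c3
              apply c2
              have := coprime_cond_mul c1 c3
              rwa [← mul_assoc, h1', one_mul] at this
            rw [pv_eq_zero _ _ c2, pv_eq_zero _ _ c3]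
            have := pv_re_ge χ n
            simp; linarith
        · by_cases c2 : n.Coprime ψ.conductor
          · have c3 : ¬ n.Coprime (χ * ψ).conductor := by
              intro c3
              apply c1
              have := coprime_cond_mul c3 c2
              rwa [mul_assoc, h2', mul_one] at this
            rw [pv_eq_zero _ _ c1, pv_eq_zero _ _ c3]
            have := pv_re_ge ψ n
            simp; linarith
          · rw [pv_eq_zero _ _ c1, pv_eq_zero _ _ c2]
            have := pv_re_ge (χ * ψ) n
            simp; linarith
      simpa [pv_one, nit_zero, Fin.sum_univ_four] using key)
  simpa [Fin.sum_univ_four] using this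

lemma pc_one (l τ : ℝ) : pc (1 : DirichletCharacter ℂ q) l τ = gk l τ := by
  unfold pc; rw [if_pos rfl]

lemma pc_ne {χ : DirichletCharacter ℂ q} (h : χ ≠ 1) (l τ : ℝ) :
    pc χ l τ = 32 / 125 * Real.log q := by
  unfold pc; rw [if_neg h]

/-- no zeros of zeta near one -/
lemma zeta_case {ρ : ℂ} (h1 : ρ.re < 1)
    (hz : IsZ (1 : DirichletCharacter ℂ q) ρ) (hη : 1 - ρ.re ≤ 0.1424) (hγ : 0 ≤ ρ.im)
    (hd : ρ.im ≤ 9.3 * (1 - ρ.re)) : False := by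
  have hp := pos_zeta (q := q) (σ := 1 + 2) (by norm_num)
  have hE := Eg_zero
  set η := 1 - ρ.re with hηd
  have hη0 : 0 < η := by linarith
  have h0 : 1 / 2 < ρ.re := by norm_num at hη; linarith
  have e2 : gk 2 0 = 1 / 2 := gk_zero (by norm_num)
  rcases hγ.eq_or_lt with h | h
  · have := Sval_le_one (1 : DirichletCharacter ℂ q) (l := 2) (τ := 0) (by norm_num)
      (Or.inr ⟨rfl, le_rfl⟩) hz h0
    rw [pc_one, ← h, sub_zero, ← hηd, e2, gk_zero (by linarith)] at this
    have h3 : 1 / 2.1424 ≤ 1 / (2 + η) :=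
      one_div_le_one_div_of_le (by linarith) (by norm_num at hη ⊢; linarith)
    norm_num at hη hE h3 this hp
    linarith
  · have hne : ρ ≠ conj ρ := by
      intro h'
      have := congrArg Complex.im h'
      rw [Complex.conj_im] at this
      linarith
    have := Sval_le_two (1 : DirichletCharacter ℂ q) (l := 2) (τ := 0) (by norm_num)
      (Or.inr ⟨rfl, le_rfl⟩) hz h0 (by simpa using isZ_conj _ (by linarith) h1 hz)
      (by simpa using h0) hne
    rw [pc_one, Complex.conj_re, Complex.conj_im, zero_sub, zero_sub, neg_neg, gk_neg,
      ← hηd, e2] at this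
    have h3 : 0.3 ≤ gk (2 + η) ρ.im := by
      unfold gk
      rw [le_div_iff₀ (by positivity)]
      have : ρ.im ^ 2 ≤ (9.3 * η) ^ 2 := pow_le_pow_left₀ h.le hd 2
      nlinarith
    norm_num at hη hE h3 this hp
    linarith

/-- complex zeros of real characters near the real axis -/
lemma real_case (hq : 3 ≤ q) {χ : DirichletCharacter ℂ q} (hχ : χ ≠ 1) (h2 : χ ^ 2 = 1) {ρ : ℂ}
    (h1 : ρ.re < 1) (hz : IsZ χ ρ) (hη : 1 - ρ.re ≤ 0.1424) (hγ : 0 < ρ.im)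
    (hL : 6.397 * Real.log q * (1 - ρ.re) ≤ 1)
    (hd : ρ.im ≤ 4.1 * (1 - ρ.re)) : False := by
  have hE := Eg_zero
  set η := 1 - ρ.re with hηd
  have hη0 : 0 < η := by linarith
  have h0 : 1 / 2 < ρ.re := by norm_num at hη; linarith
  have hp := pos_two (q := q) χ (σ := 1 + 6 * η) (by linarith)
  have hl1 : 6 * η ≤ 1 := by norm_num at hη; linarith
  have hne : ρ ≠ conj ρ := by
    intro h'
    have := congrArg Complex.im h'
    rw [Complex.conj_im] at this
    linarith
  have s1 := Sval_le_empty (1 : DirichletCharacter ℂ q) (l := 6 * η) (τ := 0) (by positivity) hl1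
  have hz' := pow_pred_zero χ (by linarith) h1 hz 1 h2
  rw [pow_one] at hz'
  have s2 := Sval_le_two χ (l := 6 * η) (τ := 0) (by positivity) (Or.inl hl1) hz h0 hz'
    (by simpa using h0) hne
  rw [pc_ne hχ, Complex.conj_re, Complex.conj_im, zero_sub, zero_sub, neg_neg, gk_neg,
      ← hηd] at s2
  rw [pc_one, gk_zero (by positivity)] at s1
  have h3 : 0.1063 * (1 / η) ≤ gk (6 * η + η) ρ.im := by
    unfold gk
    rw [mul_one_div, div_le_div_iff₀ hη0 (by positivity)]
    have : ρ.im ^ 2 ≤ (4.1 * η) ^ 2 := pow_le_pow_left₀ hγ.le hd 2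
    nlinarith
  have h4 : 1 / (6 * η) = 1 / 6 * (1 / η) := by rw [one_div_mul_one_div]
  have h5 : 6.397 * Real.log q ≤ 1 / η := by rw [le_div_iff₀ hη0]; exact hL
  have hLq : 1.0985 ≤ Real.log q := log_three_lower.trans
    (Real.log_le_log (by norm_num) (by exact_mod_cast hq))
  rw [h4] at s1
  norm_num at hη hE h3 h5 hLq s1 s2 hp
  linarith

theorem zero_real_nonneg (hq : 3 ≤ q) (χ : DirichletCharacter ℂ q) {ρ : ℂ} (h1 : ρ.re < 1)
    (hz : IsZ χ ρ) (hη : 1 - ρ.re ≤ 0.1424) (hγ : 0 ≤ ρ.im)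
    (hL : 6.397 * (Real.log q + Real.log (max 1 |ρ.im|)) * (1 - ρ.re) ≤ 1) :
    ρ.im = 0 ∧ χ ^ 2 = 1 ∧ χ ≠ 1 := by
  have hη0 : 0 < 1 - ρ.re := by linarith
  have hM : 0 ≤ Real.log (max 1 |ρ.im|) := Real.log_nonneg (le_max_left _ _)
  by_contra hcon
  by_cases hχ : χ = 1
  · subst hχ
    rcases le_total ρ.im (9.3 * (1 - ρ.re)) with h | h
    · exact zeta_case h1 hz hη hγ h
    · rw [abs_of_nonneg hγ] at hL
      refine main_contra hq 1 h1 hz hη hγ hL (fun _ => ?_) (fun _ => h)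
      linarith
  · by_cases h2 : χ ^ 2 = 1
    · have h3 : 0 < ρ.im := hγ.lt_of_ne fun h => hcon ⟨h.symm, h2, hχ⟩
      rcases le_total ρ.im (4.1 * (1 - ρ.re)) with h | h
      · refine real_case hq hχ h2 h1 hz hη h3 ?_ h
        refine le_trans ?_ hL
        have := mul_nonneg hM hη0.le
        linarith
      · rw [abs_of_nonneg hγ] at hL
        exact main_contra hq χ h1 hz hη hγ hL (fun _ => h) (fun h' => absurd h' hχ)
    · rw [abs_of_nonneg hγ] at hL
      exact main_contra hq χ h1 hz hη hγ hL (fun h' => absurd h' h2) (fun h' => absurd h' hχ)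

theorem zero_real (hq : 3 ≤ q) (χ : DirichletCharacter ℂ q) {ρ : ℂ} (h1 : ρ.re < 1)
    (hz : IsZ χ ρ) (hη : 1 - ρ.re ≤ 0.1424)
    (hL : 6.397 * (Real.log q + Real.log (max 1 |ρ.im|)) * (1 - ρ.re) ≤ 1) :
    ρ.im = 0 ∧ χ ^ 2 = 1 ∧ χ ≠ 1 := by
  rcases le_total 0 ρ.im with h | h
  · exact zero_real_nonneg hq χ h1 hz hη h hL
  · have hη' := hη
    norm_num at hη'
    obtain ⟨a, b, c⟩ := zero_real_nonneg hq χ⁻¹ (ρ := conj ρ) (by simpa using h1)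
      (isZ_conj χ (by linarith) h1 hz) (by simpa using hη) (by simpa using h) (by simpa using hL)
    refine ⟨by simpa using a, ?_, ?_⟩
    · rw [inv_pow, inv_eq_one] at b; exact b
    · intro h'; exact c (by rw [h', inv_one])

end

open Complex Filter Topology Metric ComplexConjugate

section
variable {q : ℕ} [NeZero q]

lemma inv_lower {a E η : ℝ} (ha : 0 < a) (hη : 0 < η) (hE : η ≤ E) :
    1 / (a + 1) * (1 / E) ≤ gk (a * E + η) 0 := by
  have hE0 : 0 < E := by linarith
  rw [gk_zero (by positivity), one_div_mul_one_div]
  exact one_div_le_one_div_of_le (by positivity) (by linarith)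

lemma log_q_lower (hq : 3 ≤ q) : 1.0985 ≤ Real.log q := log_three_lower.trans
    (Real.log_le_log (by norm_num) (by exact_mod_cast hq))

/-- size of the region at height zero -/
noncomputable def Eq0 (q : ℕ) : ℝ := 1 / (6.397 * Real.log q)

lemma Eq0_pos (hq : 3 ≤ q) : 0 < Eq0 q := by
  have := log_q_lower hq
  have : 0 < Real.log q := by norm_num at this; linarith
  unfold Eq0; positivity

lemma Eq0_le (hq : 3 ≤ q) : Eq0 q ≤ 0.1424 := by
  have := log_q_lower hq
  unfold Eq0
  rw [div_le_iff₀ (by norm_num at *; linarith)]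
  norm_num at *; linarith

lemma inv_Eq0 : 1 / Eq0 q = 6.397 * Real.log q := by
  unfold Eq0; rw [one_div_one_div]

lemma uniq_same (hq : 3 ≤ q) {χ : DirichletCharacter ℂ q} (hχ : χ ≠ 1) {ρ ρ' : ℂ}
    (hz : IsZ χ ρ) (hz' : IsZ χ ρ') (h1 : ρ.re < 1) (h1' : ρ'.re < 1)
    (hi : ρ.im = 0) (hi' : ρ'.im = 0) (hE : 1 - ρ.re ≤ Eq0 q) (hE' : 1 - ρ'.re ≤ Eq0 q) :
    ρ = ρ' := by
  by_contra hne
  have hE0 := Eq0_pos hq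
  have hEl := Eq0_le hq
  have hiE := inv_Eq0 (q := q)
  have hEg := Eg_zero
  have hLq := log_q_lower hq
  set E := Eq0 q
  have hp := pos_two (q := q) χ (σ := 1 + 6 * E) (by linarith)
  have s1 := Sval_le_empty (1 : DirichletCharacter ℂ q) (l := 6 * E) (τ := 0) (by positivity)
    (by norm_num at hEl; linarith)
  have s2 := Sval_le_two χ (l := 6 * E) (τ := 0) (by positivity)
    (Or.inl (by norm_num at hEl; linarith)) hz (by norm_num at hEl; linarith) hz'
    (by norm_num at hEl; linarith) hne
  rw [pc_one, gk_zero (by positivity), ← one_div_mul_one_div] at s1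
  rw [pc_ne hχ, hi, hi', sub_zero] at s2
  have b1 := inv_lower (a := 6) (by norm_num) (show 0 < 1 - ρ.re by linarith) hE
  have b2 := inv_lower (a := 6) (by norm_num) (show 0 < 1 - ρ'.re by linarith) hE'
  rw [hiE] at b1 b2 s1
  norm_num at b1 b2 s1 s2 hp hEg hEl hLq
  linarith

lemma uniq_simple (hq : 3 ≤ q) {χ : DirichletCharacter ℂ q} (hχ : χ ≠ 1) {ρ : ℂ}
    (hz : IsZ χ ρ) (h1 : ρ.re < 1) (hi : ρ.im = 0) (hE : 1 - ρ.re ≤ Eq0 q) :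
    deriv (xiG χ.primitiveCharacter) ρ ≠ 0 := by
  intro hd
  have hE0 := Eq0_pos hq
  have hEl := Eq0_le hq
  have hiE := inv_Eq0 (q := q)
  have hEg := Eg_zero
  have hLq := log_q_lower hq
  set E := Eq0 q
  have hp := pos_two (q := q) χ (σ := 1 + 6 * E) (by linarith)
  have s1 := Sval_le_empty (1 : DirichletCharacter ℂ q) (l := 6 * E) (τ := 0) (by positivity)
    (by norm_num at hEl; linarith)
  have s2 := Sval_le_dbl χ (l := 6 * E) (τ := 0) (by positivity)
    (Or.inl (by norm_num at hEl; linarith)) hz (by norm_num at hEl; linarith) hd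
  rw [pc_one, gk_zero (by positivity), ← one_div_mul_one_div] at s1
  rw [pc_ne hχ, hi, sub_zero] at s2
  have b1 := inv_lower (a := 6) (by norm_num) (show 0 < 1 - ρ.re by linarith) hE
  rw [hiE] at b1 s1
  norm_num at b1 s1 s2 hp hEg hEl hLq
  linarith

lemma uniq_diff (hq : 3 ≤ q) {χ ψ : DirichletCharacter ℂ q} (hχ : χ ≠ 1) (hψ : ψ ≠ 1)
    (hχ2 : χ ^ 2 = 1) (hψ2 : ψ ^ 2 = 1) {ρ ρ' : ℂ}
    (hz : IsZ χ ρ) (hz' : IsZ ψ ρ') (h1 : ρ.re < 1) (h1' : ρ'.re < 1)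
    (hi : ρ.im = 0) (hi' : ρ'.im = 0) (hE : 1 - ρ.re ≤ Eq0 q) (hE' : 1 - ρ'.re ≤ Eq0 q) :
    χ = ψ := by
  by_contra hne
  have hm : χ * ψ ≠ 1 := by
    intro h
    apply hne
    rw [mul_eq_one_iff_eq_inv] at h
    rw [h, inv_eq_iff_mul_eq_one, ← pow_two, hψ2]
  have hE0 := Eq0_pos hq
  have hEl := Eq0_le hq
  have hiE := inv_Eq0 (q := q)
  have hEg := Eg_zero
  have hLq := log_q_lower hq
  set E := Eq0 q
  have hl1 : 2.4 * E ≤ 1 := by norm_num at hEl ⊢; linarith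
  have hp := pos_four (q := q) hχ2 hψ2 (σ := 1 + 2.4 * E) (by linarith)
  have s1 := Sval_le_empty (1 : DirichletCharacter ℂ q) (l := 2.4 * E) (τ := 0) (by positivity) hl1
  have s4 := Sval_le_empty (χ * ψ) (l := 2.4 * E) (τ := 0) (by positivity) hl1
  have s2 := Sval_le_one χ (l := 2.4 * E) (τ := 0) (by positivity)
    (Or.inl hl1) hz (by norm_num at hEl; linarith)
  have s3 := Sval_le_one ψ (l := 2.4 * E) (τ := 0) (by positivity)
    (Or.inl hl1) hz' (by norm_num at hEl; linarith)
  rw [pc_one, gk_zero (by positivity), ← one_div_mul_one_div] at s1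
  rw [pc_ne hχ, hi, sub_zero] at s2
  rw [pc_ne hψ, hi', sub_zero] at s3
  rw [pc_ne hm] at s4
  have b1 := inv_lower (a := 2.4) (by norm_num) (show 0 < 1 - ρ.re by linarith) hE
  have b2 := inv_lower (a := 2.4) (by norm_num) (show 0 < 1 - ρ'.re by linarith) hE'
  rw [hiE] at b1 b2 s1
  norm_num at b1 b2 s1 s2 s3 s4 hp hEg hEl hLq
  linarith

lemma deriv_zero_of_mul {f g h : ℂ → ℂ} {ρ : ℂ} (he : f =ᶠ[𝓝 ρ] fun s => g s * h s)
    (hg : DifferentiableAt ℂ g ρ) (hh : DifferentiableAt ℂ h ρ) (h0 : h ρ = 0)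
    (h1 : deriv h ρ = 0) : deriv f ρ = 0 := by
  rw [he.deriv_eq, deriv_fun_mul hg hh, h0, h1]; simp

lemma eul_differentiable (χ : DirichletCharacter ℂ q) : Differentiable ℂ (eul χ) := by
  unfold eul
  refine Differentiable.fun_finset_prod fun p hp => ?_
  have hp' : (p : ℂ) ≠ 0 := by exact_mod_cast (Nat.prime_of_mem_primeFactors hp).ne_zero
  refine (differentiable_const _).sub ((differentiable_const _).mul ?_)
  intro s
  exact (differentiableAt_id.neg).const_cpow (Or.inl hp')

lemma deriv_LF_ne (χ : DirichletCharacter ℂ q) (hχ : χ ≠ 1) {ρ : ℂ} (h0 : 0 < ρ.re)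
    (h1 : ρ.re < 1) (hz : IsZ χ ρ) (hd : deriv (xiG χ.primitiveCharacter) ρ ≠ 0) :
    deriv (DirichletCharacter.LFunction χ) ρ ≠ 0 := by
  intro hL
  apply hd
  have hψ : χ.primitiveCharacter ≠ 1 := fun h => hχ ((prim_eq_one_iff χ).mp h)
  have hN : (χ.conductor : ℂ) ≠ 0 := by exact_mod_cast NeZero.ne χ.conductor
  have hx : xiG χ.primitiveCharacter = DirichletCharacter.xiC χ.primitiveCharacter := by
    unfold xiG; rw [if_neg hψ]
  rw [hx]
  refine deriv_zero_of_mul (g := fun s => (χ.conductor : ℂ) ^ (s / 2)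
      * Gammaℝ (s + DirichletCharacter.par χ.primitiveCharacter) * (eul χ s)⁻¹)
    (h := DirichletCharacter.LFunction χ) ?_ ?_ ?_ ?_ hL
  · have hU : {s : ℂ | 0 < s.re} ∩ {s : ℂ | s.re < 1} ∈ 𝓝 ρ :=
      ((isOpen_lt continuous_const Complex.continuous_re).inter
        (isOpen_lt Complex.continuous_re continuous_const)).mem_nhds ⟨h0, h1⟩
    filter_upwards [hU] with s hs
    rw [DirichletCharacter.xiC_eq hψ hs.1, LF_eq χ (ne_one_of_re hs.2)]
    have := eul_ne_zero χ hs.1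
    field_simp
  · have hre : 0 < (ρ + (DirichletCharacter.par χ.primitiveCharacter : ℂ)).re := by
      rcases DirichletCharacter.par_cases χ.primitiveCharacter with h | h <;> simp [h] <;> linarith
    refine DifferentiableAt.mul (DifferentiableAt.mul ?_ ?_) ?_
    · exact (differentiableAt_id.div_const 2).const_cpow (Or.inl hN)
    · exact (differentiableAt_Gammaℝ hre).comp ρ (differentiableAt_id.add_const _)
    · exact ((eul_differentiable χ) ρ).inv (eul_ne_zero χ h0)
  · exact (DirichletCharacter.differentiable_LFunction hχ) ρ
  · exact (isZ_iff χ h0 h1).mp hz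

lemma real_values {χ : DirichletCharacter ℂ q} (h : χ ^ 2 = 1) (n : ZMod q) : (χ n).im = 0 := by
  by_cases hn : IsUnit n
  · have h2 : (χ ^ 2) n = 1 := by rw [h, MulChar.one_apply hn]
    rw [MulChar.pow_apply' _ (by norm_num)] at h2
    have h3 : (χ n - 1) * (χ n + 1) = 0 := by linear_combination h2
    rcases mul_eq_zero.mp h3 with h | h
    · rw [show χ n = 1 by linear_combination h]; simp
    · rw [show χ n = -1 by linear_combination h]; simp
  · rw [MulChar.map_nonunit χ hn]; simp

lemma region_conv (hq : 3 ≤ q) {ρ : ℂ}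
    (h : 1 - 1 / (R0 * Real.log (max (q : ℝ) (q * |ρ.im|))) ≤ ρ.re) (h1 : ρ.re < 1) :
    1 - ρ.re ≤ 0.1424 ∧ 6.397 * (Real.log q + Real.log (max 1 |ρ.im|)) * (1 - ρ.re) ≤ 1
      ∧ (ρ.im = 0 → 1 - ρ.re ≤ Eq0 q) := by
  have hq0 : (0:ℝ) < q := by exact_mod_cast (by omega : 0 < q)
  have hm : max (q : ℝ) (q * |ρ.im|) = q * max 1 |ρ.im| := by
    rw [mul_max_of_nonneg _ _ hq0.le, mul_one]
  have hM : (1:ℝ) ≤ max 1 |ρ.im| := le_max_left _ _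
  rw [hm, Real.log_mul hq0.ne' (by linarith), R0] at h
  have hLq := log_q_lower hq
  have hLM := Real.log_nonneg hM
  set L := Real.log q + Real.log (max 1 |ρ.im|) with hL
  have hL1 : 1.0985 ≤ L := by linarith
  have hL0 : 0 < 6.397 * L := by norm_num at hL1 ⊢; linarith
  norm_num only at h
  have h2 : 1 - ρ.re ≤ 1 / (6.397 * L) := by norm_num only; linarith
  have h3 : 6.397 * L * (1 - ρ.re) ≤ 1 := by
    rw [le_div_iff₀ hL0] at h2; linarith
  refine ⟨?_, h3, ?_⟩
  · refine h2.trans ?_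
    rw [div_le_iff₀ hL0]; norm_num at hL1 ⊢; linarith
  · intro hi
    have : L = Real.log q := by rw [hL, hi]; simp
    rw [this] at h2
    exact h2

end

lemma pi_zero {q : ℕ} [NeZero q] (hq : 3 ≤ q) {ρ : ℂ} (h0 : PiProd q ρ = 0)
    (h : 1 - 1 / (R0 * Real.log (max (q : ℝ) (q * |ρ.im|))) ≤ ρ.re) (h1 : ρ.re < 1) :
    ∃ χ : DirichletCharacter ℂ q, DirichletCharacter.LFunction χ ρ = 0 := by
  unfold PiProd at h0
  obtain ⟨χ, _, hχ⟩ := Finset.prod_eq_zero_iff.mp h0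
  exact ⟨χ, hχ⟩

/-- all the information about a zero of a factor in the region -/
lemma zero_info {q : ℕ} [NeZero q] (hq : 3 ≤ q) {ρ : ℂ} {χ : DirichletCharacter ℂ q}
    (h0 : DirichletCharacter.LFunction χ ρ = 0)
    (h : 1 - 1 / (R0 * Real.log (max (q : ℝ) (q * |ρ.im|))) ≤ ρ.re) (h1 : ρ.re < 1) :
    IsZ χ ρ ∧ ρ.im = 0 ∧ χ ^ 2 = 1 ∧ χ ≠ 1 ∧ 1 - ρ.re ≤ Eq0 q ∧ 0 < ρ.re := by
  obtain ⟨a, b, c⟩ := region_conv hq h h1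
  have hr : 0 < ρ.re := by norm_num at a; linarith
  have hz := (isZ_iff χ hr h1).mpr h0
  obtain ⟨d, e, f⟩ := zero_real hq χ h1 hz a b
  exact ⟨hz, d, e, f, c d, hr⟩

/-- Lemma 2.1 (zero-free region, after Kadiri): `Π(s) = ∏_{χ mod q} L(s, χ)`
has at most one zero, counted with multiplicity, in the region
`1 - 1/(R0 log max{q, q|t|}) ≤ β < 1`; such a zero is real, simple, and is
a zero of `L(s, χ)` for a nonprincipal real character `χ` mod `q`. -/
theorem zero_free_region (q : ℕ) [NeZero q] (hq : 3 ≤ q) :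
    (∀ ρ1 ρ2 : ℂ, PiProd q ρ1 = 0 → PiProd q ρ2 = 0 →
      1 - 1 / (R0 * Real.log (max (q : ℝ) (q * |ρ1.im|))) ≤ ρ1.re → ρ1.re < 1 →
      1 - 1 / (R0 * Real.log (max (q : ℝ) (q * |ρ2.im|))) ≤ ρ2.re → ρ2.re < 1 →
      ρ1 = ρ2) ∧
    (∀ ρ : ℂ, PiProd q ρ = 0 →
      1 - 1 / (R0 * Real.log (max (q : ℝ) (q * |ρ.im|))) ≤ ρ.re → ρ.re < 1 →
      ρ.im = 0 ∧ deriv (PiProd q) ρ ≠ 0 ∧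
        ∃ χ : DirichletCharacter ℂ q, χ ≠ 1 ∧ (∀ n : ZMod q, (χ n).im = 0) ∧
          DirichletCharacter.LFunction χ ρ = 0) := by
  classical
  constructor
  · intro ρ1 ρ2 z1 z2 r1 s1 r2 s2
    obtain ⟨χ, hχ⟩ := pi_zero hq z1 r1 s1
    obtain ⟨ψ, hψ⟩ := pi_zero hq z2 r2 s2
    obtain ⟨a1, a2, a3, a4, a5, _⟩ := zero_info hq hχ r1 s1
    obtain ⟨b1, b2, b3, b4, b5, _⟩ := zero_info hq hψ r2 s2
    obtain rfl := uniq_diff hq a4 b4 a3 b3 a1 b1 s1 s2 a2 b2 a5 b5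
    exact uniq_same hq a4 a1 b1 s1 s2 a2 b2 a5 b5
  · intro ρ z r s
    obtain ⟨χ, hχ⟩ := pi_zero hq z r s
    obtain ⟨a1, a2, a3, a4, a5, a6⟩ := zero_info hq hχ r s
    refine ⟨a2, ?_, χ, a4, real_values a3, hχ⟩
    have hd := deriv_LF_ne χ a4 a6 s a1 (uniq_simple hq a4 a1 s a2 a5)
    have hother : ∀ ψ : DirichletCharacter ℂ q, ψ ≠ χ → DirichletCharacter.LFunction ψ ρ ≠ 0 := by
      intro ψ hne hψ
      obtain ⟨b1, b2, b3, b4, b5, _⟩ := zero_info hq hψ r s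
      exact hne (uniq_diff hq b4 a4 b3 a3 b1 a1 s s b2 a2 b5 a5)
    have hfun : PiProd q = fun s => DirichletCharacter.LFunction χ s *
        ∏ ψ ∈ Finset.univ.erase χ, DirichletCharacter.LFunction ψ s := by
      funext s
      unfold PiProd
      exact (Finset.mul_prod_erase _ _ (Finset.mem_univ χ)).symm
    have hdiff : ∀ ψ : DirichletCharacter ℂ q,
        DifferentiableAt ℂ (DirichletCharacter.LFunction ψ) ρ := fun ψ =>
      DirichletCharacter.differentiableAt_LFunction ψ ρ (Or.inl (ne_one_of_re s))
    have hprod : DifferentiableAt ℂ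
        (fun s => ∏ ψ ∈ Finset.univ.erase χ, DirichletCharacter.LFunction ψ s) ρ :=
      DifferentiableAt.fun_finset_prod fun ψ _ => hdiff ψ
    rw [hfun, deriv_fun_mul (hdiff χ) hprod, hχ, zero_mul, add_zero]
    refine mul_ne_zero hd (Finset.prod_ne_zero_iff.mpr fun ψ hψ => ?_)
    exact hother ψ (Finset.ne_of_mem_erase hψ)
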